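/- arXiv:1906.04325 — 2 statements merged into one kernel-verified Lean document; each statement's English description precedes it below -/
import Mathlib

section
/- Let k be a positive integer and let G be a multigraph whose number of edges is divisible by k and all of whose degrees are divisible by k. Let Q be the set of vertices v with d_G(v)/k odd. If d_G(X) ≥ 3k−2 for every vertex set X with |X ∩ Q| odd, then G can be edge-decomposed into k spanning subgraphs G_1, …, G_k with d_{G_i}(v) = d_G(v)/k for every vertex v and every i. -/
open Finset

variable {V E : Type*}

/-- Degree of `v` in the sub-multigraph given by the edge set `S`,
where `ends e` gives the two endpoints of edge `e` (loops count twice). -/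
def mdeg [DecidableEq V] (ends : E → V × V) (S : Finset E) (v : V) : ℕ :=
  (S.filter fun e => (ends e).1 = v).card + (S.filter fun e => (ends e).2 = v).card

/-- Number of edges with exactly one end in the vertex set `X`. -/
def cutCard [Fintype E] [DecidableEq V] (ends : E → V × V) (X : Finset V) : ℕ :=
  (univ.filter fun e : E =>
    ((ends e).1 ∈ X ∧ (ends e).2 ∉ X) ∨ ((ends e).1 ∉ X ∧ (ends e).2 ∈ X)).card

/-- `lam`-edge-connectedness: every edge cut has at least `lam` edges. -/
def EdgeConn [Fintype V] [Fintype E] [DecidableEq V] (ends : E → V × V) (lam : ℕ) : Prop :=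
  ∀ X : Finset V, X.Nonempty → X ≠ univ → lam ≤ cutCard ends X

set_option linter.unusedSectionVars false
namespace EF
universe u

/-- distance to zero in `ZMod (2 * k)` -/
def nm {k : ℕ} (a : ZMod (2 * k)) : ℕ := min a.val (2 * k - a.val)

section nm
variable {k : ℕ} [NeZero k]

lemma val_add_cases (a b : ZMod (2 * k)) :
    ((a + b).val = a.val + b.val ∧ a.val + b.val < 2 * k) ∨ (a + b).val + 2 * k = a.val + b.val := by
  by_cases h : a.val + b.val < 2 * k
  · exact Or.inl ⟨ZMod.val_add_of_lt h, h⟩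
  · right
    have := ZMod.val_add_val_of_le (not_lt.mp h)
    omega

lemma nm_add (a b : ZMod (2 * k)) : nm (a + b) ≤ nm a + nm b ∧ (nm (a + b) + nm a + nm b) % 2 = 0 := by
  have h1 := val_add_cases a b
  have h2 := ZMod.val_lt a
  have h3 := ZMod.val_lt b
  unfold nm
  omega

lemma nm_zero : nm (0 : ZMod (2 * k)) = 0 := by simp [nm]

lemma nm_neg (a : ZMod (2 * k)) : nm (-a) = nm a := by
  have h1 := val_add_cases a (-a)
  rw [add_neg_cancel, ZMod.val_zero] at h1
  have h2 := ZMod.val_lt a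
  have h3 := ZMod.val_lt (-a)
  unfold nm
  omega

lemma nm_eq_zero {a : ZMod (2 * k)} (h : nm a = 0) : a = 0 := by
  have h2 := ZMod.val_lt a
  unfold nm at h
  exact (ZMod.val_eq_zero a).mp (by omega)

lemma nm_le (a : ZMod (2 * k)) : nm a ≤ k := by unfold nm; omega

lemma nm_cast {n : ℕ} (h : n < 2 * k) : nm ((n : ℕ) : ZMod (2 * k)) = min n (2 * k - n) := by
  unfold nm; rw [ZMod.val_natCast_of_lt h]

lemma val_one' : (1 : ZMod (2 * k)).val = 1 := by
  have : 0 < k := Nat.pos_of_ne_zero (NeZero.ne k)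
  have h := ZMod.val_natCast_of_lt (n := 2 * k) (a := 1) (by omega)
  simpa using h

lemma nm_add_one (a : ZMod (2 * k)) : nm (a + 1) = nm a + 1 ∨ nm (a + 1) + 1 = nm a := by
  have h1 := val_add_cases a 1
  have h2 := ZMod.val_lt a
  rw [val_one'] at h1
  unfold nm
  omega

lemma nm_sub_one (a : ZMod (2 * k)) : nm (a - 1) = nm a + 1 ∨ nm (a - 1) + 1 = nm a := by
  have := nm_add_one (a - 1)
  rw [sub_add_cancel] at this
  omega

lemma nm_pos_sub {a : ZMod (2 * k)} (h : a.val ≤ k) (h0 : a ≠ 0) : nm (a - 1) + 1 = nm a := by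
  have h1 := val_add_cases (a - 1) 1
  have h2 := ZMod.val_lt a
  have h3 := ZMod.val_lt (a - 1)
  have h4 : a.val ≠ 0 := fun h => h0 ((ZMod.val_eq_zero a).mp h)
  rw [val_one', sub_add_cancel] at h1
  unfold nm
  omega

lemma nm_neg_add {a : ZMod (2 * k)} (h : k ≤ a.val) : nm (a + 1) + 1 = nm a := by
  have h1 := val_add_cases a 1
  have h2 := ZMod.val_lt a
  have : 0 < k := Nat.pos_of_ne_zero (NeZero.ne k)
  rw [val_one'] at h1
  unfold nm
  omega

lemma pos_cast {a : ZMod (2 * k)} (h : a.val ≤ k) : ((nm a : ℕ) : ZMod (2 * k)) = a := by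
  have : nm a = a.val := by unfold nm; omega
  rw [this, ZMod.natCast_zmod_val]

lemma pos_neg {a : ZMod (2 * k)} (h : k ≤ a.val) : (-a).val ≤ k := by
  have h1 := val_add_cases a (-a)
  rw [add_neg_cancel, ZMod.val_zero] at h1
  have h2 := ZMod.val_lt a
  have h3 := ZMod.val_lt (-a)
  have : 0 < k := Nat.pos_of_ne_zero (NeZero.ne k)
  omega

lemma nm_nat_parity (n : ℕ) : (nm ((n : ℕ) : ZMod (2 * k)) + n) % 2 = 0 := by
  induction n with
  | zero => simp [nm_zero]
  | succ n ih =>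
    push_cast
    have := nm_add_one ((n : ℕ) : ZMod (2 * k))
    omega

lemma nm_nat_le (n : ℕ) : nm ((n : ℕ) : ZMod (2 * k)) ≤ n := by
  induction n with
  | zero => simp [nm_zero]
  | succ n ih =>
    push_cast
    have := nm_add_one ((n : ℕ) : ZMod (2 * k))
    omega
end nm

section basic
variable {V : Type u} [Fintype V] [DecidableEq V] {k : ℕ}

/-- unit edge -/
def Ed (x y : V) : V → V → ℕ := fun a c => if (a = x ∧ c = y) ∨ (a = y ∧ c = x) then 1 else 0

lemma Ed_comm (x y a c : V) : Ed x y a c = Ed x y c a := by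
  unfold Ed; congr 1; grind

def dH (w : V → V → ℕ) (C : Finset V) : ℕ := ∑ x ∈ C, ∑ y ∈ Cᶜ, w x y

lemma dH_add (w w' : V → V → ℕ) (C : Finset V) : dH (w + w') C = dH w C + dH w' C := by
  simp [dH, sum_add_distrib]

lemma dH_Ed {x y : V} (h : x ≠ y) (C : Finset V) :
    dH (Ed x y) C = if x ∈ C then (if y ∈ C then 0 else 1) else (if y ∈ C then 1 else 0) := by
  have : ∀ a c, Ed x y a c = (if a = x then (if c = y then 1 else 0) else 0) + (if a = y then (if c = x then 1 else 0) else 0) := by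
    intro a c; unfold Ed; grind
  simp only [dH, this, sum_add_distrib]
  simp only [Finset.sum_ite_irrel, sum_const_zero, Finset.sum_ite_eq', mem_compl]
  grind

/-- total weight -/
def tw (w : V → V → ℕ) : ℕ := ∑ x, ∑ y, w x y

lemma tw_add (w w' : V → V → ℕ) : tw (w + w') = tw w + tw w' := by
  simp [tw, sum_add_distrib]

lemma tw_Ed {x y : V} (h : x ≠ y) : tw (Ed x y) = 2 := by
  have : ∀ a c, Ed x y a c = (if a = x then (if c = y then 1 else 0) else 0) + (if a = y then (if c = x then 1 else 0) else 0) := by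
    intro a c; unfold Ed; grind
  simp only [tw, this, sum_add_distrib]
  simp only [Finset.sum_ite_irrel, sum_const_zero, Finset.sum_ite_eq']
  simp

lemma split_Ed {w : V → V → ℕ} (hs : ∀ x y, w x y = w y x) {x y : V} (h : 0 < w x y) :
    ∃ w0 : V → V → ℕ, (∀ x y, w0 x y = w0 y x) ∧ w = w0 + Ed x y := by
  refine ⟨fun a c => w a c - Ed x y a c, fun a c => by
    change w a c - Ed x y a c = w c a - Ed x y c a
    rw [hs, Ed_comm], ?_⟩
  funext a c
  have : Ed x y a c ≤ w a c := by
    unfold Ed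
    split_ifs with h1
    · rcases h1 with ⟨rfl, rfl⟩ | ⟨rfl, rfl⟩
      · exact h
      · rw [hs]; exact h
    · exact Nat.zero_le _
  simp only [Pi.add_apply]
  omega

def Solv (w : V → V → ℕ) (b : V → ZMod (2 * k)) : Prop :=
  ∃ f : V → V → ℕ, (∀ x y, x ≠ y → f x y + f y x = w x y) ∧
    ∀ x, ∑ y, ((f x y : ZMod (2 * k)) - f y x) = b x

/-- one unit at x -/
def sg (x : V) : V → ZMod (2 * k) := fun a => if a = x then 1 else 0

lemma sum_sg (x : V) (C : Finset V) : ∑ a ∈ C, (sg x a : ZMod (2 * k)) = if x ∈ C then 1 else 0 := by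
  simp [sg]

lemma M1 {w : V → V → ℕ} {b : V → ZMod (2 * k)} {x y : V} (h : x ≠ y)
    (H : Solv w (b - sg x + sg y)) : Solv (w + Ed x y) b := by
  obtain ⟨f, h1, h2⟩ := H
  refine ⟨fun a c => f a c + if a = x ∧ c = y then 1 else 0, ?_, ?_⟩
  · intro a c hac
    have := h1 a c hac
    simp only [Pi.add_apply, Ed]
    grind
  · intro a
    have := h2 a
    have e : ∀ c, (((f a c + if a = x ∧ c = y then 1 else 0 : ℕ) : ZMod (2 * k)) -
       ((f c a + if c = x ∧ a = y then 1 else 0 : ℕ) : ZMod (2 * k)))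
       = ((f a c : ZMod (2 * k)) - f c a) + ((if c = y then (if a = x then 1 else 0) else 0) - (if c = x then (if a = y then 1 else 0) else 0)) := by
      intro c; push_cast
      split_ifs <;> first | (exfalso; grind) | ring
    simp only [e, sum_add_distrib, this, sum_sub_distrib, Finset.sum_ite_eq', mem_univ, if_true]
    simp only [Pi.add_apply, Pi.sub_apply, sg]
    ring

lemma M1' {w : V → V → ℕ} {b : V → ZMod (2 * k)} {x y : V} (h : x ≠ y)
    (H : Solv (w + Ed x y) b) : Solv w (b - sg x + sg y) ∨ Solv w (b + sg x - sg y) := by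
  obtain ⟨f, h1, h2⟩ := H
  have key : ∀ x y, x ≠ y → (∀ a c, a ≠ c → f a c + f c a = (w + Ed x y) a c) → 0 < f x y → Solv w (b - sg x + sg y) := by
    intro x y h h1 hp
    refine ⟨fun a c => f a c - if a = x ∧ c = y then 1 else 0, ?_, ?_⟩
    · intro a c hac
      have := h1 a c hac
      simp only [Pi.add_apply, Ed] at this
      grind
    · intro a
      have := h2 a
      have e : ∀ c, (((f a c - if a = x ∧ c = y then 1 else 0 : ℕ) : ZMod (2 * k)) -
         ((f c a - if c = x ∧ a = y then 1 else 0 : ℕ) : ZMod (2 * k)))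
         = ((f a c : ZMod (2 * k)) - f c a) - ((if c = y then (if a = x then 1 else 0) else 0) - (if c = x then (if a = y then 1 else 0) else 0)) := by
        intro c
        have e1 : ∀ a c, ((f a c - if a = x ∧ c = y then 1 else 0 : ℕ) : ZMod (2 * k)) = (f a c : ZMod (2 * k)) - if a = x ∧ c = y then 1 else 0 := by
          intro a c
          rw [Nat.cast_sub]
          · push_cast; rfl
          · grind
        rw [e1, e1]
        split_ifs <;> first | (exfalso; grind) | ring
      rw [Finset.sum_congr rfl (fun c _ => e c), sum_sub_distrib, this]
      simp only [sum_sub_distrib, Finset.sum_ite_eq', mem_univ, if_true]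
      simp only [Pi.add_apply, Pi.sub_apply, sg]
      ring
  have hxy := h1 x y h
  simp only [Pi.add_apply, Ed] at hxy
  rcases Nat.eq_zero_or_pos (f x y) with h0 | h0
  · right
    have : 0 < f y x := by grind
    have := key y x h.symm (by
      intro a c hac; rw [h1 a c hac]; simp only [Pi.add_apply, Ed]; grind) this
    convert this using 1
    ring
  · left; exact key x y h h1 h0

lemma Ed_swap (x y : V) : Ed x y = Ed y x := by
  funext a c; unfold Ed; grind

lemma M2 {w : V → V → ℕ} {b : V → ZMod (2 * k)} {v x y : V} (h : x ≠ y) (hx : v ≠ x) (hy : v ≠ y)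
    (H : Solv (w + Ed x y) b) : Solv (w + Ed v x + Ed v y) b := by
  rcases M1' h H with H | H
  · -- x → v → y
    apply M1 hy
    rw [Ed_swap v x]
    apply M1 hx.symm
    convert H using 1
    ring
  · rw [Ed_swap v y]
    apply M1 hy.symm
    apply M1 hx
    convert H using 1
    ring

end basic
end EF

set_option linter.unusedSectionVars false
namespace EF
universe u
section inst
variable {V : Type u} [Fintype V] [DecidableEq V] {k : ℕ}

def bt (b : V → ZMod (2 * k)) (o i : V → ℕ) : V → ZMod (2 * k) := fun x => b x - o x + i x

def DD (w : V → V → ℕ) (o i : V → ℕ) (C : Finset V) : ℕ := dH w C + ∑ x ∈ C, (o x + i x)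

structure Inst (weak : Prop) (ex : V → Prop) (w : V → V → ℕ) (b : V → ZMod (2 * k)) (o i : V → ℕ) :
    Prop where
  sym : ∀ x y, w x y = w y x
  sumb : ∑ x, b x = 0
  ex_sub : ∀ x y, ex x → ex y → x = y
  ex_zero : ∀ x, ex x → bt b o i x = 0
  ex_weak : weak → ∀ x, ¬ ex x
  par : ∀ C : Finset V, (nm (∑ x ∈ C, bt b o i x) + DD w o i C) % 2 = 0
  cut : ∀ C : Finset V, C.Nonempty → C ≠ univ → (weak ∧ ∑ x ∈ C, bt b o i x = 0) ∨
    (∃ v, ex v ∧ C = {v}) ∨ 2 * k + nm (∑ x ∈ C, bt b o i x) ≤ DD w o i C + 2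
  tot : DD w o i univ + 2 ≤ 2 * k + nm (∑ x, bt b o i x)
  wtot : weak → DD w o i univ = 0 ∨ ∑ x, bt b o i x ≠ 0

variable {weak : Prop} {ex : V → Prop} {w : V → V → ℕ} {b : V → ZMod (2 * k)} {o i : V → ℕ}

lemma dH_univ : dH w univ = 0 := by simp [dH]

lemma DD_compl (hs : ∀ x y, w x y = w y x) (C : Finset V) :
    DD w o i C + DD w o i Cᶜ = DD w o i univ + 2 * dH w C := by
  have h1 : dH w Cᶜ = dH w C := by
    unfold dH; rw [compl_compl, sum_comm]
    simp only [hs]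
  unfold DD
  rw [dH_univ, h1, ← sum_add_sum_compl C]
  ring

lemma step2_aux (h : Inst weak ex w b o i) {v : V} (hex : ∀ x, ex x → x = v) (hv : bt b o i v = 0)
    (hsl : ∀ C : Finset V, 2 ≤ C.card → C ≠ univ → (weak → ∑ x ∈ C, bt b o i x ≠ 0) →
      2 * k + nm (∑ x ∈ C, bt b o i x) ≤ DD w o i C)
    {w' : V → V → ℕ} {b' : V → ZMod (2 * k)} {o' i' : V → ℕ} (hs' : ∀ x y, w' x y = w' y x)
    (hb' : ∑ x, b' x = 0) (hbt : bt b' o' i' = bt b o i)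
    (hD : ∀ C, DD w' o' i' C = DD w o i C ∨
      (DD w' o' i' C + 2 = DD w o i C ∧ C ≠ univ ∧ (C = {v} ∨ 2 ≤ C.card))) :
    Inst weak (fun x => ¬ weak ∧ x = v) w' b' o' i' := by
  have hDu : DD w' o' i' univ = DD w o i univ := by
    rcases hD univ with h | h
    · exact h
    · exact absurd rfl h.2.1
  constructor
  · exact hs'
  · exact hb'
  · rintro x y ⟨_, rfl⟩ ⟨_, rfl⟩; rfl
  · rintro x ⟨_, rfl⟩; rw [hbt, hv]
  · rintro hw x ⟨h, _⟩; exact h hw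
  · intro C
    rw [hbt]
    have := h.par C
    have := hD C
    omega
  · intro C hC hCu
    rw [hbt]
    by_cases hCv : C = {v}
    · by_cases hw : weak
      · left; refine ⟨hw, ?_⟩; rw [hCv, sum_singleton, hv]
      · right; left; exact ⟨v, ⟨hw, rfl⟩, hCv⟩
    · by_cases hz : weak ∧ ∑ x ∈ C, bt b o i x = 0
      · left; exact hz
      · right; right
        have hcut : 2 * k + nm (∑ x ∈ C, bt b o i x) ≤ DD w o i C + 2 := by
          rcases h.cut C hC hCu with h1 | ⟨x, hx, h1⟩ | h1
          · exact absurd h1 hz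
          · rw [hex x hx] at h1; exact absurd h1 hCv
          · exact h1
        rcases hD C with h1 | ⟨h1, _, h2 | h2⟩
        · omega
        · exact absurd h2 hCv
        · have := hsl C h2 hCu (fun hw hc => hz ⟨hw, hc⟩)
          omega
  · rw [hbt, hDu]; exact h.tot
  · rw [hbt, hDu]; exact h.wtot

lemma card_cases {C : Finset V} {v : V} (hv : v ∈ C) : C = {v} ∨ 2 ≤ C.card := by
  have h1 := Finset.card_pos.mpr ⟨v, hv⟩
  by_cases h : C.card = 1
  · left
    obtain ⟨a, rfl⟩ := Finset.card_eq_one.mp h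
    simp at hv; rw [hv]
  · right; omega

/-- unit, natural valued -/
def sn (x : V) : V → ℕ := fun a => if a = x then 1 else 0

lemma sum_sn (x : V) (C : Finset V) : ∑ a ∈ C, sn x a = if x ∈ C then 1 else 0 := by
  simp [sn]

lemma cast_sn (x a : V) : ((sn x a : ℕ) : ZMod (2 * k)) = sg x a := by
  unfold sn sg; split_ifs <;> simp

lemma split_sn {o : V → ℕ} {x : V} (h : 0 < o x) : ∃ o0 : V → ℕ, o = o0 + sn x := by
  refine ⟨fun a => o a - sn x a, ?_⟩
  funext a
  have : sn x a ≤ o a := by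
    unfold sn; split_ifs with h1
    · rw [h1]; exact h
    · exact Nat.zero_le _
  simp only [Pi.add_apply]; omega

lemma DD_add (w w' : V → V → ℕ) (o o' i i' : V → ℕ) (C : Finset V) :
    DD (w + w') (o + o') (i + i') C = DD w o i C + DD w' o' i' C := by
  simp only [DD, dH_add, Pi.add_apply, sum_add_distrib]; ring

lemma DD_w (w w' : V → V → ℕ) (o i : V → ℕ) (C : Finset V) :
    DD (w + w') o i C = DD w o i C + dH w' C := by
  simp only [DD, dH_add]; ring

lemma DD_o (w : V → V → ℕ) (o o' i : V → ℕ) (C : Finset V) :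
    DD w (o + o') i C = DD w o i C + ∑ x ∈ C, o' x := by
  simp only [DD, Pi.add_apply, sum_add_distrib]; ring

lemma DD_i (w : V → V → ℕ) (o i i' : V → ℕ) (C : Finset V) :
    DD w o (i + i') C = DD w o i C + ∑ x ∈ C, i' x := by
  simp only [DD, Pi.add_apply, sum_add_distrib]; ring

lemma sum_shift {x y : V} (hb : ∑ x, b x = 0) : ∑ a, (b - sg x + sg y : V → ZMod (2 * k)) a = 0 := by
  simp only [Pi.add_apply, Pi.sub_apply, sum_add_distrib, sum_sub_distrib, hb, sum_sg]
  simp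

lemma step2_a (h : Inst weak ex w b o i) {v : V} (hex : ∀ x, ex x → x = v) (hv : bt b o i v = 0)
    (hsl : ∀ C : Finset V, 2 ≤ C.card → C ≠ univ → (weak → ∑ x ∈ C, bt b o i x ≠ 0) →
      2 * k + nm (∑ x ∈ C, bt b o i x) ≤ DD w o i C)
    (IH2 : ∀ ex (w' : V → V → ℕ) (b : V → ZMod (2 * k)) o i, tw w' < tw w → Inst weak ex w' b o i → Solv w' b)
    {u : V} (huv : v ≠ u) (hu : 0 < w v u) (ho : 0 < o v) : Solv w b := by
  obtain ⟨w0, hs0, rfl⟩ := split_Ed h.sym hu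
  obtain ⟨o0, rfl⟩ := split_sn ho
  apply M1 huv
  refine IH2 _ _ _ (o0 + sn u) i ?_ (step2_aux h hex hv hsl hs0 (sum_shift h.sumb) ?_ ?_)
  · rw [tw_add, tw_Ed huv]; omega
  · funext a
    simp only [bt, Pi.add_apply, Pi.sub_apply, Nat.cast_add, cast_sn]; ring
  · intro C
    rw [DD_w, DD_o, DD_o, sum_sn, sum_sn, dH_Ed huv]
    by_cases h1 : v ∈ C <;> by_cases h2 : u ∈ C <;> simp [h1, h2]
    refine Or.inr ⟨?_, card_cases h1⟩
    rintro rfl; simp at h2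

lemma step2_a' (h : Inst weak ex w b o i) {v : V} (hex : ∀ x, ex x → x = v) (hv : bt b o i v = 0)
    (hsl : ∀ C : Finset V, 2 ≤ C.card → C ≠ univ → (weak → ∑ x ∈ C, bt b o i x ≠ 0) →
      2 * k + nm (∑ x ∈ C, bt b o i x) ≤ DD w o i C)
    (IH2 : ∀ ex (w' : V → V → ℕ) (b : V → ZMod (2 * k)) o i, tw w' < tw w → Inst weak ex w' b o i → Solv w' b)
    {u : V} (huv : v ≠ u) (hu : 0 < w v u) (ho : 0 < i v) : Solv w b := by
  obtain ⟨w0, hs0, rfl⟩ := split_Ed h.sym hu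
  obtain ⟨i0, rfl⟩ := split_sn ho
  rw [Ed_swap]
  apply M1 huv.symm
  refine IH2 _ _ _ o (i0 + sn u) ?_ (step2_aux h hex hv hsl hs0 (sum_shift h.sumb) ?_ ?_)
  · rw [tw_add, tw_Ed huv]; omega
  · funext a
    simp only [bt, Pi.add_apply, Pi.sub_apply, Nat.cast_add, cast_sn]; ring
  · intro C
    rw [DD_w, DD_i, DD_i, sum_sn, sum_sn, dH_Ed huv]
    by_cases h1 : v ∈ C <;> by_cases h2 : u ∈ C <;> simp [h1, h2]
    refine Or.inr ⟨?_, card_cases h1⟩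
    rintro rfl; simp at h2

lemma step2_b (h : Inst weak ex w b o i) {v : V} (hex : ∀ x, ex x → x = v) (hv : bt b o i v = 0)
    (hsl : ∀ C : Finset V, 2 ≤ C.card → C ≠ univ → (weak → ∑ x ∈ C, bt b o i x ≠ 0) →
      2 * k + nm (∑ x ∈ C, bt b o i x) ≤ DD w o i C)
    (IH2 : ∀ ex (w' : V → V → ℕ) (b : V → ZMod (2 * k)) o i, tw w' < tw w → Inst weak ex w' b o i → Solv w' b)
    {u u' : V} (huv : v ≠ u) (huv' : v ≠ u') (huu : u ≠ u') (hu : 0 < w v u) (hu' : 0 < w v u') : Solv w b := by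
  obtain ⟨w1, hs1, rfl⟩ := split_Ed h.sym hu'
  have : 0 < w1 v u := by
    have : Ed v u' v u = 0 := by unfold Ed; grind
    simp only [Pi.add_apply, this] at hu; omega
  obtain ⟨w0, hs0, rfl⟩ := split_Ed hs1 this
  apply M2 huu huv huv'
  refine IH2 _ _ _ o i ?_ (step2_aux h hex hv hsl ?_ h.sumb rfl ?_)
  · rw [tw_add, tw_add, tw_add, tw_Ed huv, tw_Ed huu, tw_Ed huv']; omega
  · intro x y
    simp only [Pi.add_apply]
    rw [hs0, Ed_comm]
  · intro C
    rw [DD_w, DD_w, DD_w, dH_Ed huv, dH_Ed huv', dH_Ed huu]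
    by_cases h1 : v ∈ C <;> by_cases h2 : u ∈ C <;> by_cases h3 : u' ∈ C <;> simp [h1, h2, h3]
    · refine Or.inr ⟨?_, card_cases h1⟩
      rintro rfl; simp at h2
    · refine Or.inr ⟨?_, ?_⟩
      · rintro rfl; simp at h1
      · rcases card_cases h2 with h4 | h4
        · rw [h4] at h3; simp at h3; exact absurd h3.symm huu
        · right; exact h4

lemma step2_c (h : Inst weak ex w b o i) {v : V} (hex : ∀ x, ex x → x = v) (hv : bt b o i v = 0)
    (hcard : 2 ≤ Fintype.card V)
    (hn : ∀ u, v ≠ u → w v u = 0) : o v = 0 ∧ i v = 0 := by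
  by_contra hc
  have hc : 0 < o v + i v := by omega
  have hvc : ({v} : Finset V)ᶜ.Nonempty := by
    rw [← card_pos, card_compl, card_singleton]; omega
  have hvu : ({v} : Finset V)ᶜ ≠ univ := by
    intro h; have : v ∈ ({v} : Finset V)ᶜ := by rw [h]; simp
    simp at this
  have hD := DD_compl (o := o) (i := i) h.sym {v}
  have h1 : dH w {v} = 0 := by
    simp only [dH, sum_singleton]
    apply sum_eq_zero
    intro x hx
    simp at hx
    exact hn x (Ne.symm hx)
  have h2 : DD w o i {v} = o v + i v := by simp [DD, h1]
  have h3 : ∑ x ∈ ({v} : Finset V)ᶜ, bt b o i x = ∑ x, bt b o i x := by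
    rw [← sum_add_sum_compl {v}, sum_singleton, hv, zero_add]
  have ht := h.tot
  rcases h.cut _ hvc hvu with ⟨h4, h5⟩ | ⟨x, hx, h4⟩ | h4
  · rw [h3] at h5
    rcases h.wtot h4 with h6 | h6
    · omega
    · exact h6 h5
  · rw [hex x hx] at h4
    have : v ∈ ({v} : Finset V)ᶜ := by rw [h4]; simp
    simp at this
  · rw [h3] at h4; omega
end inst
end EF

set_option linter.unusedSectionVars false
namespace EF
universe u
section step3
variable {V : Type u} [Fintype V] [DecidableEq V] {k : ℕ} [NeZero k]
variable {ex : V → Prop} {w : V → V → ℕ} {b : V → ZMod (2 * k)} {o i : V → ℕ}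

lemma mkInst (hs : ∀ x y, w x y = w y x) (hb : ∑ x, b x = 0)
    (hpar : ∀ C : Finset V, (nm (∑ x ∈ C, bt b o i x) + DD w o i C) % 2 = 0)
    (hcut : ∀ C : Finset V, C.Nonempty → C ≠ univ →
       2 * k + nm (∑ x ∈ C, bt b o i x) ≤ DD w o i C + 2)
    (htot : DD w o i univ + 2 ≤ 2 * k + nm (∑ x, bt b o i x)) :
    Inst False (fun _ => False) w b o i :=
  ⟨hs, hb, by simp, by simp, by simp, hpar, fun C h1 h2 => Or.inr (Or.inr (hcut C h1 h2)), htot, by simp⟩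

lemma cut0 (h : Inst False ex w b o i) (hz : ∀ x, bt b o i x ≠ 0) (C : Finset V) (h1 : C.Nonempty)
    (h2 : C ≠ univ) : 2 * k + nm (∑ x ∈ C, bt b o i x) ≤ DD w o i C + 2 := by
  rcases h.cut C h1 h2 with h3 | ⟨v, h3, _⟩ | h3
  · exact h3.1.elim
  · exact absurd (h.ex_zero v h3) (hz v)
  · exact h3

lemma dH_pos (hk : 2 ≤ k) (h : Inst False ex w b o i) (hz : ∀ x, bt b o i x ≠ 0) (C : Finset V) (h1 : C.Nonempty)
    (h2 : C ≠ univ) : ∃ x ∈ C, ∃ y ∉ C, 0 < w x y := by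
  have a1 := cut0 h hz C h1 h2
  have a2 := cut0 h hz Cᶜ (by
    rw [← card_pos, card_compl]
    have := (card_lt_iff_ne_univ C).mpr h2
    omega) (by
    rintro h; rw [compl_eq_univ_iff] at h; rw [h] at h1; simp at h1)
  have a3 := DD_compl (o := o) (i := i) h.sym C
  have a4 := h.tot
  have a5 := (nm_add (∑ x ∈ C, bt b o i x) (∑ x ∈ Cᶜ, bt b o i x)).1
  rw [sum_add_sum_compl] at a5
  have a6 : dH w C ≠ 0 := by omega
  unfold dH at a6
  obtain ⟨x, hx, h6⟩ := exists_ne_zero_of_sum_ne_zero a6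
  obtain ⟨y, hy, h7⟩ := exists_ne_zero_of_sum_ne_zero h6
  exact ⟨x, hx, y, by simpa using hy, Nat.pos_of_ne_zero h7⟩

lemma step3_a (h : Inst False ex w b o i) (hz : ∀ x, bt b o i x ≠ 0)
    (hsl : ∀ C : Finset V, 2 ≤ C.card → C ≠ univ →
      2 * k + nm (∑ x ∈ C, bt b o i x) ≤ DD w o i C)
    (IH2 : ∀ ex (w' : V → V → ℕ) (b : V → ZMod (2 * k)) o i, tw w' < tw w → Inst False ex w' b o i → Solv w' b)
    {x y : V} (hxy : x ≠ y) (hw : 0 < w x y) (hx : (bt b o i x).val ≤ k) (hy : k ≤ (bt b o i y).val) :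
    Solv w b := by
  have hc0 := cut0 h hz
  obtain ⟨w0, hs0, rfl⟩ := split_Ed h.sym hw
  apply M1 hxy
  have hbt : bt (b - sg x + sg y) o i = bt b o i - sg x + sg y := by
    funext a; simp only [bt, Pi.add_apply, Pi.sub_apply]; ring
  have hB : ∀ C : Finset V, ∑ a ∈ C, bt (b - sg x + sg y) o i a
      = ∑ a ∈ C, bt b o i a - (if x ∈ C then 1 else 0) + if y ∈ C then 1 else 0 := by
    intro C
    rw [hbt]; simp only [Pi.add_apply, Pi.sub_apply, sum_add_distrib, sum_sub_distrib, sum_sg]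
  have n1 := nm_pos_sub hx (hz x)
  have n2 := nm_neg_add hy
  refine IH2 (fun _ => False) _ _ o i ?_ (mkInst hs0 (sum_shift h.sumb) ?_ ?_ ?_)
  · rw [tw_add, tw_Ed hxy]; omega
  · intro C
    have hp := h.par C
    rw [DD_w, dH_Ed hxy] at hp
    rw [hB]
    have m1 := nm_sub_one (∑ a ∈ C, bt b o i a)
    have m2 := nm_add_one (∑ a ∈ C, bt b o i a)
    by_cases h1 : x ∈ C <;> by_cases h2 : y ∈ C <;> simp [h1, h2] at hp ⊢ <;> omega
  · intro C hC hCu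
    have hc := hc0 C hC hCu
    have hs := hsl C
    rw [DD_w, dH_Ed hxy] at hc hs
    rw [hB]
    have m1 := nm_sub_one (∑ a ∈ C, bt b o i a)
    have m2 := nm_add_one (∑ a ∈ C, bt b o i a)
    by_cases h1 : x ∈ C <;> by_cases h2 : y ∈ C <;> simp [h1, h2] at hc hs ⊢
    · omega
    · rcases card_cases h1 with h3 | h3
      · subst h3
        simp only [sum_singleton] at *
        omega
      · have := hs h3 hCu
        omega
    · rcases card_cases h2 with h3 | h3
      · subst h3
        simp only [sum_singleton] at *
        omega
      · have := hs h3 hCu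
        omega
    · omega
  · have := h.tot
    rw [hB]
    rw [DD_w, dH_Ed hxy] at this
    simpa using this

lemma step3_c (h : Inst False ex w b o i) (hz : ∀ x, bt b o i x ≠ 0)
    (hsl : ∀ C : Finset V, 2 ≤ C.card → C ≠ univ →
      2 * k + nm (∑ x ∈ C, bt b o i x) ≤ DD w o i C)
    (IH3 : ∀ ex o' i', (∑ x, (o' x + i' x) < ∑ x, (o x + i x)) → Inst False ex w b o' i' → Solv w b)
    {x : V} (hi : 0 < i x) (hx : (bt b o i x).val ≤ k) :
    Solv w b := by
  have hc0 := cut0 h hz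
  obtain ⟨i0, rfl⟩ := split_sn hi
  have hbt : bt b o i0 = bt b o (i0 + sn x) - sg x := by
    funext a; simp only [bt, Pi.add_apply, Pi.sub_apply, Nat.cast_add, cast_sn]; ring
  have hB : ∀ C : Finset V, ∑ a ∈ C, bt b o i0 a
      = ∑ a ∈ C, bt b o (i0 + sn x) a - (if x ∈ C then 1 else 0) := by
    intro C
    rw [hbt]; simp only [Pi.sub_apply, sum_sub_distrib, sum_sg]
  have n1 := nm_pos_sub hx (hz x)
  refine IH3 (fun _ => False) o i0 ?_ (mkInst h.sym h.sumb ?_ ?_ ?_)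
  · simp only [Pi.add_apply, sum_add_distrib, sum_sn]; simp
  · intro C
    have hp := h.par C
    rw [DD_i, sum_sn] at hp
    rw [hB]
    have m1 := nm_sub_one (∑ a ∈ C, bt b o (i0 + sn x) a)
    by_cases h1 : x ∈ C <;> simp [h1] at hp ⊢ <;> omega
  · intro C hC hCu
    have hc := hc0 C hC hCu
    have hs := hsl C
    rw [DD_i, sum_sn] at hc hs
    rw [hB]
    have m1 := nm_sub_one (∑ a ∈ C, bt b o (i0 + sn x) a)
    by_cases h1 : x ∈ C <;> simp [h1] at hc hs ⊢
    · rcases card_cases h1 with h3 | h3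
      · subst h3
        simp only [sum_singleton] at *
        omega
      · have := hs h3 hCu
        omega
    · omega
  · have := h.tot
    rw [hB]
    rw [DD_i, sum_sn] at this
    have m1 := nm_sub_one (∑ a, bt b o (i0 + sn x) a)
    simp at this ⊢
    omega

lemma step3_d1 (h : Inst False ex w b o i) (hz : ∀ x, bt b o i x ≠ 0)
    (hsl : ∀ C : Finset V, 2 ≤ C.card → C ≠ univ →
      2 * k + nm (∑ x ∈ C, bt b o i x) ≤ DD w o i C)
    (IH2 : ∀ ex (w' : V → V → ℕ) (b : V → ZMod (2 * k)) o i, tw w' < tw w → Inst False ex w' b o i → Solv w' b)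
    {x y : V} (hxy : x ≠ y) (hw : 0 < w x y) (hy : (bt b o i y).val ≤ k)
    (ht : DD w o i univ + 4 ≤ 2 * k + nm (∑ x, bt b o i x)) :
    Solv w b := by
  have hc0 := cut0 h hz
  obtain ⟨w0, hs0, rfl⟩ := split_Ed h.sym hw
  rw [Ed_swap]
  apply M1 hxy.symm
  have hbt : bt (b - sg y + sg x) (o + sn x) i = bt b o i - sg y := by
    funext a; simp only [bt, Pi.add_apply, Pi.sub_apply, Nat.cast_add, cast_sn]; ring
  have hB : ∀ C : Finset V, ∑ a ∈ C, bt (b - sg y + sg x) (o + sn x) i a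
      = ∑ a ∈ C, bt b o i a - (if y ∈ C then 1 else 0) := by
    intro C
    rw [hbt]; simp only [Pi.sub_apply, sum_sub_distrib, sum_sg]
  have n1 := nm_pos_sub hy (hz y)
  refine IH2 (fun _ => False) _ _ (o + sn x) i ?_ (mkInst hs0 (sum_shift h.sumb) ?_ ?_ ?_)
  · rw [tw_add, tw_Ed hxy]; omega
  · intro C
    have hp := h.par C
    rw [DD_w, dH_Ed hxy] at hp
    rw [hB, DD_o, sum_sn]
    have m1 := nm_sub_one (∑ a ∈ C, bt b o i a)
    by_cases h1 : x ∈ C <;> by_cases h2 : y ∈ C <;> simp [h1, h2] at hp ⊢ <;> omega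
  · intro C hC hCu
    have hc := hc0 C hC hCu
    have hs := hsl C
    rw [DD_w, dH_Ed hxy] at hc hs
    rw [hB, DD_o, sum_sn]
    have m1 := nm_sub_one (∑ a ∈ C, bt b o i a)
    by_cases h1 : x ∈ C <;> by_cases h2 : y ∈ C <;> simp [h1, h2] at hc hs ⊢
    · omega
    · omega
    · rcases card_cases h2 with h3 | h3
      · subst h3
        simp only [sum_singleton] at *
        omega
      · have := hs h3 hCu
        omega
    · omega
  · rw [hB, DD_o, sum_sn]
    rw [DD_w, dH_Ed hxy] at ht
    have m1 := nm_sub_one (∑ a, bt b o i a)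
    simp at ht ⊢
    omega

lemma step3_d2 (hk : 2 ≤ k) (h : Inst False ex w b o i) (hz : ∀ x, bt b o i x ≠ 0)
    (hsl : ∀ C : Finset V, 2 ≤ C.card → C ≠ univ →
      2 * k + nm (∑ x ∈ C, bt b o i x) ≤ DD w o i C)
    (IH2 : ∀ ex (w' : V → V → ℕ) (b : V → ZMod (2 * k)) o i, tw w' < tw w → Inst False ex w' b o i → Solv w' b)
    {x y : V} (hxy : x ≠ y) (hw : 0 < w x y) (hx : (bt b o i x).val ≤ k) (hy : (bt b o i y).val ≤ k)
    (ht : DD w o i univ = 2 * k - 1) (ht' : ∑ x, bt b o i x = 1) :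
    Solv w b := by
  have hc0 := cut0 h hz
  obtain ⟨w0, hs0, rfl⟩ := split_Ed h.sym hw
  rw [Ed_swap]
  apply M1 hxy.symm
  obtain ⟨m, hm⟩ : ∃ m, m + nm (bt b o i x) = k := ⟨k - nm (bt b o i x), by have := nm_le (bt b o i x); omega⟩
  have hmk : m + 1 ≤ k := by
    have : nm (bt b o i x) ≠ 0 := fun h => hz x (nm_eq_zero h)
    omega
  have hbt : bt (b - sg y + sg x) o (i + fun a => m * sn x a) = bt b o i - sg y + fun a => ((m + 1 : ℕ) : ZMod (2 * k)) * sg x a := by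
    funext a; simp only [bt, Pi.add_apply, Pi.sub_apply, Nat.cast_add, Nat.cast_mul, cast_sn]; push_cast; ring
  have hB : ∀ C : Finset V, ∑ a ∈ C, bt (b - sg y + sg x) o (i + fun a => m * sn x a) a
      = ∑ a ∈ C, bt b o i a - (if y ∈ C then 1 else 0) + ((m + 1 : ℕ) : ZMod (2 * k)) * if x ∈ C then 1 else 0 := by
    intro C
    rw [hbt]; simp only [Pi.sub_apply, Pi.add_apply, sum_add_distrib, sum_sub_distrib, sum_sg, ← mul_sum]
  have hmm : (nm ((m : ℕ) : ZMod (2 * k))) = m := by rw [nm_cast (by omega)]; omega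
  have hmm1 : (nm ((m : ℕ) + 1 : ZMod (2 * k))) = m + 1 := by
    have := nm_cast (k := k) (n := m + 1) (by omega)
    push_cast at this
    rw [this]; omega
  have n1 := nm_pos_sub hy (hz y)
  have n2 : nm (bt b o i x + ((m : ZMod (2 * k)) + 1)) + 1 = k := by
    have : bt b o i x + ((m : ZMod (2 * k)) + 1) = ((k + 1 : ℕ) : ZMod (2 * k)) := by
      have e : ((k + 1 : ℕ) : ZMod (2 * k)) = ((m + nm (bt b o i x) + 1 : ℕ) : ZMod (2 * k)) := by
        congr 1; omega
      rw [e]; push_cast; rw [pos_cast hx]; ring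
    rw [this, nm_cast (by omega)]; omega
  refine IH2 (fun _ => False) _ _ o (i + fun a => m * sn x a) ?_ (mkInst hs0 (sum_shift h.sumb) ?_ ?_ ?_)
  · rw [tw_add, tw_Ed hxy]; omega
  · intro C
    have hp := h.par C
    rw [DD_w, dH_Ed hxy] at hp
    rw [hB, DD_i, ← mul_sum, sum_sn]
    have m1 := nm_sub_one (∑ a ∈ C, bt b o i a)
    have m2 := nm_add (∑ a ∈ C, bt b o i a) m
    have m3 := nm_add (∑ a ∈ C, bt b o i a) (m + 1)
    have m4 : ∑ a ∈ C, bt b o i a - 1 + (m + 1) = ∑ a ∈ C, bt b o i a + m := by ring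
    by_cases h1 : x ∈ C <;> by_cases h2 : y ∈ C <;> simp [h1, h2] at hp ⊢ <;> (try rw [m4]) <;> omega
  · intro C hC hCu
    have hc := hc0 C hC hCu
    have hs := hsl C
    rw [DD_w, dH_Ed hxy] at hc hs
    rw [hB, DD_i, ← mul_sum, sum_sn]
    have m1 := nm_sub_one (∑ a ∈ C, bt b o i a)
    have m2 := nm_add (∑ a ∈ C, bt b o i a) m
    have m3 := nm_add (∑ a ∈ C, bt b o i a) (m + 1)
    have m4 : ∑ a ∈ C, bt b o i a - 1 + (m + 1) = ∑ a ∈ C, bt b o i a + m := by ring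
    by_cases h1 : x ∈ C <;> by_cases h2 : y ∈ C <;> simp [h1, h2] at hc hs ⊢
    · omega
    · rcases card_cases h1 with h3 | h3
      · subst h3
        simp only [sum_singleton] at *
        omega
      · have := hs h3 hCu
        omega
    · rcases card_cases h2 with h3 | h3
      · subst h3
        simp only [sum_singleton] at *
        omega
      · have := hs h3 hCu
        omega
    · omega
  · rw [hB, DD_i, ← mul_sum, sum_sn]
    rw [DD_w, dH_Ed hxy] at ht
    rw [ht']
    simp at ht ⊢
    rw [hmm1]
    omega

lemma step3_pos (hk : 2 ≤ k) (hcard : 2 ≤ Fintype.card V) (h : Inst False ex w b o i) (hz : ∀ x, bt b o i x ≠ 0)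
    (hsl : ∀ C : Finset V, 2 ≤ C.card → C ≠ univ →
      2 * k + nm (∑ x ∈ C, bt b o i x) ≤ DD w o i C)
    (IH2 : ∀ ex (w' : V → V → ℕ) (b : V → ZMod (2 * k)) o i, tw w' < tw w → Inst False ex w' b o i → Solv w' b)
    (IH3 : ∀ ex o' i', (∑ x, (o' x + i' x) < ∑ x, (o x + i x)) → Inst False ex w b o' i' → Solv w b)
    (hpos : ∀ x, (bt b o i x).val ≤ k) : Solv w b := by
  by_cases hi : ∃ x, 0 < i x
  · obtain ⟨x, hx⟩ := hi
    exact step3_c h hz hsl IH3 hx (hpos x)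
  have hi0 : ∀ x, i x = 0 := by
    intro x; by_contra hc; exact hi ⟨x, Nat.pos_of_ne_zero hc⟩
  have : Nonempty V := Fintype.card_pos_iff.mp (by omega)
  obtain ⟨v⟩ := this
  obtain ⟨x, hx, y, hy, hw⟩ := dH_pos hk h hz {v} ⟨v, by simp⟩ (by
    intro h; have := congrArg card h; rw [card_singleton, card_univ] at this; omega)
  have hxy : x ≠ y := by rintro rfl; exact hy hx
  by_cases ht : DD w o i univ + 4 ≤ 2 * k + nm (∑ x, bt b o i x)
  · exact step3_d1 h hz hsl IH2 hxy hw (hpos y) ht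
  have hb : ∑ x, bt b o i x = -((DD w o i univ : ℕ) : ZMod (2 * k)) := by
    simp only [bt, DD, dH_univ, hi0, sum_add_distrib, sum_sub_distrib, h.sumb]
    push_cast; simp
  have htot := h.tot
  set s := DD w o i univ with hs
  have hnm : nm (∑ x, bt b o i x) = nm ((s : ℕ) : ZMod (2 * k)) := by rw [hb, nm_neg]
  rw [hnm] at ht htot
  have hp := nm_nat_parity (k := k) s
  have hle := nm_le ((s : ℕ) : ZMod (2 * k))
  have hs1 : s = 2 * k - 1 := by
    rcases lt_or_ge s (2 * k) with h1 | h1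
    · rw [nm_cast h1] at *; omega
    · obtain ⟨t, hst⟩ := Nat.exists_eq_add_of_le h1
      rw [hst] at hp hle ht htot
      have : (((2 * k + t : ℕ)) : ZMod (2 * k)) = (t : ZMod (2 * k)) := by
        rw [Nat.cast_add, ZMod.natCast_self, zero_add]
      rw [this] at hp hle ht htot
      have := nm_nat_le (k := k) t
      omega
  refine step3_d2 hk h hz hsl IH2 hxy hw (hpos x) (hpos y) hs1 ?_
  rw [hb, hs1, Nat.cast_sub (by omega), ZMod.natCast_self]; simp

lemma Solv_neg (h : Solv w (-b)) : Solv w b := by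
  obtain ⟨f, h1, h2⟩ := h
  refine ⟨fun x y => f y x, fun x y hxy => ?_, fun x => ?_⟩
  · have := h1 x y hxy; simp only; omega
  · have := h2 x
    rw [← neg_inj, ← Pi.neg_apply b, ← this, ← sum_neg_distrib]
    simp

lemma bt_neg (b : V → ZMod (2 * k)) (o i : V → ℕ) : bt (-b) i o = - bt b o i := by
  funext x; simp only [bt, Pi.neg_apply]; ring

lemma DD_swap (w : V → V → ℕ) (o i : V → ℕ) : DD w i o = DD w o i := by
  funext C; simp only [DD, add_comm]

lemma Inst_neg {weak : Prop} (h : Inst weak ex w b o i) : Inst weak ex w (-b) i o := by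
  obtain ⟨a1, a2, a3, a4, a5, a6, a7, a8, a9⟩ := h
  refine ⟨a1, by simpa using a2, a3, ?_, a5, ?_, ?_, ?_, ?_⟩ <;>
    simp only [bt_neg, DD_swap, Pi.neg_apply, sum_neg_distrib, nm_neg, neg_eq_zero, ne_eq] <;> assumption

lemma step3 (hk : 2 ≤ k) (hcard : 2 ≤ Fintype.card V) (h : Inst False ex w b o i) (hz : ∀ x, bt b o i x ≠ 0)
    (hsl : ∀ C : Finset V, 2 ≤ C.card → C ≠ univ →
      2 * k + nm (∑ x ∈ C, bt b o i x) ≤ DD w o i C)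
    (IH2 : ∀ ex (w' : V → V → ℕ) (b : V → ZMod (2 * k)) o i, tw w' < tw w → Inst False ex w' b o i → Solv w' b)
    (IH3 : ∀ ex o' i', (∑ x, (o' x + i' x) < ∑ x, (o x + i x)) → Inst False ex w b o' i' → Solv w b) :
    Solv w b := by
  by_cases h1 : ∀ x, (bt b o i x).val ≤ k
  · exact step3_pos hk hcard h hz hsl IH2 IH3 h1
  push Not at h1
  by_cases h2 : ∀ x, k ≤ (bt b o i x).val
  · apply Solv_neg
    refine step3_pos hk hcard (Inst_neg h) ?_ ?_ ?_ ?_ ?_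
    · intro x; rw [bt_neg]; simpa using hz x
    · simpa only [bt_neg, DD_swap, Pi.neg_apply, sum_neg_distrib, nm_neg] using hsl
    · exact IH2
    · intro ex o' i' hlt hI
      have := IH3 ex i' o' (by simpa only [add_comm] using hlt) (by simpa using Inst_neg hI)
      apply Solv_neg; simpa using this
    · intro x; rw [bt_neg]; exact pos_neg (h2 x)
  push Not at h2
  obtain ⟨p, hp⟩ := h1
  obtain ⟨q, hq⟩ := h2
  obtain ⟨x, hx, y, hy, hw⟩ := dH_pos hk h hz (univ.filter fun x => (bt b o i x).val ≤ k) ⟨q, by simp; omega⟩ (by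
    intro h; have : p ∈ (univ.filter fun x => (bt b o i x).val ≤ k) := by rw [h]; simp
    simp at this; omega)
  simp at hx hy
  exact step3_a h hz hsl IH2 (by rintro rfl; omega) hw hx (by omega)
end step3
end EF

set_option linter.unusedSectionVars false
namespace EF
universe u
section glue
variable {V : Type u} [Fintype V] [DecidableEq V] {k : ℕ}
variable {weak : Prop} {ex : V → Prop} {w : V → V → ℕ} {b : V → ZMod (2 * k)} {o i : V → ℕ}

def subw (w : V → V → ℕ) (A : Finset V) : {x // x ∈ A} → {x // x ∈ A} → ℕ := fun x y => w x y
def subb (w g : V → V → ℕ) (b : V → ZMod (2 * k)) (A : Finset V) : {x // x ∈ A} → ZMod (2 * k) :=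
  fun x => b x - ∑ y ∈ Aᶜ, ((g x y : ZMod (2 * k)) - (w x y - g x y : ℕ))
def subo (w g : V → V → ℕ) (o : V → ℕ) (A : Finset V) : {x // x ∈ A} → ℕ :=
  fun x => o x + ∑ y ∈ Aᶜ, (w x y - g x y)
def subi (g : V → V → ℕ) (i : V → ℕ) (A : Finset V) : {x // x ∈ A} → ℕ :=
  fun x => i x + ∑ y ∈ Aᶜ, g x y

def sm {A : Finset V} (C : Finset {x // x ∈ A}) : Finset V := C.map (Function.Embedding.subtype _)

lemma sub_bt (w g : V → V → ℕ) (b : V → ZMod (2 * k)) (o i : V → ℕ) (A : Finset V) (x : {x // x ∈ A}) :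
    bt (subb w g b A) (subo w g o A) (subi g i A) x = bt b o i x := by
  simp only [bt, subb, subo, subi, sum_sub_distrib]
  push_cast
  ring

lemma sub_B (w g : V → V → ℕ) (b : V → ZMod (2 * k)) (o i : V → ℕ) (A : Finset V) (C : Finset {x // x ∈ A}) :
    ∑ x ∈ C, bt (subb w g b A) (subo w g o A) (subi g i A) x = ∑ x ∈ sm C, bt b o i x := by
  simp only [sub_bt, sm, sum_map, Function.Embedding.subtype_apply]

lemma sm_compl {A : Finset V} (C : Finset {x // x ∈ A}) (F : V → ℕ) :
    ∑ y ∈ (sm C)ᶜ, F y = ∑ y ∈ Cᶜ, F y + ∑ y ∈ Aᶜ, F y := by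
  have h1 : ∑ y ∈ Cᶜ, F (y : V) = ∑ y ∈ sm Cᶜ, F y := by
    simp [sm]
  rw [h1, ← sum_union]
  · congr 1
    ext y
    simp only [sm, mem_compl, mem_map, Function.Embedding.subtype_apply, mem_union, Subtype.exists, exists_and_right, exists_eq_right]
    by_cases hy : y ∈ A <;> simp [hy]
  · rw [disjoint_left]
    intro y hy
    simp only [sm, mem_map, Function.Embedding.subtype_apply] at hy
    obtain ⟨a, _, rfl⟩ := hy
    simp

lemma sub_D {w g : V → V → ℕ} (hg : ∀ x y, g x y ≤ w x y) (o i : V → ℕ) (A : Finset V) (C : Finset {x // x ∈ A}) :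
    DD (subw w A) (subo w g o A) (subi g i A) C = DD w o i (sm C) := by
  have h0 : ∀ F : V → ℕ, ∑ x ∈ sm C, F x = ∑ x ∈ C, F x := by intro F; simp [sm]
  simp only [DD, dH]
  rw [h0, h0]
  simp only [sm_compl, ← sum_add_distrib]
  apply sum_congr rfl
  intro x _
  simp only [subo, subi, subw]
  have : ∑ y ∈ Aᶜ, w x y = ∑ y ∈ Aᶜ, (w x y - g x y) + ∑ y ∈ Aᶜ, g x y := by
    rw [← sum_add_distrib]
    apply sum_congr rfl
    intro y _
    have := hg x y
    omega
  omega

lemma sm_univ (A : Finset V) : sm (univ : Finset {x // x ∈ A}) = A := by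
  ext; simp [sm]

lemma sm_inj {A : Finset V} : Function.Injective (sm (A := A)) := Finset.map_injective _

lemma subInst {weak' : Prop} (h : Inst weak ex w b o i) (A : Finset V) {g : V → V → ℕ}
    (hg : ∀ x y, g x y ≤ w x y) (hb : ∑ x, subb w g b A x = 0)
    (hex : weak' → weak)
    (hcut : ∀ C, C ⊆ A → C ≠ A → C.Nonempty → (weak' ∧ ∑ x ∈ C, bt b o i x = 0) ∨
    (∃ v, ex v ∧ C = {v}) ∨ 2 * k + nm (∑ x ∈ C, bt b o i x) ≤ DD w o i C + 2)
    (htot : DD w o i A + 2 ≤ 2 * k + nm (∑ x ∈ A, bt b o i x))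
    (hwt : weak' → DD w o i A = 0 ∨ ∑ x ∈ A, bt b o i x ≠ 0) :
    Inst weak' (fun x => ex x.1) (subw w A) (subb w g b A) (subo w g o A) (subi g i A) := by
  constructor
  · intro x y; exact h.sym _ _
  · exact hb
  · intro x y hx hy; exact Subtype.ext (h.ex_sub _ _ hx hy)
  · intro x hx; rw [sub_bt]; exact h.ex_zero _ hx
  · intro hw x; exact h.ex_weak (hex hw) _
  · intro C; rw [sub_B, sub_D hg]; exact h.par _
  · intro C hC hCu
    rw [sub_B, sub_D hg]
    rcases hcut (sm C) (by intro x hx; simp [sm] at hx; exact hx.1) (by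
      intro h; exact hCu (sm_inj (h.trans (sm_univ A).symm))) (by simpa [sm] using hC) with h1 | ⟨v, h1, h2⟩ | h1
    · exact Or.inl h1
    · right; left
      have : v ∈ sm C := by rw [h2]; simp
      simp only [sm, mem_map, Function.Embedding.subtype_apply] at this
      obtain ⟨a, _, rfl⟩ := this
      refine ⟨a, h1, sm_inj ?_⟩
      rw [h2]; simp [sm]
    · exact Or.inr (Or.inr h1)
  · rw [sub_B, sub_D hg, sm_univ]; exact htot
  · rw [sub_B, sub_D hg, sm_univ]; exact hwt

section quot
variable {V' : Type u} [Fintype V'] [DecidableEq V']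

def qs {M : Type*} [AddCommMonoid M] (π : V → V') (F : V → M) : V' → M := fun p => ∑ x with π x = p, F x
def qw (π : V → V') (w : V → V → ℕ) : V' → V' → ℕ := fun p q => ∑ x with π x = p, ∑ y with π y = q, w x y
def pre (π : V → V') (C : Finset V') : Finset V := univ.filter fun x => π x ∈ C

lemma qs_sum {M : Type*} [AddCommMonoid M] (π : V → V') (F : V → M) (C : Finset V') :
    ∑ p ∈ C, qs π F p = ∑ x ∈ pre π C, F x := by
  unfold qs pre
  rw [← sum_fiberwise_of_maps_to (s := univ.filter fun x => π x ∈ C) (t := C) (g := π) (by simp)]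
  apply sum_congr rfl
  intro p hp
  rw [filter_filter]
  apply sum_congr _ (fun _ _ => rfl)
  ext x; simp; rintro rfl; exact hp

lemma pre_compl (π : V → V') (C : Finset V') : pre π Cᶜ = (pre π C)ᶜ := by
  ext; simp [pre]

lemma q_D (π : V → V') (C : Finset V') : DD (qw π w) (qs π o) (qs π i) C = DD w o i (pre π C) := by
  simp only [DD, dH, sum_add_distrib, qs_sum]
  congr 1
  rw [← pre_compl, ← qs_sum]
  apply sum_congr rfl
  intro p _
  simp only [qw, qs]
  rw [sum_comm]
  apply sum_congr rfl
  intro x _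
  rw [← qs_sum]
  rfl

lemma q_bt (π : V → V') : bt (qs π b) (qs π o) (qs π i) = qs π (bt b o i) := by
  funext p
  simp only [bt, qs, sum_add_distrib, sum_sub_distrib]
  push_cast; rfl

lemma pre_univ (π : V → V') : pre π univ = univ := by ext; simp [pre]

lemma quotInst (h : Inst weak ex w b o i) {π : V → V'} (hπ : Function.Surjective π) :
    Inst weak (fun p => ∃ v, ex v ∧ ∀ x, π x = p ↔ x = v) (qw π w) (qs π b) (qs π o) (qs π i) := by
  constructor
  · intro p q
    simp only [qw]
    rw [sum_comm]
    exact sum_congr rfl fun x _ => sum_congr rfl fun y _ => h.sym _ _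
  · rw [qs_sum, pre_univ]; exact h.sumb
  · rintro p q ⟨v, hv, hp⟩ ⟨v', hv', hq⟩
    have := h.ex_sub _ _ hv hv'
    subst this
    rw [← (hp v).mpr rfl, ← (hq v).mpr rfl]
  · rintro p ⟨v, hv, hp⟩
    rw [q_bt]
    simp only [qs, hp, filter_eq', mem_univ, if_true, sum_singleton]
    exact h.ex_zero v hv
  · rintro hw p ⟨v, hv, hp⟩
    exact h.ex_weak hw v hv
  · intro C; rw [q_bt, qs_sum, q_D]; exact h.par _
  · intro C hC hCu
    rw [q_bt, qs_sum, q_D]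
    rcases h.cut (pre π C) (by
      obtain ⟨p, hp⟩ := hC
      obtain ⟨x, rfl⟩ := hπ p
      exact ⟨x, by simp [pre, hp]⟩) (by
      intro hu
      apply hCu
      ext p; simp
      obtain ⟨x, rfl⟩ := hπ p
      have : x ∈ pre π C := by rw [hu]; simp
      simpa [pre] using this) with h1 | ⟨v, h1, h2⟩ | h1
    · exact Or.inl h1
    · right; left
      have hm : ∀ x, π x ∈ C ↔ x = v := by
        intro x
        have : x ∈ pre π C ↔ x ∈ ({v} : Finset V) := by rw [h2]
        simpa [pre] using this
      have hC : C = {π v} := by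
        ext p
        obtain ⟨x, rfl⟩ := hπ p
        rw [hm x, mem_singleton]
        constructor
        · rintro rfl; rfl
        · intro e; rw [← hm x, e, hm v]
      refine ⟨π v, ⟨v, h1, ?_⟩, hC⟩
      intro x
      rw [← hm x, hC, mem_singleton]
    · exact Or.inr (Or.inr h1)
  · rw [q_bt, qs_sum, q_D, pre_univ]; exact h.tot
  · rw [q_bt, qs_sum, q_D, pre_univ]; exact h.wtot
end quot

lemma split_sum (A : Finset V) (w : V → ℕ) (m : ℕ) (h : m ≤ ∑ x ∈ A, w x) :
    ∃ g : V → ℕ, (∀ x, g x ≤ w x) ∧ ∑ x ∈ A, g x = m := by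
  induction A using Finset.induction_on generalizing m with
  | empty => exact ⟨fun _ => 0, by simp, by simp at h ⊢; omega⟩
  | insert a A ha ih =>
    rw [sum_insert ha] at h
    obtain ⟨g, h1, h2⟩ := ih (m - min m (w a)) (by omega)
    refine ⟨fun x => if x = a then min m (w a) else g x, ?_, ?_⟩
    · intro x; dsimp only; split_ifs with hx
      · rw [hx]; omega
      · exact h1 x
    · rw [sum_insert ha, if_pos rfl]
      have : ∑ x ∈ A, (if x = a then min m (w a) else g x) = ∑ x ∈ A, g x := by
        apply sum_congr rfl
        intro x hx
        rw [if_neg]; rintro rfl; exact ha hx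
      rw [this, h2]; omega

def pj (A : Finset V) : V → Option {x // x ∉ A} := fun x => if h : x ∈ A then none else some ⟨x, h⟩

lemma pj_none {A : Finset V} (x : V) : pj A x = none ↔ x ∈ A := by
  unfold pj; split_ifs with h <;> simp [h]

lemma pj_some {A : Finset V} (x : V) (y : {x // x ∉ A}) : pj A x = some y ↔ x = y := by
  unfold pj; split_ifs with h
  · simp; rintro rfl; exact y.2 h
  · simp [Subtype.ext_iff]

lemma pj_surj {A : Finset V} (hA : A.Nonempty) : Function.Surjective (pj A) := by
  intro p
  cases p with
  | none => obtain ⟨x, hx⟩ := hA; exact ⟨x, (pj_none x).mpr hx⟩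
  | some y => exact ⟨y, (pj_some _ _).mpr rfl⟩

lemma card_quot {A : Finset V} (hA : 2 ≤ A.card) : Fintype.card (Option {x // x ∉ A}) < Fintype.card V := by
  rw [Fintype.card_option]
  have : Fintype.card {x // x ∉ A} = Aᶜ.card := by
    rw [Fintype.card_subtype]; congr 1; ext; simp
  rw [this, card_compl]
  have := card_le_univ A
  omega

lemma glue (hs : ∀ x y, w x y = w y x) (A : Finset V) (hq : Solv (qw (pj A) w) (qs (pj A) b))
    (H : ∀ g : V → V → ℕ, (∀ x y, g x y ≤ w x y) → ∑ x, subb w g b A x = 0 → Solv (subw w A) (subb w g b A)) :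
    Solv w b := by
  obtain ⟨f, hf1, hf2⟩ := hq
  have w1 : ∀ y : {x // x ∉ A}, qw (pj A) w none (some y) = ∑ x ∈ A, w x y := by
    intro y
    simp [qw, pj_none, pj_some, Finset.filter_eq']
  have w2 : ∀ x y : {x // x ∉ A}, qw (pj A) w (some x) (some y) = w x y := by
    intro x y
    simp [qw, pj_some, Finset.filter_eq']
  have b1 : qs (pj A) b none = ∑ x ∈ A, b x := by simp [qs, pj_none]
  have b2 : ∀ x : {x // x ∉ A}, qs (pj A) b (some x) = b x := by intro x; simp [qs, pj_some, Finset.filter_eq']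
  have hex : ∀ y : V, ∃ g : V → ℕ, (∀ x, g x ≤ w x y) ∧ (y ∉ A → ∑ x ∈ A, g x = f none (pj A y)) := by
    intro y
    by_cases hy : y ∈ A
    · exact ⟨fun _ => 0, by simp, fun h => absurd hy h⟩
    · have e : pj A y = some ⟨y, hy⟩ := (pj_some _ _).mpr rfl
      have h1 := hf1 none (some ⟨y, hy⟩) (by simp)
      rw [w1] at h1
      obtain ⟨g, hg1, hg2⟩ := split_sum A (fun x => w x y) (f none (pj A y)) (by rw [e]; dsimp only at h1 ⊢; omega)
      exact ⟨g, hg1, fun _ => hg2⟩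
  choose g' hg1 hg2 using hex
  let g : V → V → ℕ := fun x y => g' y x
  have hg : ∀ x y, g x y ≤ w x y := fun x y => hg1 y x
  have hn : ∀ y : {x // x ∉ A}, ((f none (some y) : ℕ) : ZMod (2 * k)) = ∑ x ∈ A, (g x y : ZMod (2 * k)) := by
    intro y
    have := hg2 y y.2
    rw [(pj_some y.1 y).mpr rfl] at this
    rw [← this]; push_cast; rfl
  have hn' : ∀ y : {x // x ∉ A}, ((f (some y) none : ℕ) : ZMod (2 * k)) = ∑ x ∈ A, ((w x y - g x y : ℕ) : ZMod (2 * k)) := by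
    intro y
    have h1 := hf1 none (some y) (by simp)
    rw [w1] at h1
    have h2 := hg2 y y.2
    rw [(pj_some y.1 y).mpr rfl] at h2
    have h3 : ∑ x ∈ A, w x y = ∑ x ∈ A, (w x y - g x y) + ∑ x ∈ A, g' y x := by
      rw [← sum_add_distrib]
      apply sum_congr rfl
      intro x _
      have := hg x y
      change w x y = w x y - g x y + g x y
      omega
    have h4 : f (some y) none = ∑ x ∈ A, (w x y - g x y) := by omega
    rw [h4]; push_cast; rfl
  have hsub : ∀ F : V → ZMod (2 * k), ∑ y : {x // x ∉ A}, F y = ∑ y ∈ Aᶜ, F y := by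
    intro F
    rw [sum_subtype Aᶜ (p := fun x => x ∉ A) (by simp)]
  have hsubA : ∀ F : V → ZMod (2 * k), ∑ y : {x // x ∈ A}, F y = ∑ y ∈ A, F y := by
    intro F
    rw [sum_subtype A (p := fun x => x ∈ A) (by simp)]
  have hb : ∑ x, subb w g b A x = 0 := by
    have h1 := hf2 none
    rw [b1, Fintype.sum_option, sub_self, zero_add] at h1
    simp only [hn, hn', ← sum_sub_distrib] at h1
    rw [hsub (fun y => ∑ x ∈ A, ((g x y : ZMod (2 * k)) - (w x y - g x y : ℕ))), sum_comm] at h1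
    simp only [subb]
    rw [hsubA (fun x => b x - ∑ y ∈ Aᶜ, ((g x y : ZMod (2 * k)) - (w x y - g x y : ℕ))), sum_sub_distrib, h1, sub_self]
  obtain ⟨f2, h21, h22⟩ := H g hg hb
  let F2 : V → V → ℕ := fun x y => if h : x ∈ A ∧ y ∈ A then f2 ⟨x, h.1⟩ ⟨y, h.2⟩ else 0
  have hF2 : ∀ x y : {x // x ∈ A}, F2 x y = f2 x y := by
    intro x y; simp [F2]
  refine ⟨fun x y => if x ∈ A then (if y ∈ A then F2 x y else g x y) else
    (if y ∈ A then w y x - g y x else f (pj A x) (pj A y)), ?_, ?_⟩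
  · intro x y hxy
    have := hg x y
    have := hg y x
    have := hs x y
    by_cases hx : x ∈ A <;> by_cases hy : y ∈ A <;> simp only [hx, hy, if_true, if_false]
    · have := h21 ⟨x, hx⟩ ⟨y, hy⟩ (by simpa using hxy)
      rw [← hF2, ← hF2] at this
      exact this
    · omega
    · omega
    · have e1 : pj A x = some ⟨x, hx⟩ := (pj_some _ _).mpr rfl
      have e2 : pj A y = some ⟨y, hy⟩ := (pj_some _ _).mpr rfl
      rw [e1, e2, hf1 _ _ (by simpa using hxy), w2]
  · intro x
    rw [← sum_add_sum_compl A]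
    by_cases hx : x ∈ A
    · have h1 := h22 ⟨x, hx⟩
      simp only [← hF2, subb] at h1
      rw [hsubA (fun y => (F2 x y : ZMod (2 * k)) - F2 y x)] at h1
      rw [sub_eq_iff_eq_add.mp h1.symm]
      rw [add_comm (∑ y ∈ A, _)]
      rw [add_comm (∑ y ∈ A, _)]
      congr 1
      · apply sum_congr rfl
        intro y hy
        simp only [mem_compl] at hy
        simp [hx, hy]
      · apply sum_congr rfl
        intro y hy
        simp [hx, hy]
    · have h1 := hf2 (some ⟨x, hx⟩)
      rw [b2, Fintype.sum_option, hn, hn', ← sum_sub_distrib] at h1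
      have e : ∀ x : {x // x ∉ A}, some x = pj A x := fun x => ((pj_some _ _).mpr rfl).symm
      simp only [e] at h1
      rw [hsub (fun y => (f (pj A x) (pj A y) : ZMod (2 * k)) - f (pj A y) (pj A x))] at h1
      rw [← h1]
      congr 1
      · apply sum_congr rfl
        intro y hy
        simp [hx, hy]
      · apply sum_congr rfl
        intro y hy
        simp only [mem_compl] at hy
        simp [hx, hy]
end glue
end EF

set_option linter.unusedSectionVars false
namespace EF
universe u
section main
variable {V : Type u} [Fintype V] [DecidableEq V] {k : ℕ} [NeZero k]
variable {weak : Prop} {ex : V → Prop} {w : V → V → ℕ} {b : V → ZMod (2 * k)} {o i : V → ℕ}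

lemma step2_d (h : Inst weak ex w b o i) {v u : V} (hv : bt b o i v = 0) (hvu : v ≠ u)
    (ho : o v = 0) (hi : i v = 0) (hn : ∀ y, v ≠ y → u ≠ y → w v y = 0)
    (IH1 : ∀ (V' : Type u) [Fintype V'] [DecidableEq V'], Fintype.card V' < Fintype.card V →
      ∀ (ex : V' → Prop) w (b : V' → ZMod (2 * k)) o i, Inst weak ex w b o i → Solv w b) : Solv w b := by
  have hcard : ({v, u} : Finset V).card = 2 := card_pair hvu
  apply glue h.sym {v, u}
  · exact IH1 _ (card_quot (by omega)) _ _ _ _ _ (quotInst h (pj_surj ⟨v, by simp⟩))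
  intro g hg hb
  have hbv : b v = 0 := by
    simpa [bt, ho, hi] using hv
  have hev : w v u % 2 = 0 := by
    have := h.par {v}
    rw [sum_singleton, hv, nm_zero] at this
    have e : DD w o i {v} = w v u := by
      simp only [DD, dH, sum_singleton, ho, hi]
      rw [sum_eq_single u]
      · rfl
      · intro y hy hyu
        simp at hy
        exact hn y (Ne.symm hy) (Ne.symm hyu)
      · intro hu; exact absurd (by simpa using hvu.symm) hu
    omega
  have hsv : subb w g b {v, u} ⟨v, by simp⟩ = 0 := by
    simp only [subb, hbv, zero_sub, neg_eq_zero]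
    apply sum_eq_zero
    intro y hy
    simp at hy
    have h1 := hn y (Ne.symm hy.1) (Ne.symm hy.2)
    have h2 := hg v y
    have h3 : g v y = 0 := by omega
    rw [h1, h3]; simp
  have hsu : subb w g b {v, u} ⟨u, by simp⟩ = 0 := by
    rw [← hb]
    have huniv : (univ : Finset {x // x ∈ ({v, u} : Finset V)}) = {⟨v, by simp⟩, ⟨u, by simp⟩} := by
      ext ⟨x, hx⟩; simp at hx; simp; tauto
    rw [huniv, sum_pair (by simpa using hvu), hsv, zero_add]
  refine ⟨fun x y => w x y / 2, ?_, ?_⟩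
  · rintro ⟨x, hx⟩ ⟨y, hy⟩ hxy
    have := h.sym v u
    simp at hx hy hxy
    simp only [subw]
    rcases hx with rfl | rfl <;> rcases hy with rfl | rfl
    · exact absurd rfl hxy
    · omega
    · omega
    · exact absurd rfl hxy
  · rintro ⟨x, hx⟩
    have : subb w g b {v, u} ⟨x, hx⟩ = 0 := by
      have hx' := hx
      simp at hx'
      rcases hx' with rfl | rfl
      · exact hsv
      · exact hsu
    rw [this]
    apply sum_eq_zero
    intro y _
    dsimp only
    rw [h.sym x y]; simp

lemma step2 (h : Inst weak ex w b o i) {v : V} (hex : ∀ x, ex x → x = v) (hv : bt b o i v = 0)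
    (hcard : 2 ≤ Fintype.card V)
    (hsl : ∀ C : Finset V, 2 ≤ C.card → C ≠ univ → (weak → ∑ x ∈ C, bt b o i x ≠ 0) →
      2 * k + nm (∑ x ∈ C, bt b o i x) ≤ DD w o i C)
    (IH1 : ∀ (V' : Type u) [Fintype V'] [DecidableEq V'], Fintype.card V' < Fintype.card V →
      ∀ (ex : V' → Prop) w (b : V' → ZMod (2 * k)) o i, Inst weak ex w b o i → Solv w b)
    (IH2 : ∀ ex (w' : V → V → ℕ) (b : V → ZMod (2 * k)) o i, tw w' < tw w → Inst weak ex w' b o i → Solv w' b) :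
    Solv w b := by
  by_cases hn : ∃ u, v ≠ u ∧ 0 < w v u
  · obtain ⟨u, huv, hu⟩ := hn
    by_cases ho : 0 < o v
    · exact step2_a h hex hv hsl IH2 huv hu ho
    by_cases hi : 0 < i v
    · exact step2_a' h hex hv hsl IH2 huv hu hi
    by_cases hn' : ∃ u', v ≠ u' ∧ u ≠ u' ∧ 0 < w v u'
    · obtain ⟨u', h1, h2, h3⟩ := hn'
      exact step2_b h hex hv hsl IH2 huv h1 h2 hu h3
    · refine step2_d h hv huv (by omega) (by omega) ?_ IH1
      intro y h1 h2
      by_contra h3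
      exact hn' ⟨y, h1, h2, Nat.pos_of_ne_zero h3⟩
  · have hn0 : ∀ u, v ≠ u → w v u = 0 := by
      intro u h1
      by_contra h3
      exact hn ⟨u, h1, Nat.pos_of_ne_zero h3⟩
    obtain ⟨ho, hi⟩ := step2_c h hex hv hcard hn0
    obtain ⟨u, hu⟩ := Fintype.exists_ne_of_one_lt_card (by omega : 1 < Fintype.card V) v
    exact step2_d h hv hu.symm ho hi (fun y h1 _ => hn0 y h1) IH1

lemma card_sub {A : Finset V} (hA : A ≠ univ) : Fintype.card {x // x ∈ A} < Fintype.card V := by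
  rw [Fintype.card_coe]; exact (card_lt_iff_ne_univ A).mpr hA

lemma step1 (h : Inst weak ex w b o i)
    (IH1 : ∀ (V' : Type u) [Fintype V'] [DecidableEq V'], Fintype.card V' < Fintype.card V →
      ∀ (ex : V' → Prop) w (b : V' → ZMod (2 * k)) o i, Inst weak ex w b o i → Solv w b) :
    Solv w b ∨ (∀ C : Finset V, 2 ≤ C.card → C ≠ univ → (weak → ∑ x ∈ C, bt b o i x ≠ 0) →
      2 * k + nm (∑ x ∈ C, bt b o i x) ≤ DD w o i C) := by
  by_cases hA : ∃ A : Finset V, 2 ≤ A.card ∧ A ≠ univ ∧ (weak → ∑ x ∈ A, bt b o i x ≠ 0) ∧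
      DD w o i A + 2 ≤ 2 * k + nm (∑ x ∈ A, bt b o i x)
  · left
    obtain ⟨A, h1, h2, h3, h4⟩ := hA
    apply glue h.sym A
    · exact IH1 _ (card_quot (by omega)) _ _ _ _ _ (quotInst h (pj_surj (card_pos.mp (by omega))))
    · intro g hg hb
      refine IH1 _ (card_sub h2) _ _ _ _ _ (subInst h A hg hb id ?_ h4 (fun hw => Or.inr (h3 hw)))
      intro C hC hCA hCn
      refine h.cut C hCn ?_
      rintro rfl
      exact h2 (univ_subset_iff.mp hC)
  · right
    intro C h1 h2 h3
    by_contra hc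
    apply hA
    refine ⟨C, h1, h2, h3, ?_⟩
    have hp := h.par C
    rcases h.cut C (card_pos.mp (by omega)) h2 with h4 | ⟨v, _, h4⟩ | h4
    · exact absurd h4.2 (h3 h4.1)
    · rw [h4] at h1; simp at h1
    · omega

lemma trivial_case (h : Inst weak ex w b o i) (hcard : Fintype.card V < 2) : Solv w b := by
  have hs : Subsingleton V := Fintype.card_le_one_iff_subsingleton.mp (by omega)
  refine ⟨fun _ _ => 0, fun x y hxy => absurd (Subsingleton.elim x y) hxy, ?_⟩
  intro x
  have := h.sumb
  have hu : (univ : Finset V) = {x} := by ext y; simp [Subsingleton.elim y x]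
  rw [hu, sum_singleton] at this
  rw [this]; simp

/-- Main strong statement. -/
theorem strong_main (hk : 2 ≤ k) (N : ℕ) : ∀ (V : Type u) [Fintype V] [DecidableEq V], Fintype.card V = N →
    ∀ (ex : V → Prop) w (b : V → ZMod (2 * k)) o i, Inst False ex w b o i → Solv w b := by
  induction N using Nat.strong_induction_on with
  | _ N IHN =>
  intro V _ _ hN
  have IH1 : ∀ (V' : Type u) [Fintype V'] [DecidableEq V'], Fintype.card V' < Fintype.card V →
      ∀ (ex : V' → Prop) w (b : V' → ZMod (2 * k)) o i, Inst False ex w b o i → Solv w b :=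
    fun V' _ _ hlt => IHN _ (hN ▸ hlt) V' rfl
  suffices H : ∀ M (ex : V → Prop) w (b : V → ZMod (2 * k)) o i, tw w = M → Inst False ex w b o i → Solv w b from
    fun ex w b o i h => H _ ex w b o i rfl h
  intro M
  induction M using Nat.strong_induction_on with
  | _ M IHM =>
  suffices H : ∀ L (ex : V → Prop) w (b : V → ZMod (2 * k)) o i, ∑ x, (o x + i x) = L → tw w = M → Inst False ex w b o i → Solv w b from
    fun ex w b o i hM h => H _ ex w b o i rfl hM h
  intro L
  induction L using Nat.strong_induction_on with
  | _ L IHL =>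
  intro ex w b o i hL hM h
  have IH2 : ∀ ex (w' : V → V → ℕ) (b : V → ZMod (2 * k)) o i, tw w' < tw w → Inst False ex w' b o i → Solv w' b :=
    fun ex w' b o i hlt hI => IHM _ (hM ▸ hlt) ex w' b o i rfl hI
  have IH3 : ∀ ex o' i', (∑ x, (o' x + i' x) < ∑ x, (o x + i x)) → Inst False ex w b o' i' → Solv w b :=
    fun ex o' i' hlt hI => IHL _ (hL ▸ hlt) ex w b o' i' rfl hM hI
  by_cases hcard : Fintype.card V < 2
  · exact trivial_case h hcard
  rcases step1 h IH1 with hS | hsl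
  · exact hS
  by_cases hex : ∃ v, ex v
  · obtain ⟨v, hv⟩ := hex
    exact step2 h (fun x hx => h.ex_sub _ _ hx hv) (h.ex_zero v hv) (by omega) hsl IH1 IH2
  by_cases hz : ∃ v, bt b o i v = 0
  · obtain ⟨v, hv⟩ := hz
    exact step2 h (fun x hx => absurd ⟨x, hx⟩ hex) hv (by omega) hsl IH1 IH2
  · exact step3 hk (by omega) h (fun x hx => hz ⟨x, hx⟩) (fun C h1 h2 => hsl C h1 h2 (fun h => h.elim)) IH2 IH3

theorem weak_main (hk : 2 ≤ k) (N : ℕ) : ∀ (V : Type u) [Fintype V] [DecidableEq V], Fintype.card V = N →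
    ∀ (ex : V → Prop) w (b : V → ZMod (2 * k)) o i, Inst True ex w b o i → Solv w b := by
  induction N using Nat.strong_induction_on with
  | _ N IHN =>
  intro V _ _ hN
  have IH1 : ∀ (V' : Type u) [Fintype V'] [DecidableEq V'], Fintype.card V' < Fintype.card V →
      ∀ (ex : V' → Prop) w (b : V' → ZMod (2 * k)) o i, Inst True ex w b o i → Solv w b :=
    fun V' _ _ hlt => IHN _ (hN ▸ hlt) V' rfl
  suffices H : ∀ M (ex : V → Prop) w (b : V → ZMod (2 * k)) o i, tw w = M → Inst True ex w b o i → Solv w b from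
    fun ex w b o i h => H _ ex w b o i rfl h
  intro M
  induction M using Nat.strong_induction_on with
  | _ M IHM =>
  intro ex w b o i hM h
  have IH2 : ∀ ex (w' : V → V → ℕ) (b : V → ZMod (2 * k)) o i, tw w' < tw w → Inst True ex w' b o i → Solv w' b :=
    fun ex w' b o i hlt hI => IHM _ (hM ▸ hlt) ex w' b o i rfl hI
  by_cases hcard : Fintype.card V < 2
  · exact trivial_case h hcard
  rcases step1 h IH1 with hS | hsl
  · exact hS
  by_cases hz : ∃ v, bt b o i v = 0
  · obtain ⟨v, hv⟩ := hz
    exact step2 h (fun x hx => absurd hx (h.ex_weak trivial x)) hv (by omega) hsl IH1 IH2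
  have hz' : ∀ v, bt b o i v ≠ 0 := fun x hx => hz ⟨x, hx⟩
  have hbig : ∀ C : Finset V, C.Nonempty → ∑ x ∈ C, bt b o i x = 0 → 2 ≤ C.card := by
    rintro C ⟨x, hx⟩ hC
    rcases card_cases hx with h1 | h1
    · rw [h1, sum_singleton] at hC; exact absurd hC (hz' x)
    · exact h1
  classical
  let S : Finset (Finset V) := univ.filter fun C => C.Nonempty ∧ C ≠ univ ∧ ∑ x ∈ C, bt b o i x = 0 ∧ DD w o i C + 2 ≤ 2 * k
  by_cases hS : S.Nonempty
  · obtain ⟨A, hAS, hmin⟩ := exists_min_image S card hS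
    simp only [S, mem_filter, mem_univ, true_and] at hAS hmin
    obtain ⟨h1, h2, h3, h4⟩ := hAS
    apply glue h.sym A
    · exact IH1 _ (card_quot (hbig A h1 h3)) _ _ _ _ _ (quotInst h (pj_surj h1))
    · intro g hg hb
      refine strong_main hk _ _ rfl _ _ _ _ _ (subInst (weak' := False) h A hg hb (fun h => h.elim) ?_ (by omega) (fun h => h.elim))
      intro C hC hCA hCn
      have hCu : C ≠ univ := by rintro rfl; exact h2 (univ_subset_iff.mp hC)
      right; right
      rcases h.cut C hCn hCu with h5 | ⟨v, h5, _⟩ | h5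
      · by_contra h6
        rw [h5.2, nm_zero] at h6
        have := hmin C ⟨hCn, hCu, h5.2, by omega⟩
        have := card_lt_card (ssubset_of_subset_of_ne hC hCA)
        omega
      · exact absurd h5 (h.ex_weak trivial v)
      · exact h5
  · refine strong_main hk _ _ rfl _ _ _ _ _ (mkInst h.sym h.sumb h.par ?_ h.tot)
    intro C hCn hCu
    rcases h.cut C hCn hCu with h5 | ⟨v, h5, _⟩ | h5
    · by_contra h6
      apply hS
      rw [h5.2, nm_zero] at h6
      exact ⟨C, by simp only [S, mem_filter, mem_univ, true_and]; exact ⟨hCn, hCu, h5.2, by omega⟩⟩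
    · exact absurd h5 (h.ex_weak trivial v)
    · exact h5
end main
end EF

-- BEGIN6
set_option linter.unusedSectionVars false
namespace EF
universe u
section konig
variable {ε α β : Type*} [DecidableEq ε] [DecidableEq α] [DecidableEq β]

lemma count_fibers {S : Finset ε} {p : ε → α} {L : Finset α} {k : ℕ}
    (hf : ∀ l ∈ L, (S.filter fun e => p e = l).card = k) :
    (S.filter fun e => p e ∈ L).card = L.card * k := by
  rw [card_eq_sum_card_fiberwise (f := p) (t := L) (by intro x; simp)]
  rw [sum_const_nat]
  intro l hl
  rw [filter_filter, ← hf l hl]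
  congr 1; ext e; simp; rintro _ rfl; exact hl

lemma matching {S : Finset ε} {p : ε → α} {q : ε → β} {L : Finset α} {R : Finset β} {k : ℕ}
    (hp : ∀ e ∈ S, p e ∈ L) (hq : ∀ e ∈ S, q e ∈ R)
    (hpf : ∀ l ∈ L, (S.filter fun e => p e = l).card = k + 1)
    (hqf : ∀ r ∈ R, (S.filter fun e => q e = r).card = k + 1) :
    ∃ M ⊆ S, (∀ l ∈ L, (M.filter fun e => p e = l).card = 1) ∧
      (∀ r ∈ R, (M.filter fun e => q e = r).card = 1) := by
  have hcards : L.card = R.card := by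
    have h1 := count_fibers hpf
    have h2 := count_fibers hqf
    rw [filter_true_of_mem hp] at h1
    rw [filter_true_of_mem hq] at h2
    exact Nat.eq_of_mul_eq_mul_right (Nat.succ_pos k) (h1.symm.trans h2)
  let t : {l // l ∈ L} → Finset β := fun l => (S.filter fun e => p e = l).image q
  have hall : ∀ s : Finset {l // l ∈ L}, s.card ≤ (s.biUnion t).card := by
    intro s
    have h1 : (S.filter fun e => p e ∈ s.map (Function.Embedding.subtype _)).card = s.card * (k + 1) := by
      rw [← card_map (Function.Embedding.subtype _) (s := s)]
      apply count_fibers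
      intro l hl
      simp at hl
      exact hpf l hl.1
    have h2 : (S.filter fun e => q e ∈ s.biUnion t).card = (s.biUnion t).card * (k + 1) := by
      apply count_fibers
      intro r hr
      simp only [mem_biUnion, t, mem_image, mem_filter] at hr
      obtain ⟨l, _, e, ⟨he, _⟩, rfl⟩ := hr
      exact hqf _ (hq e he)
    have h3 : (S.filter fun e => p e ∈ s.map (Function.Embedding.subtype _)) ⊆ (S.filter fun e => q e ∈ s.biUnion t) := by
      intro e he
      simp only [mem_filter, mem_map, Function.Embedding.subtype_apply] at he
      obtain ⟨he, a, ha, hae⟩ := he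
      simp only [mem_filter, mem_biUnion, t, mem_image]
      exact ⟨he, a, ha, e, ⟨he, hae.symm⟩, rfl⟩
    have h4 := card_le_card h3
    rw [h1, h2] at h4
    exact Nat.le_of_mul_le_mul_right h4 (Nat.succ_pos k)
  obtain ⟨m, hm1, hm2⟩ := (Finset.all_card_le_biUnion_card_iff_exists_injective t).mp hall
  have hm3 : ∀ l : {l // l ∈ L}, ∃ e, e ∈ S ∧ p e = l.1 ∧ q e = m l := by
    intro l
    have := hm2 l
    simp only [t, mem_image, mem_filter] at this
    obtain ⟨e, ⟨h1, h2⟩, h3⟩ := this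
    exact ⟨e, h1, h2, h3⟩
  choose ed he1 he2 he3 using hm3
  refine ⟨univ.image ed, ?_, ?_, ?_⟩
  · intro e he
    simp only [mem_image, mem_univ, true_and] at he
    obtain ⟨l, rfl⟩ := he
    exact he1 l
  · intro l hl
    rw [card_eq_one]
    refine ⟨ed ⟨l, hl⟩, ?_⟩
    ext e
    simp only [mem_filter, mem_image, mem_univ, true_and, mem_singleton]
    constructor
    · rintro ⟨⟨l', rfl⟩, h⟩
      congr 1
      rw [he2] at h
      exact Subtype.ext h
    · rintro rfl
      exact ⟨⟨_, rfl⟩, he2 _⟩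
  · intro r hr
    have himg : univ.image m = R := by
      apply eq_of_subset_of_card_le
      · intro x hx
        simp only [mem_image, mem_univ, true_and] at hx
        obtain ⟨l, rfl⟩ := hx
        rw [← he3]; exact hq _ (he1 l)
      · rw [card_image_of_injective _ hm1, card_univ, Fintype.card_coe, hcards]
    rw [← himg] at hr
    simp only [mem_image, mem_univ, true_and] at hr
    obtain ⟨l, rfl⟩ := hr
    rw [card_eq_one]
    refine ⟨ed l, ?_⟩
    ext e
    simp only [mem_filter, mem_image, mem_univ, true_and, mem_singleton]
    constructor
    · rintro ⟨⟨l', rfl⟩, h⟩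
      congr 1
      rw [he3] at h
      exact hm1 h
    · rintro rfl
      exact ⟨⟨_, rfl⟩, he3 _⟩

lemma konig {p : ε → α} {q : ε → β} {L : Finset α} {R : Finset β} (k : ℕ) : ∀ (S : Finset ε)
    (_ : ∀ e ∈ S, p e ∈ L) (_ : ∀ e ∈ S, q e ∈ R)
    (_ : ∀ l ∈ L, (S.filter fun e => p e = l).card = k)
    (_ : ∀ r ∈ R, (S.filter fun e => q e = r).card = k),
    ∃ c : ε → ℕ, (∀ e ∈ S, c e < k) ∧
      ∀ i < k, (∀ l ∈ L, (S.filter fun e => p e = l ∧ c e = i).card = 1) ∧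
        (∀ r ∈ R, (S.filter fun e => q e = r ∧ c e = i).card = 1) := by
  induction k with
  | zero =>
    intro S hp hq hpf hqf
    refine ⟨fun _ => 0, ?_, by simp⟩
    intro e he
    have := hpf _ (hp e he)
    rw [card_eq_zero] at this
    have h2 : e ∈ S.filter fun e' => p e' = p e := by simp [he]
    rw [this] at h2; simp at h2
  | succ k ih =>
    intro S hp hq hpf hqf
    obtain ⟨M, hMS, hM1, hM2⟩ := matching hp hq hpf hqf
    have hsd : ∀ (P : ε → Prop) [DecidablePred P], ((S \ M).filter P).card + (M.filter P).card = (S.filter P).card := by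
      intro P _
      rw [← card_union_of_disjoint]
      · rw [← filter_union, sdiff_union_of_subset hMS]
      · exact disjoint_filter_filter sdiff_disjoint
    obtain ⟨c, hc1, hc2⟩ := ih (S \ M) (fun e he => hp e (mem_sdiff.mp he).1) (fun e he => hq e (mem_sdiff.mp he).1)
      (fun l hl => by have := hsd (fun e => p e = l); rw [hM1 l hl, hpf l hl] at this; omega)
      (fun r hr => by have := hsd (fun e => q e = r); rw [hM2 r hr, hqf r hr] at this; omega)
    refine ⟨fun e => if e ∈ M then k else c e, ?_, ?_⟩
    · intro e he
      dsimp only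
      split_ifs with h
      · omega
      · have := hc1 e (mem_sdiff.mpr ⟨he, h⟩); omega
    · have key : ∀ P : ε → Prop, ∀ [DecidablePred P], ∀ i < k + 1, (S.filter fun e => P e ∧ (if e ∈ M then k else c e) = i) =
          if i = k then M.filter P else (S \ M).filter fun e => P e ∧ c e = i := by
        intro P _ i hi
        ext e
        have h1 := hc1 e
        have h2 : e ∈ M → e ∈ S := fun h => hMS h
        split_ifs with hik
        · simp only [mem_filter]; simp only [mem_sdiff] at h1; grind
        · simp only [mem_filter, mem_sdiff]; grind
      intro i hi
      refine ⟨fun l hl => ?_, fun r hr => ?_⟩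
      · rw [key _ i hi]
        split_ifs with hik
        · exact hM1 l hl
        · exact (hc2 i (by omega)).1 l hl
      · rw [key _ i hi]
        split_ifs with hik
        · exact hM2 r hr
        · exact (hc2 i (by omega)).2 r hr

lemma slots (k : ℕ) (a : ℕ) : ∀ F : Finset ε, F.card = k * a →
    ∃ s : ε → ℕ, (∀ e ∈ F, s e < a) ∧ ∀ j < a, (F.filter fun e => s e = j).card = k := by
  induction a with
  | zero => intro F hF; refine ⟨fun _ => 0, ?_, by simp⟩; rw [mul_zero, card_eq_zero] at hF; simp [hF]
  | succ a ih =>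
    intro F hF
    obtain ⟨T, hT1, hT2⟩ := exists_subset_card_eq (s := F) (n := k) (by rw [hF]; exact Nat.le_mul_of_pos_right k (Nat.succ_pos a))
    obtain ⟨s, hs1, hs2⟩ := ih (F \ T) (by rw [card_sdiff_of_subset hT1, hF, hT2, Nat.mul_succ]; omega)
    refine ⟨fun e => if e ∈ T then a else s e, ?_, ?_⟩
    · intro e he
      dsimp only
      split_ifs with h
      · omega
      · have := hs1 e (mem_sdiff.mpr ⟨he, h⟩); omega
    · intro j hj
      have : (F.filter fun e => (if e ∈ T then a else s e) = j) = if j = a then T else (F \ T).filter fun e => s e = j := by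
        ext e
        have h1 := hs1 e
        have h2 : e ∈ T → e ∈ F := fun h => hT1 h
        split_ifs with hik
        · simp only [mem_filter]; simp only [mem_sdiff] at h1; grind
        · simp only [mem_filter, mem_sdiff]; grind
      rw [this]
      split_ifs with h
      · exact hT2
      · exact hs2 j (by omega)

lemma slotmap {V : Type*} [DecidableEq V] [Fintype ε] (t : ε → V) (k : ℕ)
    (h : ∀ v, k ∣ (univ.filter fun e => t e = v).card) :
    ∃ p : ε → V × ℕ, (∀ l ∈ univ.image p, (univ.filter fun e => p e = l).card = k) ∧
      ∀ c : ε → ℕ, ∀ i, 0 < k → (∀ l ∈ univ.image p, (univ.filter fun e => p e = l ∧ c e = i).card = 1) →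
        ∀ v, (univ.filter fun e => t e = v ∧ c e = i).card = (univ.filter fun e => t e = v).card / k := by
  choose a ha using h
  have hs := fun v => slots k (a v) _ (ha v)
  choose s hs1 hs2 using hs
  have hlt : ∀ e, s (t e) e < a (t e) := fun e => hs1 (t e) e (by simp)
  have hfib : ∀ v j, j < a v → (univ.filter fun e => (t e, s (t e) e) = (v, j)).card = k := by
    intro v j hj
    rw [← hs2 v j hj]
    congr 1; ext e; simp; rintro rfl; rfl
  refine ⟨fun e => (t e, s (t e) e), ?_, ?_⟩
  · intro l hl
    simp only [mem_image, mem_univ, true_and] at hl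
    obtain ⟨e, rfl⟩ := hl
    exact hfib _ _ (hlt e)
  · intro c i hk hc v
    rw [ha v, Nat.mul_div_cancel_left _ hk]
    rw [card_eq_sum_card_fiberwise (f := fun e => s (t e) e) (t := range (a v))]
    · rw [sum_const_nat (m := 1), card_range, mul_one]
      intro j hj
      rw [mem_range] at hj
      rw [← hc (v, j)]
      · rw [filter_filter]; congr 1; ext e; simp; tauto
      · have : 0 < (univ.filter fun e => (t e, s (t e) e) = (v, j)).card := by rw [hfib v j hj]; exact hk
        obtain ⟨e, he⟩ := card_pos.mp this
        simp only [mem_filter, mem_univ, true_and] at he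
        exact mem_image.mpr ⟨e, mem_univ _, he⟩
    · intro e he
      simp at he
      simp
      rw [← he.1]; exact hlt e

lemma color {V : Type*} [DecidableEq V] [Fintype ε] (t h : ε → V) {k : ℕ} (hk : 0 < k)
    (ht : ∀ v, k ∣ (univ.filter fun e => t e = v).card)
    (hh : ∀ v, k ∣ (univ.filter fun e => h e = v).card) :
    ∃ c : ε → Fin k, ∀ v i, (univ.filter fun e => t e = v ∧ c e = i).card = (univ.filter fun e => t e = v).card / k ∧
      (univ.filter fun e => h e = v ∧ c e = i).card = (univ.filter fun e => h e = v).card / k := by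
  obtain ⟨p, hp1, hp2⟩ := slotmap t k ht
  obtain ⟨q, hq1, hq2⟩ := slotmap h k hh
  obtain ⟨c, hc1, hc2⟩ := konig k univ (fun e _ => mem_image_of_mem p (mem_univ e)) (fun e _ => mem_image_of_mem q (mem_univ e)) hp1 hq1
  refine ⟨fun e => ⟨c e, hc1 e (mem_univ e)⟩, fun v i => ?_⟩
  simp only [Fin.ext_iff]
  exact ⟨hp2 c i hk (hc2 i i.2).1 v, hq2 c i hk (hc2 i i.2).2 v⟩
end konig

section app
variable {V : Type u} [Fintype V] [DecidableEq V] {ε : Type*} [DecidableEq ε] {k : ℕ}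

/-- weight function of an edge set, loops dropped -/
def wS (ends : ε → V × V) (S : Finset ε) : V → V → ℕ :=
  ∑ e ∈ S, if (ends e).1 = (ends e).2 then 0 else Ed (ends e).1 (ends e).2

lemma orient (ends : ε → V × V) (S : Finset ε) : ∀ b : V → ZMod (2 * k), Solv (wS ends S) b →
    ∃ r : ε → Bool, ∀ x, ∑ e ∈ S, ((sg (if r e then (ends e).1 else (ends e).2) x : ZMod (2 * k)) -
      sg (if r e then (ends e).2 else (ends e).1) x) = b x := by
  induction S using Finset.induction_on with
  | empty =>
    rintro b ⟨f, h1, h2⟩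
    refine ⟨fun _ => true, fun x => ?_⟩
    rw [← h2 x, sum_empty, eq_comm]
    apply sum_eq_zero
    intro y _
    by_cases hxy : x = y
    · rw [hxy, sub_self]
    · have := h1 x y hxy
      simp only [wS, sum_empty, Pi.zero_apply] at this
      have e1 : f x y = 0 := by omega
      have e2 : f y x = 0 := by omega
      rw [e1, e2, sub_self]
  | insert e S he ih =>
    intro b hb
    have hw : wS ends (insert e S) = wS ends S + if (ends e).1 = (ends e).2 then 0 else Ed (ends e).1 (ends e).2 := by
      rw [wS, sum_insert he, add_comm]; rfl
    rw [hw] at hb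
    have key : ∀ (b' : V → ZMod (2 * k)) (ρ : Bool), Solv (wS ends S) b' →
        (∀ x, b x = b' x + ((sg (if ρ then (ends e).1 else (ends e).2) x : ZMod (2 * k)) -
      sg (if ρ then (ends e).2 else (ends e).1) x)) → ∃ r : ε → Bool, ∀ x, ∑ e ∈ insert e S, ((sg (if r e then (ends e).1 else (ends e).2) x : ZMod (2 * k)) -
      sg (if r e then (ends e).2 else (ends e).1) x) = b x := by
      intro b' ρ hS hx
      obtain ⟨r, hr⟩ := ih b' hS
      refine ⟨fun e' => if e' = e then ρ else r e', fun x => ?_⟩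
      rw [sum_insert he, hx, ← hr x, add_comm]
      congr 1
      · apply sum_congr rfl
        intro e' he'
        have : e' ≠ e := by rintro rfl; exact he he'
        simp only [this, if_false]
      · simp
    split_ifs at hb with hl
    · rw [add_zero] at hb
      refine key b true hb (fun x => ?_)
      simp [hl]
    · rcases M1' hl hb with h | h
      · refine key _ true h (fun x => ?_)
        simp
      · refine key _ false h (fun x => ?_)
        simp

lemma dH_sum (S : Finset ε) (F : ε → V → V → ℕ) (C : Finset V) : dH (∑ e ∈ S, F e) C = ∑ e ∈ S, dH (F e) C := by
  induction S using Finset.induction_on with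
  | empty => simp [dH]
  | insert e S he ih => rw [sum_insert he, sum_insert he, dH_add, ih]

lemma dH_wS [Fintype ε] (ends : ε → V × V) (C : Finset V) : dH (wS ends univ) C = cutCard ends C := by
  rw [wS, dH_sum, cutCard, card_filter]
  apply sum_congr rfl
  intro e _
  by_cases hl : (ends e).1 = (ends e).2
  · rw [if_pos hl, hl]; simp [dH]
  · rw [if_neg hl, dH_Ed hl]
    by_cases h1 : (ends e).1 ∈ C <;> by_cases h2 : (ends e).2 ∈ C <;> simp [h1, h2]

lemma wS_symm (ends : ε → V × V) (S : Finset ε) (x y : V) : wS ends S x y = wS ends S y x := by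
  simp only [wS, Finset.sum_apply]
  apply sum_congr rfl
  intro e _
  split_ifs
  · rfl
  · exact Ed_comm _ _ _ _

lemma sum_mdeg [Fintype ε] (ends : ε → V × V) (C : Finset V) :
    ∑ x ∈ C, mdeg ends univ x = ∑ e, ((if (ends e).1 ∈ C then 1 else 0) + if (ends e).2 ∈ C then 1 else 0) := by
  simp only [mdeg, card_filter, sum_add_distrib]
  congr 1 <;> · rw [sum_comm]; simp

lemma nm_mul [NeZero k] (t : ℕ) : nm ((k * t : ℕ) : ZMod (2 * k)) = if Odd t then k else 0 := by
  have hk : 0 < k := Nat.pos_of_ne_zero (NeZero.ne k)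
  have h0 : (2 : ZMod (2 * k)) * k = 0 := by
    have := ZMod.natCast_self (2 * k)
    push_cast at this; exact this
  split_ifs with h
  · obtain ⟨m, rfl⟩ := h
    have : ((k * (2 * m + 1) : ℕ) : ZMod (2 * k)) = (k : ℕ) := by
      push_cast; linear_combination (m : ZMod (2 * k)) * h0
    rw [this, nm_cast (by omega)]; omega
  · rw [Nat.not_odd_iff_even] at h
    obtain ⟨m, rfl⟩ := h
    have : ((k * (m + m) : ℕ) : ZMod (2 * k)) = 0 := by
      push_cast; linear_combination (m : ZMod (2 * k)) * h0
    rw [this, nm_zero]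

lemma start [Fintype ε] [NeZero k] (hk : 2 ≤ k) (ends : ε → V × V) (hsize : k ∣ Fintype.card ε)
    (hdeg : ∀ v : V, k ∣ mdeg ends univ v)
    (hconn : ∀ X : Finset V,
      Odd (X ∩ (univ.filter fun v : V => Odd (mdeg ends univ v / k))).card →
      3 * k - 2 ≤ cutCard ends X) :
    Inst True (fun _ => False) (wS ends univ) (fun v => -((mdeg ends univ v : ℕ) : ZMod (2 * k))) 0 0 := by
  have hbt : ∀ x, bt (fun v => -((mdeg ends univ v : ℕ) : ZMod (2 * k))) 0 0 x = -((mdeg ends univ x : ℕ) : ZMod (2 * k)) := by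
    intro x; simp [bt]
  have hB : ∀ C : Finset V, ∑ x ∈ C, bt (fun v => -((mdeg ends univ v : ℕ) : ZMod (2 * k))) 0 0 x = -((∑ x ∈ C, mdeg ends univ x : ℕ) : ZMod (2 * k)) := by
    intro C; simp only [hbt, sum_neg_distrib]; push_cast; rfl
  have hD : ∀ C, DD (wS ends univ) 0 0 C = cutCard ends C := by
    intro C; simp [DD, dH_wS]
  have hD0 : DD (wS ends univ) 0 0 univ = 0 := by simp [DD, dH_univ]
  constructor
  · exact wS_symm _ _
  · rw [sum_neg_distrib, ← Nat.cast_sum, sum_mdeg, neg_eq_zero, ZMod.natCast_eq_zero_iff]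
    simp
    rw [mul_comm]
    exact mul_dvd_mul_right hsize 2
  · simp
  · simp
  · simp
  · intro C
    rw [hB, hD, nm_neg]
    have h1 := nm_nat_parity (k := k) (∑ x ∈ C, mdeg ends univ x)
    have h2 : (∑ x ∈ C, mdeg ends univ x + cutCard ends C) % 2 = 0 := by
      rw [sum_mdeg, cutCard, card_filter, ← sum_add_distrib]
      apply Nat.mod_eq_zero_of_dvd
      apply dvd_sum
      intro e _
      by_cases h1 : (ends e).1 ∈ C <;> by_cases h2 : (ends e).2 ∈ C <;> simp [h1, h2]
    omega
  · intro C hC hCu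
    have hs : ∑ x ∈ C, mdeg ends univ x = k * ∑ x ∈ C, mdeg ends univ x / k := by
      rw [mul_sum]
      apply sum_congr rfl
      intro x _
      rw [Nat.mul_div_cancel' (hdeg x)]
    rw [hB, hD, nm_neg, hs, nm_mul]
    split_ifs with hodd
    · right; right
      rw [Finset.odd_sum_iff_odd_card_odd] at hodd
      have := hconn C (by
        convert hodd using 2
        ext; simp)
      omega
    · left
      refine ⟨trivial, ?_⟩
      rw [neg_eq_zero]
      apply nm_eq_zero
      rw [nm_mul, if_neg hodd]
  · rw [hD0]; omega
  · intro _; left; exact hD0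

lemma mdeg_orient [Fintype ε] (ends : ε → V × V) (S : Finset ε) (r : ε → Bool) (v : V) :
    mdeg ends S v = (S.filter fun e => (if r e then (ends e).1 else (ends e).2) = v).card +
      (S.filter fun e => (if r e then (ends e).2 else (ends e).1) = v).card := by
  simp only [mdeg, card_filter, ← sum_add_distrib]
  apply sum_congr rfl
  intro e _
  cases r e
  · simp [add_comm]
  · simp

theorem final [Fintype ε] (ends : ε → V × V) (k : ℕ) (hk : 0 < k)
    (hsize : k ∣ Fintype.card ε)
    (hdeg : ∀ v : V, k ∣ mdeg ends univ v)
    (hconn : ∀ X : Finset V,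
      Odd (X ∩ (univ.filter fun v : V => Odd (mdeg ends univ v / k))).card →
      3 * k - 2 ≤ cutCard ends X) :
    ∃ c : ε → Fin k, ∀ v : V, ∀ i : Fin k,
      mdeg ends (univ.filter fun e => c e = i) v = mdeg ends univ v / k := by
  by_cases hk1 : k = 1
  · subst hk1
    refine ⟨fun _ => 0, fun v i => ?_⟩
    rw [Nat.div_one, filter_true_of_mem]
    intro e _; exact Subsingleton.elim _ _
  haveI : NeZero k := ⟨by omega⟩
  have hS := weak_main (by omega : 2 ≤ k) _ V rfl _ _ _ _ _ (start (by omega) ends hsize hdeg hconn)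
  obtain ⟨r, hr⟩ := orient ends univ _ hS
  have hT : ∀ v, k ∣ (univ.filter fun e => (if r e then (ends e).1 else (ends e).2) = v).card := by
    intro v
    have h1 := hr v
    rw [mdeg_orient ends univ r v] at h1
    simp only [sum_sub_distrib, sg] at h1
    rw [← Nat.mul_dvd_mul_iff_left (show 0 < 2 by norm_num), ← ZMod.natCast_eq_zero_iff]
    simp only [card_filter] at h1 ⊢
    push_cast at h1 ⊢
    simp only [eq_comm (a := v)] at h1
    linear_combination h1
  have hH : ∀ v, k ∣ (univ.filter fun e => (if r e then (ends e).2 else (ends e).1) = v).card := by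
    intro v
    have h1 := hdeg v
    rw [mdeg_orient ends univ r v] at h1
    exact (Nat.dvd_add_right (hT v)).mp h1
  obtain ⟨c, hc⟩ := color _ _ hk hT hH
  refine ⟨c, fun v i => ?_⟩
  rw [mdeg_orient ends _ r v, mdeg_orient ends univ r v, Nat.add_div_of_dvd_right (hT v), ← (hc v i).1, ← (hc v i).2]
  simp only [filter_filter, and_comm]
end app
end EF
-- END6

/-- Exact equitable factorization of multigraphs with size and degrees divisible by `k`,
under an odd-type edge-connectivity condition along the set `Q` of vertices with
`d_G(v)/k` odd. -/
theorem exact_factorization_divisible [Fintype V] [Fintype E] [DecidableEq V]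
    (ends : E → V × V) (k : ℕ) (hk : 0 < k)
    (hsize : k ∣ Fintype.card E)
    (hdeg : ∀ v : V, k ∣ mdeg ends univ v)
    (hconn : ∀ X : Finset V,
      Odd (X ∩ (univ.filter fun v : V => Odd (mdeg ends univ v / k))).card →
      3 * k - 2 ≤ cutCard ends X) :
    ∃ c : E → Fin k, ∀ v : V, ∀ i : Fin k,
      mdeg ends (univ.filter fun e => c e = i) v = mdeg ends univ v / k := by
  classical exact EF.final ends k hk hsize hdeg hconn
end

section
/- Let r be an odd positive integer and k a positive integer. If G is a kr-regular multigraph of even order satisfying d_G(A) ≥ 3k−2 for every vertex set A of odd size, then G can be edge-decomposed into k spanning subgraphs each of which is r-regular. -/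
open Finset

variable {V E : Type*}

open Finset
namespace RF
section base
variable {V E : Type*}

/-- distance to the nearest multiple of 2k -/
def Nn (k x : ℤ) : ℤ := min (x % (2 * k)) (2 * k - x % (2 * k))

theorem Nn_le {k : ℤ} (hk : 0 < k) (x d : ℤ) (hd : 2 * k ∣ d) : Nn k x ≤ max (x - d) (d - x) := by
  obtain ⟨j, rfl⟩ := hd
  unfold Nn
  have h1 := Int.emod_add_mul_ediv x (2 * k)
  have h2 := Int.emod_nonneg x (show 2 * k ≠ 0 by omega)
  have h3 := Int.emod_lt_of_pos x (show 0 < 2 * k by omega)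
  set m := x % (2 * k)
  set t := x / (2 * k)
  rcases lt_trichotomy t j with h | h | h
  · have : 2 * k * (t + 1) ≤ 2 * k * j := by
      apply mul_le_mul_of_nonneg_left (by omega) (by omega)
    have e : 2 * k * (t + 1) = 2 * k * t + 2 * k := by ring
    generalize 2 * k * (t+1) = a at *
    generalize 2 * k * t = b at *
    generalize 2 * k * j = c at *
    omega
  · subst h
    generalize 2 * k * t = b at *
    omega
  · have : 2 * k * (j + 1) ≤ 2 * k * t := by
      apply mul_le_mul_of_nonneg_left (by omega) (by omega)
    have e : 2 * k * (j + 1) = 2 * k * j + 2 * k := by ring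
    generalize 2 * k * (j+1) = a at *
    generalize 2 * k * t = b at *
    generalize 2 * k * j = c at *
    omega

theorem Nn_spec {k : ℤ} (hk : 0 < k) (x : ℤ) :
    ∃ d, 2 * k ∣ d ∧ Nn k x = max (x - d) (d - x) := by
  have h1 := Int.emod_add_mul_ediv x (2 * k)
  have h2 := Int.emod_nonneg x (show 2 * k ≠ 0 by omega)
  have h3 := Int.emod_lt_of_pos x (show 0 < 2 * k by omega)
  unfold Nn
  by_cases h : x % (2 * k) ≤ k
  · refine ⟨2 * k * (x / (2 * k)), ⟨_, rfl⟩, ?_⟩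
    generalize 2 * k * (x / (2 * k)) = a at *
    omega
  · refine ⟨2 * k * (x / (2 * k)) + 2 * k, ⟨x / (2 * k) + 1, by ring⟩, ?_⟩
    generalize 2 * k * (x / (2 * k)) = a at *
    omega

theorem Nn_nonneg {k : ℤ} (hk : 0 < k) (x : ℤ) : 0 ≤ Nn k x := by
  obtain ⟨d, -, h⟩ := Nn_spec hk x
  omega

theorem Nn_le_k {k : ℤ} (x : ℤ) : Nn k x ≤ k := by
  unfold Nn; omega

theorem Nn_eq_of_dvd {k : ℤ} (x y : ℤ) (h : 2 * k ∣ x - y) : Nn k x = Nn k y := by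
  unfold Nn
  rw [Int.emod_eq_emod_iff_emod_sub_eq_zero.2 (Int.emod_eq_zero_of_dvd h)]

theorem Nn_add_le {k : ℤ} (hk : 0 < k) (x y : ℤ) : Nn k (x + y) ≤ Nn k x + Nn k y := by
  obtain ⟨d, hd, h⟩ := Nn_spec hk x
  obtain ⟨d', hd', h'⟩ := Nn_spec hk y
  have := Nn_le hk (x + y) (d + d') (dvd_add hd hd')
  omega

theorem Nn_le_abs {k : ℤ} (hk : 0 < k) (x : ℤ) : Nn k x ≤ max x (-x) := by
  have := Nn_le hk x 0 (dvd_zero _)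
  omega

theorem Nn_neg {k : ℤ} (hk : 0 < k) (x : ℤ) : Nn k (-x) = Nn k x := by
  obtain ⟨d, hd, h⟩ := Nn_spec hk x
  obtain ⟨d', hd', h'⟩ := Nn_spec hk (-x)
  have := Nn_le hk (-x) (-d) ((dvd_neg).2 hd)
  have := Nn_le hk x (-d') ((dvd_neg).2 hd')
  omega

theorem Nn_sub_one {k : ℤ} (hk : 0 < k) (x : ℤ) : Nn k (x - 1) ≤ Nn k x + 1 := by
  obtain ⟨d, hd, h⟩ := Nn_spec hk x
  have := Nn_le hk (x - 1) d hd
  omega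

theorem Nn_add_one {k : ℤ} (hk : 0 < k) (x : ℤ) : Nn k (x + 1) ≤ Nn k x + 1 := by
  obtain ⟨d, hd, h⟩ := Nn_spec hk x
  have := Nn_le hk (x + 1) d hd
  omega

theorem Nn_dec {k : ℤ} (hk : 0 < k) (x : ℤ) (h : 1 ≤ Nn k x) :
    Nn k (x - 1) ≤ Nn k x - 1 ∨ Nn k (x + 1) ≤ Nn k x - 1 := by
  obtain ⟨d, hd, h⟩ := Nn_spec hk x
  have := Nn_le hk (x + 1) d hd
  have := Nn_le hk (x - 1) d hd
  omega

theorem Nn_zero_iff {k : ℤ} (hk : 0 < k) (x : ℤ) : Nn k x ≤ 0 ↔ 2 * k ∣ x := by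
  constructor
  · intro h
    obtain ⟨d, hd, h'⟩ := Nn_spec hk x
    have : x = d := by omega
    rwa [this]
  · intro h
    have := Nn_le hk x x h
    omega

theorem Nn_add_k {k : ℤ} (hk : 0 < k) (x : ℤ) : Nn k (x + k) ≤ k - Nn k x := by
  obtain ⟨d, hd, h⟩ := Nn_spec hk x
  have h3 := Nn_le_k (k := k) x
  rcases le_total (x - d) (d - x) with h' | h'
  · have := Nn_le hk (x + k) d hd
    omega
  · have := Nn_le hk (x + k) (d + 2 * k) (dvd_add hd dvd_rfl)
    omega

theorem Nn_par {k : ℤ} (hk : 0 < k) (x : ℤ) : (Nn k x) % 2 = x % 2 := by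
  obtain ⟨d, hd, h⟩ := Nn_spec hk x
  have : (2 : ℤ) ∣ d := (Dvd.intro _ rfl : (2:ℤ) ∣ 2 * k).trans hd
  omega

theorem Nn_I {k : ℤ} (hk : 2 ≤ k) (I : ℤ) (h0 : 0 ≤ I) (h : I ≤ 2 * k - 2 + Nn k (-I)) :
    I + k - 1 ≤ 2 * k - 2 + Nn k (k - 1 - I) := by
  have hk' : 0 < k := by omega
  have h1 := Nn_le hk' (-I) (-(2*k)) ((dvd_neg).2 dvd_rfl)
  have h3 := Nn_nonneg hk' (k - 1 - I)
  have h2 : I ≤ 2 * k - 1 := by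
    omega
  by_cases h4 : I ≤ k - 1
  · omega
  · have h5 : Nn k (k - 1 - I) = I - k + 1 := by
      rw [← Nn_neg hk']
      unfold Nn
      rw [Int.emod_eq_of_lt (by omega) (by omega)]
      omega
    omega

/-! ### Cuts -/
variable [DecidableEq V]

def ind (A : Finset V) (v : V) : ℤ := if v ∈ A then 1 else 0
def cv (A : Finset V) (u v : V) : ℤ := if (u ∈ A ↔ v ∈ A) then 0 else 1
def chi (v w : V) : ℤ := if w = v then 1 else 0

theorem cv_symm (A : Finset V) (u v : V) : cv A u v = cv A v u := by
  unfold cv; simp [iff_comm]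
theorem cv_self (A : Finset V) (u : V) : cv A u u = 0 := by simp [cv]
theorem cv_nonneg (A : Finset V) (u v : V) : 0 ≤ cv A u v := by
  unfold cv; split_ifs <;> simp
theorem cv_ind (A : Finset V) (u v : V) :
    (cv A u v = 0 ∧ ind A u = ind A v) ∨ (cv A u v = 1 ∧ ind A u = 1 ∧ ind A v = 0) ∨
      (cv A u v = 1 ∧ ind A u = 0 ∧ ind A v = 1) := by
  unfold cv ind; by_cases h : u ∈ A <;> by_cases h' : v ∈ A <;> simp [h, h']
theorem ind_cases (A : Finset V) (v : V) : (ind A v = 0 ∧ v ∉ A) ∨ (ind A v = 1 ∧ v ∈ A) := by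
  unfold ind; by_cases h : v ∈ A <;> simp [h]
theorem ind_mem {A : Finset V} {v : V} (h : v ∈ A) : ind A v = 1 := by simp [ind, h]
theorem ind_not_mem {A : Finset V} {v : V} (h : v ∉ A) : ind A v = 0 := by simp [ind, h]
theorem sum_chi (A : Finset V) (w : V) : ∑ v ∈ A, chi v w = ind A w := by
  simp [chi, ind]
theorem chi_eq_ind (v w : V) : chi v w = ind {v} w := by simp [chi, ind]

def dH (F : Finset E) (p q : E → V) (A : Finset V) : ℤ := ∑ e ∈ F, cv A (p e) (q e)

theorem dH_nonneg (F : Finset E) (p q : E → V) (A : Finset V) : 0 ≤ dH F p q A :=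
  Finset.sum_nonneg fun _ _ => cv_nonneg _ _ _

def DD (F : Finset E) (p q : E → V) (i o : V → ℤ) (A : Finset V) : ℤ :=
  dH F p q A + ∑ v ∈ A, (i v + o v)
def TT (b i o : V → ℤ) (A : Finset V) : ℤ := ∑ v ∈ A, (b v + o v - i v)

def Solv (k : ℤ) (F : Finset E) (p q : E → V) (S : Finset V) (b : V → ℤ) : Prop :=
  ∃ s : E → ℤ, (∀ e, s e = 1 ∨ s e = -1) ∧
    ∀ v ∈ S, 2 * k ∣ (∑ e ∈ F, s e * (chi v (p e) - chi v (q e))) - b v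

structure Good (k : ℤ) (F : Finset E) (p q : E → V) (S X : Finset V) (b i o : V → ℤ) : Prop where
  hmem : ∀ e ∈ F, p e ∈ S ∧ q e ∈ S
  hi : ∀ v, 0 ≤ i v
  ho : ∀ v, 0 ≤ o v
  hX : ∀ x ∈ S, x ∈ X → 2 * k ∣ b x + o x - i x
  hY : (∃ y ∈ S, y ∉ X) ∨ (∀ v ∈ S, i v = 0 ∧ o v = 0)
  hb : 2 * k ∣ ∑ v ∈ S, b v
  par : ∀ A ⊆ S, 2 ∣ dH F p q A + ∑ v ∈ A, b v
  h2 : DD F p q i o S ≤ 2 * k - 2 + Nn k (TT b i o S)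
  h3 : ∀ A ⊆ S, A.Nonempty → A ≠ S → ¬ A ⊆ X → 2 * k - 2 + Nn k (TT b i o A) ≤ DD F p q i o A

theorem dH_S {F : Finset E} {p q : E → V} {S : Finset V} (h : ∀ e ∈ F, p e ∈ S ∧ q e ∈ S) :
    dH F p q S = 0 := by
  apply Finset.sum_eq_zero
  intro e he
  simp [cv, (h e he).1, (h e he).2]

theorem dH_compl {F : Finset E} {p q : E → V} {S : Finset V} (h : ∀ e ∈ F, p e ∈ S ∧ q e ∈ S)
    (A : Finset V) : dH F p q (S \ A) = dH F p q A := by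
  apply Finset.sum_congr rfl
  intro e he
  simp [cv, (h e he).1, (h e he).2, not_iff_not]

theorem Good.pDT {k : ℤ} {F : Finset E} {p q : E → V} {S X : Finset V} {b i o : V → ℤ}
    (h : Good k F p q S X b i o) (A : Finset V) (hA : A ⊆ S) :
    (DD F p q i o A) % 2 = (TT b i o A) % 2 := by
  have := h.par A hA
  have e1 : ∑ v ∈ A, (i v + o v) = ∑ v ∈ A, i v + ∑ v ∈ A, o v := Finset.sum_add_distrib
  have e2 : ∑ v ∈ A, (b v + o v - i v) = ∑ v ∈ A, b v + ∑ v ∈ A, o v - ∑ v ∈ A, i v := by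
    rw [Finset.sum_sub_distrib, Finset.sum_add_distrib]
  unfold DD TT
  omega

end base
end RF

open Finset
set_option linter.unusedSectionVars false
set_option linter.unusedVariables false
set_option linter.unusedSimpArgs false
namespace RF
section p2
variable {V E : Type*} [DecidableEq V] [DecidableEq E]

def Ends (p q : E → V) (e : E) (u x : V) : Prop := (p e = u ∧ q e = x) ∨ (p e = x ∧ q e = u)

theorem Ends.symm {p q : E → V} {e : E} {u x : V} (h : Ends p q e u x) : Ends p q e x u := by
  unfold Ends at *; tauto

theorem Ends.cv {p q : E → V} {e : E} {u x : V} (h : Ends p q e u x) (A : Finset V) :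
    cv A (p e) (q e) = cv A u x := by
  rcases h with ⟨h1, h2⟩ | ⟨h1, h2⟩ <;> rw [h1, h2]
  exact cv_symm _ _ _

theorem Ends.sign {p q : E → V} {e : E} {u x : V} (h : Ends p q e u x) :
    ∃ σ : ℤ, (σ = 1 ∨ σ = -1) ∧ ∀ v, σ * (chi v (p e) - chi v (q e)) = chi v u - chi v x := by
  rcases h with ⟨h1, h2⟩ | ⟨h1, h2⟩
  · exact ⟨1, Or.inl rfl, fun v => by rw [h1, h2]; ring⟩
  · exact ⟨-1, Or.inr rfl, fun v => by rw [h1, h2]; ring⟩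

theorem dH_erase {F : Finset E} {p q : E → V} {e : E} {u x : V} (he : e ∈ F)
    (h : Ends p q e u x) (A : Finset V) : dH (F.erase e) p q A = dH F p q A - cv A u x := by
  unfold dH
  rw [← Finset.add_sum_erase F _ he, h.cv]; ring

theorem solv_delete {k : ℤ} {F : Finset E} {p q : E → V} {S : Finset V} {b : V → ℤ} {e : E}
    {u x : V} (he : e ∈ F) (h : Ends p q e u x)
    (hs : Solv k (F.erase e) p q S (fun v => b v - chi v u + chi v x)) : Solv k F p q S b := by
  obtain ⟨s, h1, h2⟩ := hs
  obtain ⟨σ, hσ, hσ'⟩ := h.sign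
  refine ⟨Function.update s e σ, ?_, ?_⟩
  · intro e'
    by_cases h' : e' = e
    · subst h'; simpa using hσ
    · simpa [h'] using h1 e'
  · intro v hv
    have := h2 v hv
    rw [← Finset.add_sum_erase F _ he]
    have e1 : ∑ x ∈ F.erase e, Function.update s e σ x * (chi v (p x) - chi v (q x))
        = ∑ x ∈ F.erase e, s x * (chi v (p x) - chi v (q x)) := by
      apply Finset.sum_congr rfl
      intro y hy
      rw [Function.update_of_ne (Finset.ne_of_mem_erase hy)]
    rw [e1, Function.update_self, hσ']
    convert this using 1
    ring

theorem dH_lift {F : Finset E} {p q : E → V} {e e' : E} {x u v : V} (he : e ∈ F) (he' : e' ∈ F)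
    (hne : e ≠ e') (h : Ends p q e x u) (h' : Ends p q e' x v) (A : Finset V) :
    dH (F.erase e') (Function.update p e u) (Function.update q e v) A
      = dH F p q A - cv A x u - cv A x v + cv A u v := by
  unfold dH
  rw [← Finset.add_sum_erase F _ he', h'.cv,
    ← Finset.add_sum_erase (F.erase e') _ (Finset.mem_erase.2 ⟨hne, he⟩),
    ← Finset.add_sum_erase (F.erase e') _ (Finset.mem_erase.2 ⟨hne, he⟩), h.cv]
  have : ∑ x ∈ (F.erase e').erase e, cv A (Function.update p e u x) (Function.update q e v x)
      = ∑ x ∈ (F.erase e').erase e, cv A (p x) (q x) := by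
    apply Finset.sum_congr rfl
    intro y hy
    rw [Function.update_of_ne (Finset.ne_of_mem_erase hy),
      Function.update_of_ne (Finset.ne_of_mem_erase hy)]
  rw [this]; simp; ring

theorem solv_lift {k : ℤ} {F : Finset E} {p q : E → V} {S : Finset V} {b : V → ℤ}
    {e e' : E} {x u v : V} (he : e ∈ F) (he' : e' ∈ F)
    (hne : e ≠ e') (h : Ends p q e x u) (h' : Ends p q e' x v)
    (hs : Solv k (F.erase e') (Function.update p e u) (Function.update q e v) S b) :
    Solv k F p q S b := by
  obtain ⟨s, h1, h2⟩ := hs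
  obtain ⟨σ, hσ, hσ'⟩ := h.symm.sign
  obtain ⟨τ, hτ, hτ'⟩ := h'.sign
  refine ⟨Function.update (Function.update s e (s e * σ)) e' (s e * τ), ?_, ?_⟩
  · intro y
    by_cases hy : y = e'
    · subst hy
      simp only [Function.update_self]
      rcases h1 e with h | h <;> rcases hτ with h' | h' <;> simp [h, h']
    · rw [Function.update_of_ne hy]
      by_cases hy : y = e
      · subst hy
        simp only [Function.update_self]
        rcases h1 y with h | h <;> rcases hσ with h' | h' <;> simp [h, h']
      · rw [Function.update_of_ne hy]; exact h1 y
  · intro w hw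
    have := h2 w hw
    have me : e ∈ F.erase e' := Finset.mem_erase.2 ⟨hne, he⟩
    rw [← Finset.add_sum_erase F _ he', ← Finset.add_sum_erase (F.erase e') _ me]
    rw [← Finset.add_sum_erase (F.erase e') _ me] at this
    have e1 : ∑ y ∈ (F.erase e').erase e, s y *
        (chi w (Function.update p e u y) - chi w (Function.update q e v y))
      = ∑ y ∈ (F.erase e').erase e, Function.update (Function.update s e (s e * σ)) e' (s e * τ) y *
        (chi w (p y) - chi w (q y)) := by
      apply Finset.sum_congr rfl
      intro y hy
      have a1 := Finset.ne_of_mem_erase hy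
      have a2 := Finset.ne_of_mem_erase (Finset.mem_of_mem_erase hy)
      simp [a1, a2]
    rw [e1] at this
    rw [Function.update_self, Function.update_of_ne hne, Function.update_self, mul_assoc, mul_assoc,
      hσ', hτ']
    simp only [Function.update_self] at this
    convert this using 1
    ring

/-! ### contraction -/

def ctr (A : Finset V) (a v : V) : V := if v ∈ A then a else v
def ctrS (S A : Finset V) (a : V) : Finset V := insert a (S \ A)
def ctrf (S A : Finset V) (a : V) (f : V → ℤ) (w : V) : ℤ :=
  ∑ v ∈ S.filter (fun v => ctr A a v = w), f v
def ctrB (S A : Finset V) (a : V) (A' : Finset V) : Finset V := S.filter (fun v => ctr A a v ∈ A')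

theorem ctr_mem {S A : Finset V} {a : V} {v : V} (hv : v ∈ S) : ctr A a v ∈ ctrS S A a := by
  unfold ctr ctrS; split_ifs with h <;> simp [h, hv]

theorem ctr_dH {F : Finset E} {p q : E → V} {S A : Finset V} {a : V}
    (h : ∀ e ∈ F, p e ∈ S ∧ q e ∈ S) (A' : Finset V) :
    dH F (fun e => ctr A a (p e)) (fun e => ctr A a (q e)) A' = dH F p q (ctrB S A a A') := by
  apply Finset.sum_congr rfl
  intro e he
  simp [cv, ctrB, (h e he).1, (h e he).2]

theorem ctr_sum (S A : Finset V) (a : V) (f : V → ℤ) (A' : Finset V) :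
    ∑ w ∈ A', ctrf S A a f w = ∑ v ∈ ctrB S A a A', f v := by
  unfold ctrf ctrB
  rw [← Finset.sum_fiberwise_of_maps_to (s := S.filter (fun v => ctr A a v ∈ A')) (t := A')
    (g := ctr A a) (by simp)]
  apply Finset.sum_congr rfl
  intro w hw
  apply Finset.sum_congr _ (fun _ _ => rfl)
  ext v; simp only [Finset.mem_filter]
  constructor
  · rintro ⟨h1, rfl⟩; exact ⟨⟨h1, hw⟩, rfl⟩
  · rintro ⟨⟨h1, h2⟩, rfl⟩; exact ⟨h1, rfl⟩

theorem ctr_f_off {S A : Finset V} {a : V} (ha : a ∈ A) (f : V → ℤ) {w : V} (hw : w ∈ S)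
    (hwA : w ∉ A) : ctrf S A a f w = f w := by
  unfold ctrf
  have : S.filter (fun v => ctr A a v = w) = {w} := by
    ext v; rw [Finset.mem_filter, Finset.mem_singleton]; unfold ctr
    constructor
    · rintro ⟨h1, h2⟩
      split_ifs at h2 with h
      · subst h2; exact absurd ha hwA
      · exact h2
    · rintro rfl; simp [hw, hwA]
  rw [this, Finset.sum_singleton]

theorem ctr_f_a {S A : Finset V} {a : V} (ha : a ∈ A) (hA : A ⊆ S) (f : V → ℤ) :
    ctrf S A a f a = ∑ v ∈ A, f v := by
  unfold ctrf
  apply Finset.sum_congr _ (fun _ _ => rfl)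
  ext v; rw [Finset.mem_filter]; unfold ctr
  constructor
  · rintro ⟨h1, h2⟩
    split_ifs at h2 with h
    · exact h
    · subst h2; exact ha
  · intro h; simp [hA h, h]

theorem ctrB_sub (S A : Finset V) (a : V) (A' : Finset V) : ctrB S A a A' ⊆ S :=
  Finset.filter_subset _ _

theorem ctrB_S (S A : Finset V) (a : V) : ctrB S A a (ctrS S A a) = S := by
  unfold ctrB; apply Finset.filter_true_of_mem; intro v hv; exact ctr_mem hv

theorem ctrB_mem_off {S A A' : Finset V} {a w : V} (hw : w ∈ S) (hwA : w ∉ A) :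
    w ∈ ctrB S A a A' ↔ w ∈ A' := by
  rw [ctrB, Finset.mem_filter]; unfold ctr; simp [hw, hwA]

theorem ctrB_mem_on {S A A' : Finset V} {a w : V} (hw : w ∈ S) (hwA : w ∈ A) :
    w ∈ ctrB S A a A' ↔ a ∈ A' := by
  rw [ctrB, Finset.mem_filter]; unfold ctr; simp [hw, hwA]

theorem ctrB_nonempty {S A A' : Finset V} {a : V} (ha : a ∈ A) (hA : A ⊆ S) (h : A'.Nonempty)
    (hs : A' ⊆ ctrS S A a) : (ctrB S A a A').Nonempty := by
  obtain ⟨w, hw⟩ := h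
  have := hs hw
  simp only [ctrS, Finset.mem_insert, Finset.mem_sdiff] at this
  rcases this with rfl | ⟨h1, h2⟩
  · exact ⟨w, (ctrB_mem_on (hA ha) ha).2 hw⟩
  · exact ⟨w, (ctrB_mem_off h1 h2).2 hw⟩

theorem ctrB_ne {S A A' : Finset V} {a : V} (ha : a ∈ A) (hA : A ⊆ S) 
    (hs : A' ⊆ ctrS S A a) (hne : A' ≠ ctrS S A a) : ctrB S A a A' ≠ S := by
  intro h
  apply hne
  apply Finset.Subset.antisymm hs
  intro w hw
  simp only [ctrS, Finset.mem_insert, Finset.mem_sdiff] at hw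
  rcases hw with rfl | ⟨h1, h2⟩
  · rw [← ctrB_mem_on (hA ha) ha, h]; exact hA ha
  · rw [← ctrB_mem_off h1 h2, h]; exact h1

theorem ctrS_card {S A : Finset V} {a : V} (ha : a ∈ A) (hA : A ⊆ S) (h2 : 2 ≤ A.card) :
    (ctrS S A a).card < S.card := by
  have h1 : (ctrS S A a).card ≤ (S \ A).card + 1 := Finset.card_insert_le _ _
  have h3 := Finset.card_sdiff_add_card_eq_card hA
  omega

theorem glue {k : ℤ} {F : Finset E} {p q : E → V} {S A : Finset V} {a : V} {b : V → ℤ}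
    (ha : a ∈ A) (hA : A ⊆ S)
    (hs : Solv k F (fun e => ctr A a (p e)) (fun e => ctr A a (q e)) (ctrS S A a) (ctrf S A a b)) :
    ∃ (FA : Finset E) (cin cout : V → ℤ), FA ⊆ F ∧ (∀ e ∈ FA, p e ∈ A ∧ q e ∈ A) ∧
      (∀ v, 0 ≤ cin v) ∧ (∀ v, 0 ≤ cout v) ∧
      (∀ A' ⊆ A, dH F p q A' = dH FA p q A' + ∑ v ∈ A', (cin v + cout v)) ∧
      (2 * k ∣ ∑ v ∈ A, (b v - cout v + cin v)) ∧
      (Solv k FA p q A (fun v => b v - cout v + cin v) → Solv k F p q S b) := by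
  obtain ⟨s, h1, h2⟩ := hs
  let P : E → Prop := fun e => p e ∈ A ∧ q e ∈ A
  let FA := F.filter P
  let FB := F.filter (fun e => ¬ P e)
  let cout : V → ℤ := fun v => ∑ e ∈ FB, if s e = 1 then chi v (p e) else chi v (q e)
  let cin : V → ℤ := fun v => ∑ e ∈ FB, if s e = 1 then chi v (q e) else chi v (p e)
  have chi0 : ∀ v w : V, 0 ≤ chi v w := by intro v w; unfold chi; split_ifs <;> simp
  have hdiff : ∀ v, cout v - cin v = ∑ e ∈ FB, s e * (chi v (p e) - chi v (q e)) := by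
    intro v
    simp only [cout, cin]
    rw [← Finset.sum_sub_distrib]
    apply Finset.sum_congr rfl
    intro e he
    rcases h1 e with h | h <;> simp [h]
  have hsum : ∀ v, cin v + cout v = ∑ e ∈ FB, (chi v (p e) + chi v (q e)) := by
    intro v
    simp only [cout, cin]
    rw [← Finset.sum_add_distrib]
    apply Finset.sum_congr rfl
    intro e he
    rcases h1 e with h | h <;> simp [h, add_comm]
  have hsplit : ∀ f : E → ℤ, ∑ e ∈ F, f e = ∑ e ∈ FA, f e + ∑ e ∈ FB, f e := fun f =>
    (Finset.sum_filter_add_sum_filter_not F P f).symm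
  refine ⟨FA, cin, cout, Finset.filter_subset _ _, ?_, ?_, ?_, ?_, ?_, ?_⟩
  · intro e he; exact (Finset.mem_filter.1 he).2
  · intro v; apply Finset.sum_nonneg; intro e _; split_ifs <;> apply chi0
  · intro v; apply Finset.sum_nonneg; intro e _; split_ifs <;> apply chi0
  · intro A' hA'
    unfold dH
    rw [hsplit]
    congr 1
    simp only [hsum]
    rw [Finset.sum_comm]
    apply Finset.sum_congr rfl
    intro e he
    rw [Finset.sum_add_distrib, sum_chi, sum_chi]
    have h3 : ¬ (p e ∈ A ∧ q e ∈ A) := (Finset.mem_filter.1 he).2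
    have h4 : ¬ (p e ∈ A' ∧ q e ∈ A') := fun h => h3 ⟨hA' h.1, hA' h.2⟩
    unfold cv ind
    by_cases h5 : p e ∈ A' <;> by_cases h6 : q e ∈ A' <;> simp_all
  · have h3 := h2 a (by simp [ctrS])
    rw [ctr_f_a ha hA, hsplit] at h3
    have hca : ∀ v, chi a (ctr A a v) = ind A v := by
      intro v; unfold chi ctr ind
      by_cases hv : v ∈ A
      · simp [hv]
      · have : v ≠ a := fun h => hv (h ▸ ha)
        simp [hv, this]
    simp only [hca] at h3
    have h4 : ∑ e ∈ FA, s e * (ind A (p e) - ind A (q e)) = 0 := by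
      apply Finset.sum_eq_zero
      intro e he
      have := (Finset.mem_filter.1 he).2
      rw [ind_mem this.1, ind_mem this.2]; ring
    rw [h4] at h3
    have h5 : ∑ v ∈ A, (b v - cout v + cin v) = ∑ v ∈ A, b v -
        ∑ e ∈ FB, s e * (ind A (p e) - ind A (q e)) := by
      have : ∀ v, b v - cout v + cin v = b v - (cout v - cin v) := fun v => by ring
      simp only [this, hdiff]
      rw [Finset.sum_sub_distrib, Finset.sum_comm]
      congr 1
      apply Finset.sum_congr rfl
      intro e _
      rw [← Finset.mul_sum, Finset.sum_sub_distrib, sum_chi, sum_chi]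
    rw [h5, ← dvd_neg, neg_sub]
    rwa [zero_add] at h3
  · rintro ⟨s1, h3, h4⟩
    refine ⟨fun e => if P e then s1 e else s e, ?_, ?_⟩
    · intro e; dsimp only; split_ifs
      · exact h3 e
      · exact h1 e
    · intro v hv
      have e1 : ∑ e ∈ FA, (if P e then s1 e else s e) * (chi v (p e) - chi v (q e)) =
          ∑ e ∈ FA, s1 e * (chi v (p e) - chi v (q e)) := by
        apply Finset.sum_congr rfl
        intro e he; rw [if_pos (Finset.mem_filter.1 he).2]
      have e2 : ∑ e ∈ FB, (if P e then s1 e else s e) * (chi v (p e) - chi v (q e)) =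
          ∑ e ∈ FB, s e * (chi v (p e) - chi v (q e)) := by
        apply Finset.sum_congr rfl
        intro e he; rw [if_neg (Finset.mem_filter.1 he).2]
      rw [hsplit, e1, e2]
      by_cases hvA : v ∈ A
      · have := h4 v hvA
        rw [← hdiff]
        convert this using 1; ring
      · have h5 := h2 v (by simp [ctrS, hv, hvA])
        rw [ctr_f_off ha b hv hvA, hsplit] at h5
        have hcv : ∀ w, chi v (ctr A a w) = chi v w := by
          intro w; unfold chi ctr
          by_cases hw : w ∈ A
          · have h6 : w ≠ v := fun h => hvA (h ▸ hw)
            have h7 : a ≠ v := fun h => hvA (h ▸ ha)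
            simp [hw, h6, h7]
          · simp [hw]
        simp only [hcv] at h5
        have z : ∀ s' : E → ℤ, ∑ e ∈ FA, s' e * (chi v (p e) - chi v (q e)) = 0 := by
          intro s'
          apply Finset.sum_eq_zero
          intro e he
          have h8 := (Finset.mem_filter.1 he).2
          have h6 : p e ≠ v := fun h => hvA (h ▸ h8.1)
          have h7 : q e ≠ v := fun h => hvA (h ▸ h8.2)
          simp [chi, h6, h7]
        rw [z] at h5 ⊢
        exact h5

/-- solve the part inside `A` after the contraction of `A` has been solved -/
theorem sub_good {k : ℤ} {F : Finset E} {p q : E → V} {S A X : Finset V} {a : V} {b i o : V → ℤ}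
    (ha : a ∈ A) (hA : A ⊆ S) (hi : ∀ v, 0 ≤ i v) (ho : ∀ v, 0 ≤ o v)
    (hX : ∀ x ∈ A, x ∈ X → 2 * k ∣ b x + o x - i x) (hY : ¬ A ⊆ X)
    (par : ∀ A' ⊆ A, 2 ∣ dH F p q A' + ∑ v ∈ A', b v)
    (h2 : DD F p q i o A ≤ 2 * k - 2 + Nn k (TT b i o A))
    (h3 : ∀ A' ⊆ A, A'.Nonempty → A' ≠ A → ¬ A' ⊆ X →
      2 * k - 2 + Nn k (TT b i o A') ≤ DD F p q i o A')
    (hs : Solv k F (fun e => ctr A a (p e)) (fun e => ctr A a (q e)) (ctrS S A a) (ctrf S A a b))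
    (IH : ∀ F' ⊆ F, ∀ b' i' o', Good k F' p q A X b' i' o' → Solv k F' p q A b') :
    Solv k F p q S b := by
  obtain ⟨FA, cin, cout, g1, g2, g3, g4, g5, g6, g7⟩ := glue ha hA hs
  apply g7
  have hD : ∀ A' ⊆ A, DD FA p q (fun v => i v + cin v) (fun v => o v + cout v) A' =
      DD F p q i o A' := by
    intro A' hA'
    unfold DD
    rw [g5 A' hA', add_assoc, ← Finset.sum_add_distrib]
    congr 1
    apply Finset.sum_congr rfl; intros; ring
  have hT : ∀ A', TT (fun v => b v - cout v + cin v) (fun v => i v + cin v)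
      (fun v => o v + cout v) A' = TT b i o A' := by
    intro A'
    unfold TT
    apply Finset.sum_congr rfl; intros; ring
  apply IH FA g1 _ (fun v => i v + cin v) (fun v => o v + cout v)
  refine ⟨g2, fun v => add_nonneg (hi v) (g3 v), fun v => add_nonneg (ho v) (g4 v), ?_, ?_, g6,
    ?_, ?_, ?_⟩
  · intro x hx hxX
    convert hX x hx hxX using 1; ring
  · left
    obtain ⟨y, h, h'⟩ := Finset.not_subset.1 hY
    exact ⟨y, h, h'⟩
  · intro A' hA'
    have := par A' hA'
    rw [g5 A' hA'] at this
    have e1 : ∑ v ∈ A', (b v - cout v + cin v) = ∑ v ∈ A', b v + ∑ v ∈ A', (cin v + cout v) 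
        - 2 * ∑ v ∈ A', cout v := by
      rw [Finset.mul_sum, ← Finset.sum_add_distrib, ← Finset.sum_sub_distrib]
      apply Finset.sum_congr rfl; intros; ring
    rw [e1]
    omega
  · rw [hD A subset_rfl, hT]; exact h2
  · intro A' a1 a2 a3 a4
    rw [hD A' a1, hT]; exact h3 A' a1 a2 a3 a4

def IHs (V E : Type*) [DecidableEq V] (k : ℤ) (n : ℕ) : Prop :=
  ∀ (F : Finset E) (p q : E → V) (S X : Finset V) (b i o : V → ℤ), S.card + F.card < n →
    Good k F p q S X b i o → Solv k F p q S b

theorem contraction {k : ℤ} {F : Finset E} {p q : E → V} {S A X : Finset V} {b i o : V → ℤ}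
    (IH : IHs V E k (S.card + F.card)) (g : Good k F p q S X b i o)
    (hA : A ⊆ S) (hne : A ≠ S) (hAX : ¬ A ⊆ X) (hc : 2 ≤ A.card)
    (hD : DD F p q i o A ≤ 2 * k - 2 + Nn k (TT b i o A)) : Solv k F p q S b := by
  obtain ⟨a, ha, haX⟩ := Finset.not_subset.1 hAX
  have hlt : A.card < S.card := Finset.card_lt_card (hA.ssubset_of_ne hne)
  apply sub_good (X := X) (i := i) (o := o) ha hA g.hi g.ho (fun x hx => g.hX x (hA hx)) hAX
    (fun A' h => g.par A' (h.trans hA)) hD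
  · intro A' h1 h2 h3 h4
    apply g.h3 A' (h1.trans hA) h2 _ h4
    rintro rfl
    exact hne (Finset.Subset.antisymm hA h1)
  · apply IH F _ _ _ (X \ A) _ (ctrf S A a i) (ctrf S A a o)
    · have := ctrS_card ha hA hc
      omega
    have hDD : ∀ A', DD F (fun e => ctr A a (p e)) (fun e => ctr A a (q e)) (ctrf S A a i)
        (ctrf S A a o) A' = DD F p q i o (ctrB S A a A') := by
      intro A'
      unfold DD
      rw [ctr_dH g.hmem, Finset.sum_add_distrib, ctr_sum, ctr_sum, Finset.sum_add_distrib]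
    have hTT : ∀ A', TT (ctrf S A a b) (ctrf S A a i) (ctrf S A a o) A' =
        TT b i o (ctrB S A a A') := by
      intro A'
      unfold TT
      simp only [Finset.sum_sub_distrib, Finset.sum_add_distrib, ctr_sum]
    refine ⟨?_, ?_, ?_, ?_, ?_, ?_, ?_, ?_, ?_⟩
    · intro e he; exact ⟨ctr_mem (g.hmem e he).1, ctr_mem (g.hmem e he).2⟩
    · intro v; exact Finset.sum_nonneg fun v _ => g.hi v
    · intro v; exact Finset.sum_nonneg fun v _ => g.ho v
    · intro x hx hxX
      have ⟨x1, x2⟩ := Finset.mem_sdiff.1 hxX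
      have x3 : x ∈ S := by
        simp only [ctrS, Finset.mem_insert, Finset.mem_sdiff] at hx
        rcases hx with rfl | hx
        · exact hA ha
        · exact hx.1
      rw [ctr_f_off ha _ x3 x2, ctr_f_off ha _ x3 x2, ctr_f_off ha _ x3 x2]
      exact g.hX x x3 x1
    · left; exact ⟨a, by simp [ctrS], by simp [ha]⟩
    · rw [ctr_sum, ctrB_S]; exact g.hb
    · intro A' hA'
      rw [ctr_sum, ctr_dH g.hmem]; exact g.par _ (ctrB_sub _ _ _ _)
    · rw [hDD, hTT, ctrB_S]; exact g.h2
    · intro A' a1 a2 a3 a4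
      rw [hDD, hTT]
      apply g.h3 _ (ctrB_sub _ _ _ _) (ctrB_nonempty ha hA a2 a1) (ctrB_ne ha hA a1 a3)
      obtain ⟨w, w1, w2⟩ := Finset.not_subset.1 a4
      have := a1 w1
      simp only [ctrS, Finset.mem_insert, Finset.mem_sdiff] at this
      rw [Finset.not_subset]
      rcases this with rfl | ⟨h1, h2⟩
      · exact ⟨w, (ctrB_mem_on (hA ha) ha).2 w1, haX⟩
      · refine ⟨w, (ctrB_mem_off h1 h2).2 w1, ?_⟩
        intro h; exact w2 (Finset.mem_sdiff.2 ⟨h, h2⟩)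
  · intro F' hF' b' i' o' g'
    apply IH F' p q A X b' i' o' _ g'
    have := Finset.card_le_card hF'
    omega

end p2
end RF

open Finset
set_option linter.unusedSectionVars false
set_option linter.unusedVariables false
set_option linter.unusedSimpArgs false
namespace RF
section p3
variable {V E : Type*} [DecidableEq V] [DecidableEq E]

theorem exists_edge {F : Finset E} {p q : E → V} {A : Finset V} (h : 0 < dH F p q A) :
    ∃ e ∈ F, ∃ u ∈ A, ∃ v, v ∉ A ∧ Ends p q e u v := by
  by_contra hcon
  push Not at hcon
  have : dH F p q A = 0 := by
    apply Finset.sum_eq_zero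
    intro e he
    unfold cv
    rw [if_pos]
    constructor
    · intro h1
      by_contra h2
      exact hcon e he _ h1 _ h2 (Or.inl ⟨rfl, rfl⟩)
    · intro h1
      by_contra h2
      exact hcon e he _ h1 _ h2 (Or.inr ⟨rfl, rfl⟩)
  omega

theorem Ends.mem {F : Finset E} {p q : E → V} {S : Finset V} (h : ∀ e ∈ F, p e ∈ S ∧ q e ∈ S)
    {e : E} (he : e ∈ F) {u v : V} (h1 : Ends p q e u v) : u ∈ S ∧ v ∈ S := by
  have := h e he
  rcases h1 with ⟨rfl, rfl⟩ | ⟨rfl, rfl⟩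
  · exact this
  · exact this.symm

/-- reversal -/
theorem Good.rev {k : ℤ} (hk : 0 < k) {F : Finset E} {p q : E → V} {S X : Finset V} {b i o : V → ℤ}
    (g : Good k F p q S X b i o) : Good k F q p S X (fun v => - b v) o i := by
  have hd : ∀ A, dH F q p A = dH F p q A := fun A =>
    Finset.sum_congr rfl fun e _ => cv_symm _ _ _
  have hD : ∀ A, DD F q p o i A = DD F p q i o A := by
    intro A; unfold DD; rw [hd]; congr 1; apply Finset.sum_congr rfl; intros; ring
  have hT : ∀ A, TT (fun v => - b v) o i A = - TT b i o A := by
    intro A; unfold TT; rw [← Finset.sum_neg_distrib]; apply Finset.sum_congr rfl; intros; ring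
  refine ⟨fun e he => (g.hmem e he).symm, g.ho, g.hi, ?_, ?_, ?_, ?_, ?_, ?_⟩
  · intro x h1 h2
    have := g.hX x h1 h2
    rw [← Int.dvd_neg]
    convert this using 1; ring
  · rcases g.hY with h | h
    · exact Or.inl h
    · exact Or.inr fun v hv => (h v hv).symm
  · rw [Finset.sum_neg_distrib, dvd_neg]; exact g.hb
  · intro A hA
    have := g.par A hA
    rw [hd, Finset.sum_neg_distrib]; omega
  · rw [hD, hT, Nn_neg hk]; exact g.h2
  · intro A
    rw [hD, hT, Nn_neg hk]; exact g.h3 A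

theorem solv_rev {k : ℤ} {F : Finset E} {p q : E → V} {S : Finset V} {b : V → ℤ}
    (h : Solv k F q p S (fun v => - b v)) : Solv k F p q S b := by
  obtain ⟨s, h1, h2⟩ := h
  refine ⟨s, h1, fun v hv => ?_⟩
  rw [← Int.dvd_neg]
  convert h2 v hv using 1
  rw [neg_sub, ← sub_eq_zero]
  have : ∑ e ∈ F, s e * (chi v (q e) - chi v (p e)) = - ∑ e ∈ F, s e * (chi v (p e) - chi v (q e)) := by
    rw [← Finset.sum_neg_distrib]; apply Finset.sum_congr rfl; intros; ring
  rw [this]; ring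

/-- two-vertex case -/
theorem two_vertex {k : ℤ} (hk : 0 < k) {p q : E → V} {x y : V} (hxy : x ≠ y) :
    ∀ (n : ℕ) (F : Finset E) (b : V → ℤ), F.card = n →
    (∀ e ∈ F, p e ∈ ({x, y} : Finset V) ∧ q e ∈ ({x, y} : Finset V)) →
    2 * k ∣ b x + b y → Nn k (b x) ≤ dH F p q {x} → 2 ∣ dH F p q {x} + b x →
    Solv k F p q {x, y} b := by
  intro n
  induction n with
  | zero =>
    intro F b hF hm hb hN hp
    have : F = ∅ := Finset.card_eq_zero.1 hF
    subst this
    have hx : 2 * k ∣ b x := by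
      rw [← Nn_zero_iff hk]; simpa [dH] using hN
    have hy : 2 * k ∣ b y := (dvd_add_right hx).1 hb
    refine ⟨fun _ => 1, fun _ => Or.inl rfl, ?_⟩
    intro v hv
    simp only [Finset.sum_empty, zero_sub, dvd_neg]
    simp only [Finset.mem_insert, Finset.mem_singleton] at hv
    rcases hv with rfl | rfl <;> assumption
  | succ n ih =>
    intro F b hF hm hb hN hp
    by_cases hd : dH F p q {x} = 0
    · have hx : 2 * k ∣ b x := by
        rw [← Nn_zero_iff hk]; omega
      have hy : 2 * k ∣ b y := (dvd_add_right hx).1 hb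
      refine ⟨fun _ => 1, fun _ => Or.inl rfl, ?_⟩
      intro v hv
      have hz : ∑ e ∈ F, (1:ℤ) * (chi v (p e) - chi v (q e)) = 0 := by
        apply Finset.sum_eq_zero
        intro e he
        have h1 := (Finset.sum_eq_zero_iff_of_nonneg (fun e _ => cv_nonneg {x} (p e) (q e))).1 hd e he
        have ⟨h2, h3⟩ := hm e he
        simp only [Finset.mem_insert, Finset.mem_singleton] at h2 h3
        have : p e = q e := by
          unfold cv at h1
          simp only [Finset.mem_singleton] at h1
          split_ifs at h1 with h4
          · rcases h2 with h2 | h2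
            · rw [h2, h4.1 h2]
            · rcases h3 with h3 | h3
              · rw [h3, h4.2 h3]
              · rw [h2, h3]
          · omega
        rw [this]; ring
      rw [hz, zero_sub, dvd_neg]
      simp only [Finset.mem_insert, Finset.mem_singleton] at hv
      rcases hv with rfl | rfl <;> assumption
    · have hpos : 0 < dH F p q {x} := lt_of_le_of_ne (dH_nonneg _ _ _ _) (Ne.symm hd)
      obtain ⟨e, he, u, hu, v, hv, hE⟩ := exists_edge hpos
      have hux : u = x := by simpa using hu
      subst hux
      have hvy : v = y := by
        have := (hE.mem hm he).2
        simp only [Finset.mem_insert, Finset.mem_singleton] at this hv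
        tauto
      subst hvy
      have hcard : (F.erase e).card = n := by rw [Finset.card_erase_of_mem he, hF]; rfl
      have hm' : ∀ e' ∈ F.erase e, p e' ∈ ({u, v} : Finset V) ∧ q e' ∈ ({u, v} : Finset V) :=
        fun e' h => hm e' (Finset.mem_of_mem_erase h)
      have hcv : cv {u} u v = 1 := by simp [cv, hxy.symm]
      have hcv' : cv {u} v u = 1 := by rw [cv_symm]; exact hcv
      have c1 : chi u u = 1 := by simp [chi]
      have c2 : chi v v = 1 := by simp [chi]
      have c3 : chi u v = 0 := by simp [chi, hxy.symm]
      have c4 : chi v u = 0 := by simp [chi, hxy]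
      have hpar := Nn_par hk (b u)
      have key : Nn k (b u - 1) ≤ dH F p q {u} - 1 ∨ Nn k (b u + 1) ≤ dH F p q {u} - 1 := by
        by_cases h0 : 1 ≤ Nn k (b u)
        · rcases Nn_dec hk (b u) h0 with h | h
          · left; omega
          · right; omega
        · have := Nn_sub_one hk (b u)
          have := Nn_nonneg hk (b u)
          left; omega
      rcases key with h | h
      · apply solv_delete he hE
        apply ih _ _ hcard hm'
        · simp only [c1, c2, c3, c4]; convert hb using 1; ring
        · rw [dH_erase he hE, hcv]; simp only [c1, c3]; simpa using h
        · rw [dH_erase he hE, hcv]; simp only [c1, c3]; omega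
      · apply solv_delete he hE.symm
        apply ih _ _ hcard hm'
        · simp only [c1, c2, c3, c4]; convert hb using 1; ring
        · rw [dH_erase he hE.symm, hcv']; simp only [c1, c3]; simpa using h
        · rw [dH_erase he hE.symm, hcv']; simp only [c1, c3]; omega

theorem slack {k : ℤ} (hk : 0 < k) {F : Finset E} {p q : E → V} {S A X : Finset V} {b i o : V → ℤ}
    (IH : IHs V E k (S.card + F.card)) (g : Good k F p q S X b i o)
    (hns : ¬ Solv k F p q S b)
    (hA : A ⊆ S) (hne : A ≠ S) (hAX : ¬ A ⊆ X) (hc : 2 ≤ A.card) :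
    2 * k + Nn k (TT b i o A) ≤ DD F p q i o A := by
  by_contra hcon
  apply hns
  apply contraction IH g hA hne hAX hc
  have := g.pDT A hA
  have := Nn_par hk (TT b i o A)
  omega

theorem mkGood {k : ℤ} (hk : 0 < k) {F : Finset E} {p q : E → V} {S X : Finset V} {b i o : V → ℤ}
    (IH : IHs V E k (S.card + F.card)) (g : Good k F p q S X b i o)
    (hns : ¬ Solv k F p q S b) {F' : Finset E} {p' q' : E → V} {b' i' o' : V → ℤ}
    (hmem : ∀ e ∈ F', p' e ∈ S ∧ q' e ∈ S)
    (hi : ∀ v, 0 ≤ i' v)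
    (ho : ∀ v, 0 ≤ o' v)
    (hX : ∀ x ∈ S, x ∈ X → 2 * k ∣ b' x + o' x - i' x)
    (hY : (∃ y ∈ S, y ∉ X) ∨ (∀ v ∈ S, i' v = 0 ∧ o' v = 0))
    (hb : ∑ v ∈ S, b' v = ∑ v ∈ S, b v)
    (par : ∀ A ⊆ S, 2 ∣ (dH F' p' q' A - dH F p q A) + (∑ v ∈ A, b' v - ∑ v ∈ A, b v))
    (h2 : DD F' p' q' i' o' S ≤ 2 * k - 2 + Nn k (TT b' i' o' S))
    (h31 : ∀ a ∈ S, a ∉ X → 2 * k - 2 + Nn k (TT b i o {a}) ≤ DD F p q i o {a} →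
       2 * k - 2 + Nn k (TT b' i' o' {a}) ≤ DD F' p' q' i' o' {a})
    (h32 : ∀ A, A ⊆ S → 2 * k + Nn k (TT b i o A) ≤ DD F p q i o A →
       2 * k - 2 + Nn k (TT b' i' o' A) ≤ DD F' p' q' i' o' A) :
    Good k F' p' q' S X b' i' o' := by
  refine ⟨hmem, hi, ho, hX, hY, by rw [hb]; exact g.hb, ?_, h2, ?_⟩
  · intro A hA
    have h1 := g.par A hA
    have h2 := par A hA
    omega
  · intro A hA hn hne hAX
    by_cases hc : 2 ≤ A.card
    · exact h32 A hA (slack hk IH g hns hA hne hAX hc)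
    · have : A.card = 1 := by have := hn.card_pos; omega
      obtain ⟨a, rfl⟩ := Finset.card_eq_one.1 this
      apply h31 a (hA (by simp)) (by simpa using hAX)
      exact g.h3 _ hA hn hne hAX

/-- Z-step, shifting an `i` -/
theorem zshift_i {k : ℤ} (hk : 2 ≤ k) {F : Finset E} {p q : E → V} {S X : Finset V}
    {b i o : V → ℤ} (IH : IHs V E k (S.card + F.card)) (g : Good k F p q S X b i o)
    {x : V} (hx : x ∈ S) (hxX : x ∈ X) (hi : 1 ≤ i x) (hd : 0 < dH F p q {x}) :
    Solv k F p q S b := by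
  by_contra hns
  have hk0 : 0 < k := by omega
  obtain ⟨e, he, u, hu, v, hv, hE⟩ := exists_edge hd
  have hux : u = x := by simpa using hu
  subst hux
  have hvu : v ≠ u := by simpa using hv
  have hvS := (hE.mem g.hmem he).2
  apply hns
  apply solv_delete he hE
  have hD : ∀ A, DD (F.erase e) p q (fun w => i w - chi w u + chi w v) o A =
      DD F p q i o A - cv A u v - ind A u + ind A v := by
    intro A; unfold DD; rw [dH_erase he hE]
    simp only [Finset.sum_add_distrib, Finset.sum_sub_distrib, sum_chi]; ring
  have hT : ∀ A, TT (fun w => b w - chi w u + chi w v) (fun w => i w - chi w u + chi w v) o A =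
      TT b i o A := by
    intro A; unfold TT; apply Finset.sum_congr rfl; intros; ring
  apply IH _ p q S X _ (fun w => i w - chi w u + chi w v) o
  · rw [Finset.card_erase_of_mem he]
    have := Finset.card_pos.2 ⟨e, he⟩
    omega
  apply mkGood hk0 IH g hns
  · intro e' h; exact g.hmem e' (Finset.mem_of_mem_erase h)
  · intro w
    have := g.hi w
    by_cases hw : u = w
    · subst hw; simp [chi, hvu]; omega
    · simp only [chi, hw, if_false]; split_ifs <;> omega
  · exact g.ho
  · intro y h1 h2
    convert g.hX y h1 h2 using 1; ring
  · left
    rcases g.hY with h | h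
    · exact h
    · have := (h u hx).1; omega
  · simp only [Finset.sum_add_distrib, Finset.sum_sub_distrib, sum_chi, ind_mem hx, ind_mem hvS]
    ring
  · intro A hA
    rw [dH_erase he hE]
    simp only [Finset.sum_add_distrib, Finset.sum_sub_distrib, sum_chi]
    have := cv_ind A u v
    omega
  · rw [hD, hT]
    have := g.h2
    have := cv_ind S u v
    have := ind_mem hx
    have := ind_mem hvS
    omega
  · intro a ha haX h
    rw [hD, hT]
    have : ind {a} u = 0 := by
      apply ind_not_mem; simp; rintro rfl; exact haX hxX
    have := cv_ind {a} u v
    omega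
  · intro A hA h
    rw [hD, hT]
    have := cv_ind A u v
    have := ind_cases A u
    omega

theorem zshift_o {k : ℤ} (hk : 2 ≤ k) {F : Finset E} {p q : E → V} {S X : Finset V}
    {b i o : V → ℤ} (IH : IHs V E k (S.card + F.card)) (g : Good k F p q S X b i o)
    {x : V} (hx : x ∈ S) (hxX : x ∈ X) (ho : 1 ≤ o x) (hd : 0 < dH F p q {x}) :
    Solv k F p q S b := by
  apply solv_rev
  apply zshift_i hk IH (g.rev (by omega)) hx hxX ho
  have : dH F q p {x} = dH F p q {x} := Finset.sum_congr rfl fun e _ => cv_symm _ _ _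
  omega

/-- Z-step, dropping an isolated vertex -/
theorem zdrop {k : ℤ} (hk : 2 ≤ k) {F : Finset E} {p q : E → V} {S X : Finset V}
    {b i o : V → ℤ} (IH : IHs V E k (S.card + F.card)) (g : Good k F p q S X b i o)
    {x : V} (hx : x ∈ S) (hxX : x ∈ X) (hd : dH F p q {x} = 0) :
    Solv k F p q S b := by
  have hk0 : 0 < k := by omega
  have hTx := g.hX x hx hxX
  have hsum : ∀ f : V → ℤ, ∑ v ∈ S, f v = f x + ∑ v ∈ S.erase x, f v := fun f =>
    (Finset.add_sum_erase S f hx).symm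
  have hTS : Nn k (TT b i o S) = Nn k (TT b i o (S.erase x)) := by
    apply Nn_eq_of_dvd
    unfold TT
    rw [hsum]; simpa using hTx
  have hDS : DD F p q i o S = DD F p q i o (S.erase x) + (i x + o x) := by
    unfold DD
    rw [hsum, dH_S g.hmem, Finset.erase_eq, dH_compl g.hmem, hd]; ring
  have hio : i x = 0 ∧ o x = 0 := by
    rcases g.hY with ⟨y, hy, hyX⟩ | h
    · have hyx : y ≠ x := by rintro rfl; exact hyX hxX
      have hy' : y ∈ S.erase x := Finset.mem_erase.2 ⟨hyx, hy⟩
      have := g.h3 (S.erase x) (Finset.erase_subset _ _) ⟨y, hy'⟩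
        (fun h => by rw [← h] at hx; simp at hx) (fun h => hyX (h hy'))
      have := g.h2
      have := g.hi x
      have := g.ho x
      omega
    · exact h x hx
  have hbx : 2 * k ∣ b x := by simpa [hio] using hTx
  have hloop : ∀ e ∈ F, (p e = x ↔ q e = x) := by
    intro e he
    have h1 := (Finset.sum_eq_zero_iff_of_nonneg (fun e _ => cv_nonneg {x} (p e) (q e))).1 hd e he
    unfold cv at h1
    simp only [Finset.mem_singleton] at h1
    by_contra h; simp [h] at h1
  let F' := F.filter (fun e => p e ≠ x)
  have hF' : ∀ f : E → ℤ, (∀ e ∈ F, p e = x → q e = x → f e = 0) → ∑ e ∈ F', f e = ∑ e ∈ F, f e := by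
    intro f hf
    apply Finset.sum_filter_of_ne
    intro e he h1 h2
    exact h1 (hf e he h2 ((hloop e he).1 h2))
  have hdH : ∀ A, dH F' p q A = dH F p q A := by
    intro A; apply hF'
    intro e he h1 h2; rw [h1, h2, cv_self]
  have hDD : ∀ A, DD F' p q i o A = DD F p q i o A := by
    intro A; unfold DD; rw [hdH]
  have hs : Solv k F' p q (S.erase x) b := by
    apply IH _ p q _ X b i o
    · rw [Finset.card_erase_of_mem hx]
      have := Finset.card_pos.2 ⟨x, hx⟩
      have : F'.card ≤ F.card := Finset.card_filter_le _ _
      omega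
    refine ⟨?_, g.hi, g.ho, ?_, ?_, ?_, ?_, ?_, ?_⟩
    · intro e he
      obtain ⟨h1, h2⟩ := Finset.mem_filter.1 he
      have := g.hmem e h1
      exact ⟨Finset.mem_erase.2 ⟨h2, this.1⟩, Finset.mem_erase.2 ⟨fun h => h2 ((hloop e h1).2 h), this.2⟩⟩
    · intro y hy; exact g.hX y (Finset.mem_of_mem_erase hy)
    · rcases g.hY with ⟨y, hy, hyX⟩ | h
      · left; refine ⟨y, Finset.mem_erase.2 ⟨?_, hy⟩, hyX⟩
        rintro rfl; exact hyX hxX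
      · right; intro v hv; exact h v (Finset.mem_of_mem_erase hv)
    · have := g.hb
      rw [hsum] at this
      exact (dvd_add_right hbx).1 this
    · intro A hA
      rw [hdH]; exact g.par A (hA.trans (Finset.erase_subset _ _))
    · rw [hDD, ← hTS]
      have := g.h2
      omega
    · intro A hA hn hne hAX
      rw [hDD]
      apply g.h3 A (hA.trans (Finset.erase_subset _ _)) hn _ hAX
      rintro rfl
      have := hA hx
      simp at this
  obtain ⟨s, h1, h2⟩ := hs
  refine ⟨s, h1, ?_⟩
  intro v hv
  rw [← hF' _ (fun e he h1 h2 => by rw [h1, h2]; ring)]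
  by_cases hvx : v = x
  · subst hvx
    have : ∑ e ∈ F', s e * (chi v (p e) - chi v (q e)) = 0 := by
      apply Finset.sum_eq_zero
      intro e he
      obtain ⟨h1, h2⟩ := Finset.mem_filter.1 he
      have h3 : q e ≠ v := fun h => h2 ((hloop e h1).2 h)
      simp [chi, h2, h3]
    rw [this, zero_sub, dvd_neg]; exact hbx
  · exact h2 v (Finset.mem_erase.2 ⟨hvx, hv⟩)

/-- Z-step, lifting -/
theorem zlift {k : ℤ} (hk : 2 ≤ k) {F : Finset E} {p q : E → V} {S X : Finset V}
    {b i o : V → ℤ} (IH : IHs V E k (S.card + F.card)) (g : Good k F p q S X b i o)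
    {x : V} (hx : x ∈ S) (hxX : x ∈ X) {e e' : E} {u v : V} (he : e ∈ F) (he' : e' ∈ F)
    (hne : e ≠ e') (hE : Ends p q e x u) (hE' : Ends p q e' x v) (hu : u ≠ x) (hv : v ≠ x)
    (huv : u = v → v ∉ X → 2 * k + Nn k (TT b i o {v}) ≤ DD F p q i o {v}) :
    Solv k F p q S b := by
  by_contra hns
  have hk0 : 0 < k := by omega
  apply hns
  apply solv_lift he he' hne hE hE'
  have huS := (hE.mem g.hmem he).2
  have hvS := (hE'.mem g.hmem he').2
  have hD : ∀ A, DD (F.erase e') (Function.update p e u) (Function.update q e v) i o A =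
      DD F p q i o A - cv A x u - cv A x v + cv A u v := by
    intro A; unfold DD; rw [dH_lift he he' hne hE hE']; ring
  apply IH _ _ _ S X _ i o
  · rw [Finset.card_erase_of_mem he']
    have := Finset.card_pos.2 ⟨e, he⟩
    omega
  apply mkGood hk0 IH g hns
  · intro f hf
    have := g.hmem f (Finset.mem_of_mem_erase hf)
    by_cases h : f = e
    · subst h; simp [huS, hvS]
    · simpa [h] using this
  · exact g.hi
  · exact g.ho
  · exact g.hX
  · exact g.hY
  · rfl
  · intro A hA
    rw [dH_lift he he' hne hE hE']
    have := cv_ind A x u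
    have := cv_ind A x v
    have := cv_ind A u v
    omega
  · rw [hD]
    have := g.h2
    have := cv_ind S x u
    have := cv_ind S x v
    have := cv_ind S u v
    have := ind_mem hx
    have := ind_mem huS
    have := ind_mem hvS
    omega
  · intro a ha haX h
    rw [hD]
    have hix : ind {a} x = 0 := by
      apply ind_not_mem; simp; rintro rfl; exact haX hxX
    have h1 := cv_ind {a} x u
    have h2 := cv_ind {a} x v
    have h3 := cv_ind {a} u v
    by_cases huv' : u = v
    · subst huv'
      by_cases hua : u = a
      · subst hua
        have := huv rfl haX
        omega
      · have : ind {a} u = 0 := by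
          apply ind_not_mem; simpa using hua
        omega
    · have h4 : ¬ (ind {a} u = 1 ∧ ind {a} v = 1) := by
        rintro ⟨h5, h6⟩
        have h5 := ind_cases {a} u
        have h6 := ind_cases {a} v
        simp only [Finset.mem_singleton] at h5 h6
        apply huv'
        rcases h5 with h5 | h5
        · omega
        · rcases h6 with h6 | h6
          · omega
          · rw [h5.2, h6.2]
      omega
  · intro A hA h
    rw [hD]
    have := cv_ind A x u
    have := cv_ind A x v
    have := cv_ind A u v
    omega

end p3
end RF

open Finset
set_option linter.unusedSectionVars false
set_option linter.unusedVariables false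
set_option linter.unusedSimpArgs false
namespace RF
section p4
variable {V E : Type*} [DecidableEq V] [DecidableEq E]

theorem zstep {k : ℤ} (hk : 2 ≤ k) {F : Finset E} {p q : E → V} {S X : Finset V}
    {b i o : V → ℤ} (IH : IHs V E k (S.card + F.card)) (g : Good k F p q S X b i o)
    {x : V} (hx : x ∈ S) (hxX : x ∈ X) :
    Solv k F p q S b := by
  by_contra hns
  have hk0 : 0 < k := by omega
  have hd0 : dH F p q {x} ≠ 0 := fun h => hns (zdrop hk IH g hx hxX h)
  have hd : 0 < dH F p q {x} := lt_of_le_of_ne (dH_nonneg _ _ _ _) (Ne.symm hd0)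
  have hi : i x = 0 := by
    by_contra h
    have := g.hi x
    exact hns (zshift_i hk IH g hx hxX (by omega) hd)
  have ho : o x = 0 := by
    by_contra h
    have := g.ho x
    exact hns (zshift_o hk IH g hx hxX (by omega) hd)
  have hbx : 2 * k ∣ b x := by simpa [hi, ho] using g.hX x hx hxX
  have hbe : (2 : ℤ) ∣ b x := (Dvd.intro _ rfl : (2:ℤ) ∣ 2 * k).trans hbx
  have hp : 2 ∣ dH F p q {x} + b x := by
    simpa using g.par {x} (by simpa using hx)
  obtain ⟨e, he, x', hx', u, hu, hE⟩ := exists_edge hd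
  have : x' = x := by simpa using hx'
  subst this
  have hux : u ≠ x' := by simpa using hu
  have huS := (hE.mem g.hmem he).2
  by_cases hex : ∃ e' ∈ F, ∃ v, v ≠ x' ∧ Ends p q e' x' v ∧ v ≠ u
  · obtain ⟨e', he', v, hv, hE', hvu⟩ := hex
    apply hns
    refine zlift hk IH g hx hxX he he' ?_ hE hE' hux hv (fun h => absurd h.symm hvu)
    rintro rfl
    unfold Ends at hE hE'
    grind
  · push Not at hex
    have hd' : 0 < dH (F.erase e) p q {x'} := by
      rw [dH_erase he hE]
      have := cv_ind {x'} x' u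
      omega
    obtain ⟨e', he', x'', hx'', v, hv, hE'⟩ := exists_edge hd'
    have : x'' = x' := by simpa using hx''
    subst this
    have hvx : v ≠ x'' := by simpa using hv
    have heF := Finset.mem_of_mem_erase he'
    have hvu := hex e' heF v hvx hE'
    subst hvu
    by_cases hS : S = {x'', v}
    · subst hS
      apply hns
      apply two_vertex hk0 hux.symm _ F b rfl g.hmem
      · have := g.hb
        rwa [Finset.sum_pair hux.symm] at this
      · have := (Nn_zero_iff hk0 (b x'')).2 hbx
        omega
      · exact hp
    · apply hns
      refine zlift hk IH g hx hxX he heF (Finset.ne_of_mem_erase he').symm hE hE' hux hvx ?_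
      intro _ hvX
      have h1 := slack (A := {x'', v}) hk0 IH g hns (by
        intro w hw; simp only [Finset.mem_insert, Finset.mem_singleton] at hw
        rcases hw with rfl | rfl <;> assumption) (Ne.symm hS)
        (fun h => hvX (h (by simp))) (by rw [Finset.card_pair hux.symm])
      have h2 : Nn k (TT b i o {x'', v}) = Nn k (TT b i o {v}) := by
        apply Nn_eq_of_dvd
        unfold TT
        rw [Finset.sum_pair hux.symm]; simp [hi, ho, hbx]
      have h3 : DD F p q i o {x'', v} ≤ DD F p q i o {v} := by
        unfold DD
        rw [Finset.sum_pair hux.symm, Finset.sum_singleton, hi, ho]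
        have : dH F p q {x'', v} ≤ dH F p q {v} := by
          apply Finset.sum_le_sum
          intro f hf
          have hf1 := hex f hf (q f)
          have hf2 := hex f hf (p f)
          unfold Ends at hf1 hf2
          unfold cv
          simp only [Finset.mem_insert, Finset.mem_singleton]
          grind
        omega
      omega

theorem conn {k : ℤ} (hk : 2 ≤ k) {F : Finset E} {p q : E → V} {S : Finset V}
    {b i o : V → ℤ} (g : Good k F p q S ∅ b i o) {A : Finset V} (hA : A ⊆ S) (hn : A.Nonempty)
    (hne : A ≠ S) : 0 < dH F p q A := by
  have hk0 : 0 < k := by omega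
  have h1 := g.h3 A hA hn hne (by simpa [Finset.subset_empty] using hn.ne_empty)
  have hn2 : (S \ A).Nonempty := by
    rw [Finset.sdiff_nonempty]; intro h; exact hne (Finset.Subset.antisymm hA h)
  have h2 := g.h3 (S \ A) Finset.sdiff_subset hn2 (by
    intro h
    obtain ⟨a, ha⟩ := hn
    have := hA ha
    rw [← h] at this
    simp [ha] at this) (by simpa [Finset.subset_empty] using hn2.ne_empty)
  have h3 := g.h2
  have hT : TT b i o S = TT b i o (S \ A) + TT b i o A := by
    unfold TT; rw [Finset.sum_sdiff hA]
  have hs := Finset.sum_sdiff (f := fun v => i v + o v) hA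
  rw [hT] at h3
  have h4 := Nn_add_le hk0 (TT b i o (S \ A)) (TT b i o A)
  unfold DD at h1 h2 h3
  rw [dH_compl g.hmem] at h2
  rw [dH_S g.hmem] at h3
  omega

def IH2s (V E : Type*) [DecidableEq V] (k : ℤ) (n : ℕ) (m : ℤ) : Prop :=
  ∀ (F : Finset E) (p q : E → V) (S X : Finset V) (b i o : V → ℤ), S.card + F.card = n →
    ∑ v ∈ S, (i v + o v) < m →
    Good k F p q S X b i o → Solv k F p q S b

theorem singleton_ind {a u : V} : (ind {a} u = 1 ∧ u = a) ∨ (ind {a} u = 0 ∧ u ≠ a) := by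
  by_cases h : u = a <;> simp [ind, h]

theorem allog {k : ℤ} (hk : 2 ≤ k) {F : Finset E} {p q : E → V} {S : Finset V}
    {b i o : V → ℤ} (IH : IHs V E k (S.card + F.card))
    (IH2 : IH2s V E k (S.card + F.card) (∑ v ∈ S, (i v + o v)))
    (g : Good k F p q S ∅ b i o) (hc : 2 ≤ S.card)
    (hT : ∀ v ∈ S, ¬ 2 * k ∣ TT b i o {v})
    (og : ∀ v ∈ S, 2 * k - 2 + Nn k (TT b i o {v} - 1) ≤ DD F p q i o {v} - 1) :
    Solv k F p q S b := by
  by_contra hns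
  have hk0 : 0 < k := by omega
  have hSn : S.Nonempty := Finset.card_pos.1 (by omega)
  have hne1 : ∀ v, ({v} : Finset V) ≠ S := by
    rintro v rfl; simp at hc
  have hY : ∃ y ∈ S, y ∉ (∅ : Finset V) := by
    obtain ⟨y, hy⟩ := hSn; exact ⟨y, hy, by simp⟩
  have ho : ∀ v ∈ S, o v = 0 := by
    intro v hv
    by_contra h
    have hov := g.ho v
    apply hns
    have hD : ∀ A, DD F p q i (fun w => o w - chi w v) A = DD F p q i o A - ind A v := by
      intro A; unfold DD
      simp only [Finset.sum_add_distrib, Finset.sum_sub_distrib, sum_chi]; ring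
    have hTT : ∀ A, TT b i (fun w => o w - chi w v) A = TT b i o A - ind A v := by
      intro A; unfold TT
      simp only [Finset.sum_add_distrib, Finset.sum_sub_distrib, sum_chi]; ring
    apply IH2 F p q S ∅ b i (fun w => o w - chi w v) rfl
    · simp only [Finset.sum_add_distrib, Finset.sum_sub_distrib, sum_chi, ind_mem hv]; omega
    apply mkGood hk0 IH g hns
    · exact g.hmem
    · exact g.hi
    · intro w
      have := g.ho w
      unfold chi; split_ifs with h
      · subst h; omega
      · omega
    · simp
    · exact Or.inl hY
    · rfl
    · intro A hA; simp
    · rw [hD, hTT, ind_mem hv]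
      have h5 := Nn_add_one hk0 (TT b i o S - 1)
      have := g.h2
      rw [sub_add_cancel] at h5
      omega
    · intro a ha _ h
      rw [hD, hTT]
      rcases singleton_ind (a := a) (u := v) with ⟨h1, h2⟩ | ⟨h1, h2⟩
      · subst h2
        rw [h1]; exact og v hv
      · rw [h1]; simpa using h
    · intro A hA h
      rw [hD, hTT]
      rcases ind_cases A v with ⟨h1, _⟩ | ⟨h1, _⟩
      · rw [h1]; rw [sub_zero]; omega
      · rw [h1]
        have := Nn_sub_one hk0 (TT b i o A)
        omega
  obtain ⟨v, hv⟩ := hSn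
  obtain ⟨e, he, y, hy, x, hx, hE⟩ := exists_edge (conn hk g (A := {v}) (by simpa using hv) (by simp) (hne1 v))
  have hxy : x ≠ y := by
    rintro rfl; exact hx hy
  obtain ⟨hyS, hxS⟩ := hE.mem g.hmem he
  have hD : ∀ A, DD (F.erase e) p q i (fun w => o w + (k - 1) * chi w x) A =
      DD F p q i o A - cv A y x + (k - 1) * ind A x := by
    intro A; unfold DD; rw [dH_erase he hE]
    simp only [Finset.sum_add_distrib, Finset.sum_sub_distrib, ← Finset.mul_sum, sum_chi]; ring
  have hTT : ∀ A, TT (fun w => b w - chi w y + chi w x) i (fun w => o w + (k - 1) * chi w x) A =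
      TT b i o A - ind A y + ind A x + (k - 1) * ind A x := by
    intro A; unfold TT
    simp only [Finset.sum_add_distrib, Finset.sum_sub_distrib, ← Finset.mul_sum, sum_chi]; ring
  apply hns
  apply solv_delete he hE
  apply IH _ p q S ∅ _ i (fun w => o w + (k - 1) * chi w x)
  · rw [Finset.card_erase_of_mem he]
    have := Finset.card_pos.2 ⟨e, he⟩
    omega
  apply mkGood hk0 IH g hns
  · intro e' h; exact g.hmem e' (Finset.mem_of_mem_erase h)
  · exact g.hi
  · intro w
    have := g.ho w
    have h2 : 0 ≤ chi w x := by unfold chi; split_ifs <;> simp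
    have := mul_nonneg (show 0 ≤ k - 1 by omega) h2
    omega
  · simp
  · exact Or.inl hY
  · simp only [Finset.sum_add_distrib, Finset.sum_sub_distrib, sum_chi, ind_mem hxS, ind_mem hyS]
    ring
  · intro A hA
    rw [dH_erase he hE]
    simp only [Finset.sum_add_distrib, Finset.sum_sub_distrib, sum_chi]
    have := cv_ind A y x
    omega
  · rw [hD, hTT, ind_mem hxS, ind_mem hyS]
    have hcv : cv S y x = 0 := by simp [cv, hxS, hyS]
    rw [hcv]
    have h2 := g.h2
    have e1 : ∑ v ∈ S, (i v + o v) = ∑ v ∈ S, i v :=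
      Finset.sum_congr rfl fun v hv => by rw [ho v hv]; ring
    have e2 : DD F p q i o S = ∑ v ∈ S, i v := by
      unfold DD; rw [dH_S g.hmem, e1]; ring
    have e3 : TT b i o S = ∑ v ∈ S, b v - ∑ v ∈ S, i v := by
      unfold TT; rw [← Finset.sum_sub_distrib]
      exact Finset.sum_congr rfl fun v hv => by rw [ho v hv]; ring
    rw [e2, e3] at h2 ⊢
    have hI0 : 0 ≤ ∑ v ∈ S, i v := Finset.sum_nonneg fun v _ => g.hi v
    have hb := g.hb
    generalize ∑ v ∈ S, i v = I at *
    generalize ∑ v ∈ S, b v = B at *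
    have e4 : Nn k (B - I) = Nn k (-I) := Nn_eq_of_dvd _ _ (by simpa using hb)
    have e5 : Nn k (B - I - 1 + 1 + (k - 1) * 1) = Nn k (k - 1 - I) := by
      apply Nn_eq_of_dvd; convert hb using 1; ring
    rw [e4] at h2
    rw [e5]
    have := Nn_I hk I hI0 h2
    omega
  · intro a ha _ h
    rw [hD, hTT]
    rcases singleton_ind (a := a) (u := x) with ⟨h1, h2⟩ | ⟨h1, h2⟩
    · subst h2
      have h3 : ind {x} y = 0 := by apply ind_not_mem; simpa using hxy.symm
      have h4 := cv_ind {x} y x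
      rw [h1, h3]
      have h5 : TT b i o {x} - 0 + 1 + (k - 1) * 1 = TT b i o {x} + k := by ring
      rw [h5]
      have h6 := Nn_add_k hk0 (TT b i o {x})
      have h7 : 1 ≤ Nn k (TT b i o {x}) := by
        by_contra h
        exact hT x ha ((Nn_zero_iff hk0 _).1 (by omega))
      omega
    · rw [h1]
      rcases singleton_ind (a := a) (u := y) with ⟨h3, h4⟩ | ⟨h3, h4⟩
      · subst h4
        have := cv_ind {y} y x
        have h5 := og y ha
        rw [h3]
        have h6 : TT b i o {y} - 1 + 0 + (k - 1) * 0 = TT b i o {y} - 1 := by ring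
        rw [h6]; omega
      · have := cv_ind {a} y x
        rw [h3]
        have h6 : TT b i o {a} - 0 + 0 + (k - 1) * 0 = TT b i o {a} := by ring
        rw [h6]; omega
  · intro A hA h
    rw [hD, hTT]
    have hle := Nn_le_k (k := k) (TT b i o A - ind A y + ind A x + (k - 1) * ind A x)
    have h0 := Nn_nonneg hk0 (TT b i o A)
    rcases cv_ind A y x with ⟨h1, h2⟩ | ⟨h1, h2, h3⟩ | ⟨h1, h2, h3⟩
    · rcases ind_cases A x with ⟨h3, _⟩ | ⟨h3, _⟩
      · rw [h1, h2, h3]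
        have h6 : TT b i o A - 0 + 0 + (k - 1) * 0 = TT b i o A := by ring
        rw [h6]; omega
      · rw [h2, h3] at hle
        rw [h1, h2, h3]
        omega
    · rw [h1, h2, h3]
      have h6 : TT b i o A - 1 + 0 + (k - 1) * 0 = TT b i o A - 1 := by ring
      rw [h6]
      have := Nn_sub_one hk0 (TT b i o A)
      omega
    · rw [h2, h3] at hle
      rw [h1, h2, h3]
      omega

theorem delstep {k : ℤ} (hk : 2 ≤ k) {F : Finset E} {p q : E → V} {S : Finset V}
    {b i o : V → ℤ} (IH : IHs V E k (S.card + F.card))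
    (g : Good k F p q S ∅ b i o) {e : E} {u x : V} (he : e ∈ F) (hE : Ends p q e u x)
    (hux : u ≠ x)
    (og : 2 * k - 2 + Nn k (TT b i o {u} - 1) ≤ DD F p q i o {u} - 1)
    (ig : 2 * k - 2 + Nn k (TT b i o {x} + 1) ≤ DD F p q i o {x} - 1) :
    Solv k F p q S b := by
  by_contra hns
  have hk0 : 0 < k := by omega
  obtain ⟨huS, hxS⟩ := hE.mem g.hmem he
  have hD : ∀ A, DD (F.erase e) p q i o A = DD F p q i o A - cv A u x := by
    intro A; unfold DD; rw [dH_erase he hE]; ring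
  have hTT : ∀ A, TT (fun w => b w - chi w u + chi w x) i o A =
      TT b i o A - ind A u + ind A x := by
    intro A; unfold TT
    simp only [Finset.sum_add_distrib, Finset.sum_sub_distrib, sum_chi]; ring
  apply hns
  apply solv_delete he hE
  apply IH _ p q S ∅ _ i o
  · rw [Finset.card_erase_of_mem he]
    have := Finset.card_pos.2 ⟨e, he⟩
    omega
  apply mkGood hk0 IH g hns
  · intro e' h; exact g.hmem e' (Finset.mem_of_mem_erase h)
  · exact g.hi
  · exact g.ho
  · simp
  · exact Or.inl ⟨u, huS, by simp⟩
  · simp only [Finset.sum_add_distrib, Finset.sum_sub_distrib, sum_chi, ind_mem hxS, ind_mem huS]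
    ring
  · intro A hA
    rw [dH_erase he hE]
    simp only [Finset.sum_add_distrib, Finset.sum_sub_distrib, sum_chi]
    have := cv_ind A u x
    omega
  · rw [hD, hTT, ind_mem hxS, ind_mem huS]
    have hcv : cv S u x = 0 := by simp [cv, hxS, huS]
    rw [hcv, sub_zero, sub_add_cancel]
    exact g.h2
  · intro a ha _ h
    rw [hD, hTT]
    have hcv := cv_ind {a} u x
    rcases singleton_ind (a := a) (u := x) with ⟨h1, h2⟩ | ⟨h1, h2⟩
    · subst h2
      have h3 : ind {x} u = 0 := by apply ind_not_mem; simpa using hux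
      rw [h1, h3, sub_zero]; omega
    · rcases singleton_ind (a := a) (u := u) with ⟨h3, h4⟩ | ⟨h3, h4⟩
      · subst h4
        rw [h1, h3, add_zero]; omega
      · rw [h1, h3, add_zero, sub_zero]; omega
  · intro A hA h
    rw [hD, hTT]
    rcases cv_ind A u x with ⟨h1, h2⟩ | ⟨h1, h2, h3⟩ | ⟨h1, h2, h3⟩
    · rw [h1, h2, sub_add_cancel]; omega
    · rw [h1, h2, h3, add_zero]
      have := Nn_sub_one hk0 (TT b i o A)
      omega
    · rw [h1, h2, h3, sub_zero]
      have := Nn_add_one hk0 (TT b i o A)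
      omega

theorem core {k : ℤ} (hk : 2 ≤ k) {F : Finset E} {p q : E → V} {S X : Finset V}
    {b i o : V → ℤ} (IH : IHs V E k (S.card + F.card))
    (IH2 : IH2s V E k (S.card + F.card) (∑ v ∈ S, (i v + o v)))
    (g : Good k F p q S X b i o) : Solv k F p q S b := by
  have hk0 : 0 < k := by omega
  by_cases hc : S.card ≤ 1
  · refine ⟨fun _ => 1, fun _ => Or.inl rfl, ?_⟩
    intro v hv
    have hall : ∀ w ∈ S, w = v := fun w hw => Finset.card_le_one.1 hc w hw v hv
    have hz : ∑ e ∈ F, (1:ℤ) * (chi v (p e) - chi v (q e)) = 0 := by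
      apply Finset.sum_eq_zero
      intro e he
      rw [hall _ (g.hmem e he).1, hall _ (g.hmem e he).2]; ring
    have hS : S = {v} := by
      ext w; simp only [Finset.mem_singleton]
      exact ⟨hall w, fun h => h ▸ hv⟩
    have := g.hb
    rw [hS, Finset.sum_singleton] at this
    rw [hz, zero_sub, Int.dvd_neg]; exact this
  by_contra hns
  push Not at hc
  have hne1 : ∀ v, ({v} : Finset V) ≠ S := by
    rintro v rfl; simp at hc
  have hXS : ∀ x ∈ S, x ∉ X := fun x hx hxX => hns (zstep hk IH g hx hxX)
  have hSn : S.Nonempty := Finset.card_pos.1 (by omega)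
  have g0 : Good k F p q S ∅ b i o := by
    refine ⟨g.hmem, g.hi, g.ho, by simp, ?_, g.hb, g.par, g.h2, ?_⟩
    · obtain ⟨y, hy⟩ := hSn; exact Or.inl ⟨y, hy, by simp⟩
    · intro A hA hn hne _
      apply g.h3 A hA hn hne
      obtain ⟨a, ha⟩ := hn
      intro h; exact hXS a (hA ha) (h ha)
  have hT : ∀ v ∈ S, ¬ 2 * k ∣ TT b i o {v} := by
    intro v hv hdiv
    apply hns
    refine zstep hk IH (X := {v}) (i := i) (o := o) (x := v) ?_ hv (by simp)
    refine ⟨g0.hmem, g0.hi, g0.ho, ?_, ?_, g0.hb, g0.par, g0.h2, ?_⟩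
    · intro x hx hxv
      have : x = v := by simpa using hxv
      subst this
      simpa [TT] using hdiv
    · left
      obtain ⟨y, hy, hyv⟩ := Finset.exists_mem_ne (by omega : 1 < S.card) v
      exact ⟨y, hy, by simpa using hyv⟩
    · intro A hA hn hne _
      exact g0.h3 A hA hn hne (by simpa [Finset.subset_empty] using hn.ne_empty)
  have hor : ∀ v ∈ S, 2 * k - 2 + Nn k (TT b i o {v} - 1) ≤ DD F p q i o {v} - 1 ∨
      2 * k - 2 + Nn k (TT b i o {v} + 1) ≤ DD F p q i o {v} - 1 := by
    intro v hv
    have h1 := g0.h3 {v} (by simpa using hv) (by simp) (hne1 v) (by simp)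
    have h7 : 1 ≤ Nn k (TT b i o {v}) := by
      by_contra h
      exact hT v hv ((Nn_zero_iff hk0 _).1 (by omega))
    rcases Nn_dec hk0 _ h7 with h | h
    · left; omega
    · right; omega
  let P := S.filter (fun v => 2 * k - 2 + Nn k (TT b i o {v} - 1) ≤ DD F p q i o {v} - 1)
  by_cases hP : P.Nonempty
  · by_cases hPS : P = S
    · apply hns
      apply allog hk IH IH2 g0 hc hT
      intro v hv
      rw [← hPS] at hv
      exact (Finset.mem_filter.1 hv).2
    · obtain ⟨e, he, u, hu, v, hv, hE⟩ := exists_edge (conn hk g0 (Finset.filter_subset _ _) hP hPS)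
      have huv : u ≠ v := by rintro rfl; exact hv hu
      obtain ⟨huS, hvS⟩ := hE.mem g.hmem he
      have hv' : ¬ (2 * k - 2 + Nn k (TT b i o {v} - 1) ≤ DD F p q i o {v} - 1) :=
        fun h => hv (Finset.mem_filter.2 ⟨hvS, h⟩)
      exact hns (delstep hk IH g0 he hE huv (Finset.mem_filter.1 hu).2
        ((hor v hvS).resolve_left hv'))
  · have hd : ∀ A, dH F q p A = dH F p q A := fun A =>
      Finset.sum_congr rfl fun e _ => cv_symm _ _ _
    have hD : ∀ A, DD F q p o i A = DD F p q i o A := by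
      intro A; unfold DD; rw [hd]; congr 1; apply Finset.sum_congr rfl; intros; ring
    have hT' : ∀ A, TT (fun v => - b v) o i A = - TT b i o A := by
      intro A; unfold TT; rw [← Finset.sum_neg_distrib]; apply Finset.sum_congr rfl; intros; ring
    apply hns
    apply solv_rev
    have e1 : ∑ v ∈ S, (o v + i v) = ∑ v ∈ S, (i v + o v) :=
      Finset.sum_congr rfl fun v _ => add_comm _ _
    apply allog hk IH (by rw [e1]; exact IH2) (g0.rev hk0) hc
    · intro v hv
      rw [hT', Int.dvd_neg]; exact hT v hv
    · intro v hv
      rw [hD, hT']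
      have h1 : - TT b i o {v} - 1 = - (TT b i o {v} + 1) := by ring
      rw [h1, Nn_neg hk0]
      apply (hor v hv).resolve_left
      intro h
      exact hP ⟨v, Finset.mem_filter.2 ⟨hv, h⟩⟩

theorem main {k : ℤ} (hk : 2 ≤ k) : ∀ (n : ℕ), IHs V E k n := by
  intro n
  induction n with
  | zero => intro F p q S X b i o h; omega
  | succ n ih =>
    have inner : ∀ m : ℕ, IH2s V E k n m := by
      intro m
      induction m with
      | zero =>
        intro F p q S X b i o h1 h2 g
        have : 0 ≤ ∑ v ∈ S, (i v + o v) :=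
          Finset.sum_nonneg fun v _ => add_nonneg (g.hi v) (g.ho v)
        push_cast at h2
        omega
      | succ m ihm =>
        intro F p q S X b i o h1 h2 g
        subst h1
        apply core hk ih _ g
        intro F' p' q' S' X' b' i' o' h1' h2' g'
        apply ihm F' p' q' S' X' b' i' o' h1' _ g'
        push_cast at h2
        omega
    intro F p q S X b i o h g
    by_cases h' : S.card + F.card < n
    · exact ih F p q S X b i o h' g
    · apply inner ((∑ v ∈ S, (i v + o v)).toNat + 1) F p q S X b i o (by omega) _ g
      have := Int.self_le_toNat (∑ v ∈ S, (i v + o v))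
      push_cast
      omega

theorem main' {k : ℤ} (hk : 2 ≤ k) {F : Finset E} {p q : E → V} {S X : Finset V}
    {b i o : V → ℤ} (g : Good k F p q S X b i o) : Solv k F p q S b :=
  main hk _ F p q S X b i o (Nat.lt_succ_self _) g

end p4
end RF

open Finset
set_option linter.unusedSectionVars false
set_option linter.unusedVariables false
set_option linter.unusedSimpArgs false
namespace RF
section p5
variable {V E : Type*} [DecidableEq V] [DecidableEq E]

theorem outer {k : ℤ} (hk : 2 ≤ k) : ∀ (n : ℕ) (F : Finset E) (p q : E → V) (S X : Finset V)
    (b : V → ℤ), S.card < n → (∀ e ∈ F, p e ∈ S ∧ q e ∈ S) →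
    (∀ x ∈ S, x ∈ X → 2 * k ∣ b x) → (∀ v ∈ S, v ∉ X → ¬ 2 * k ∣ b v) →
    2 * k ∣ ∑ v ∈ S, b v → (∀ A ⊆ S, 2 ∣ dH F p q A + ∑ v ∈ A, b v) →
    (∀ A ⊆ S, ¬ 2 * k ∣ ∑ v ∈ A, b v → 3 * k - 2 ≤ dH F p q A) → Solv k F p q S b := by
  have hk0 : 0 < k := by omega
  intro n
  induction n with
  | zero => intro F p q S X b h; omega
  | succ n ih =>
    intro F p q S X b hn hmem hX hnX hb par hodd
    have hDD : ∀ A, DD F p q (fun _ => 0) (fun _ => 0) A = dH F p q A := by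
      intro A; simp [DD]
    have hTT : ∀ A, TT b (fun _ => 0) (fun _ => 0) A = ∑ v ∈ A, b v := by
      intro A; simp [TT]
    let bad : Finset V → Prop := fun A => A ≠ S ∧ A.Nonempty ∧ ¬ A ⊆ X ∧ 2 * k ∣ ∑ v ∈ A, b v ∧
      dH F p q A < 2 * k - 2
    classical
    have hthree : ∀ A ⊆ S, A.Nonempty → A ≠ S → ¬ A ⊆ X → ¬ bad A →
        2 * k - 2 + Nn k (∑ v ∈ A, b v) ≤ dH F p q A := by
      intro A hA h1 h2 h3 h4
      by_cases h5 : 2 * k ∣ ∑ v ∈ A, b v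
      · have h6 : ¬ (dH F p q A < 2 * k - 2) := fun h => h4 ⟨h2, h1, h3, h5, h⟩
        have := (Nn_zero_iff hk0 _).2 h5
        omega
      · have := hodd A hA h5
        have := Nn_le_k (k := k) (∑ v ∈ A, b v)
        omega
    by_cases hbad : (S.powerset.filter bad).Nonempty
    · obtain ⟨A, hAmem, hmin⟩ := Finset.exists_min_image _ Finset.card hbad
      rw [Finset.mem_filter, Finset.mem_powerset] at hAmem
      obtain ⟨hA, hne, hnon, hAX, hdiv, hlt⟩ := hAmem
      obtain ⟨a, ha, haX⟩ := Finset.not_subset.1 hAX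
      have hcard : A.card < S.card := Finset.card_lt_card (hA.ssubset_of_ne hne)
      have hc2 : 2 ≤ A.card := by
        by_contra h
        have : A.card = 1 := by have := hnon.card_pos; omega
        obtain ⟨a', rfl⟩ := Finset.card_eq_one.1 this
        have : a = a' := by simpa using ha
        subst this
        exact hnX a (hA ha) haX (by simpa using hdiv)
      apply sub_good (X := X) (i := fun _ => 0) (o := fun _ => 0) ha hA (by simp) (by simp)
        (fun x hx hxX => by simpa using hX x (hA hx) hxX) hAX (fun A' h => par A' (h.trans hA))
      · rw [hDD, hTT]
        have := Nn_nonneg hk0 (∑ v ∈ A, b v)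
        omega
      · intro A' h1 h2 h3 h4
        rw [hDD, hTT]
        have hlt' : A'.card < A.card := Finset.card_lt_card (h1.ssubset_of_ne h3)
        apply hthree A' (h1.trans hA) h2 (by rintro rfl; omega) h4
        intro hb'
        have := hmin A' (Finset.mem_filter.2 ⟨Finset.mem_powerset.2 (h1.trans hA), hb'⟩)
        omega
      · apply ih F _ _ _ (insert a (X \ A))
        · have := ctrS_card ha hA hc2
          omega
        · intro e he; exact ⟨ctr_mem (hmem e he).1, ctr_mem (hmem e he).2⟩
        · intro x hx hxX
          by_cases hxa : x = a
          · subst hxa; rw [ctr_f_a ha hA]; exact hdiv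
          · simp only [ctrS, Finset.mem_insert, Finset.mem_sdiff, hxa, false_or] at hx hxX
            rw [ctr_f_off ha _ hx.1 hx.2]; exact hX x hx.1 hxX.1
        · intro x hx hxX
          simp only [Finset.mem_insert, Finset.mem_sdiff, not_or] at hxX
          simp only [ctrS, Finset.mem_insert, Finset.mem_sdiff, hxX.1, false_or] at hx
          rw [ctr_f_off ha _ hx.1 hx.2]
          exact hnX x hx.1 (fun h => hxX.2 ⟨h, hx.2⟩)
        · rw [ctr_sum, ctrB_S]; exact hb
        · intro A' hA'
          rw [ctr_sum, ctr_dH hmem]; exact par _ (ctrB_sub _ _ _ _)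
        · intro A' hA'
          rw [ctr_sum, ctr_dH hmem]; exact hodd _ (ctrB_sub _ _ _ _)
      · intro F' _ b' i' o' g
        exact main' hk g
    · refine main' hk (X := X) (i := fun _ => 0) (o := fun _ => 0) ?_
      refine ⟨hmem, by simp, by simp, ?_, Or.inr (by simp), hb, par, ?_, ?_⟩
      · intro x hx hxX; simpa using hX x hx hxX
      · rw [hDD, dH_S hmem]
        have := Nn_nonneg hk0 (TT b (fun _ => 0) (fun _ => 0) S)
        omega
      · intro A hA h1 h2 h3
        rw [hDD, hTT]
        apply hthree A hA h1 h2 h3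
        intro h
        exact hbad ⟨A, Finset.mem_filter.2 ⟨Finset.mem_powerset.2 hA, h⟩⟩

/-! ### Splitting and colouring -/

theorem split_one {k : ℕ} : ∀ (m : ℕ) (T : Finset E), T.card = k * m →
    ∃ h : E → ℕ, (∀ e ∈ T, h e < m) ∧ ∀ e ∈ T, (T.filter fun e' => h e' = h e).card = k := by
  intro m
  induction m with
  | zero =>
    intro T hT
    have : T = ∅ := by simpa using hT
    subst this
    exact ⟨fun _ => 0, by simp, by simp⟩
  | succ m ih =>
    intro T hT
    obtain ⟨U, hU, hUc⟩ := Finset.exists_subset_card_eq (s := T) (n := k) (by rw [hT]; exact Nat.le_mul_of_pos_right _ (by omega))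
    obtain ⟨h, h1, h2⟩ := ih (T \ U) (by
      rw [Finset.card_sdiff_of_subset hU, hT, hUc, Nat.mul_succ]; omega)
    refine ⟨fun e => if e ∈ U then m else h e, ?_, ?_⟩
    · intro e he
      dsimp only
      split_ifs with h'
      · omega
      · have := h1 e (Finset.mem_sdiff.2 ⟨he, h'⟩); omega
    · intro e he
      by_cases h' : e ∈ U
      · rw [← hUc]
        congr 1
        ext e'
        simp only [Finset.mem_filter, if_pos h']
        constructor
        · rintro ⟨h3, h4⟩
          by_contra h5
          rw [if_neg h5] at h4
          have := h1 e' (Finset.mem_sdiff.2 ⟨h3, h5⟩); omega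
        · intro h3; exact ⟨hU h3, if_pos h3⟩
      · have h6 := Finset.mem_sdiff.2 ⟨he, h'⟩
        have h7 := h1 e h6
        rw [← h2 e h6]
        congr 1
        ext e'
        simp only [Finset.mem_filter, Finset.mem_sdiff, if_neg h']
        constructor
        · rintro ⟨h3, h4⟩
          by_cases h5 : e' ∈ U
          · rw [if_pos h5] at h4; omega
          · rw [if_neg h5] at h4; exact ⟨⟨h3, h5⟩, h4⟩
        · rintro ⟨⟨h3, h4⟩, h5⟩; exact ⟨h3, by rw [if_neg h4]; exact h5⟩

theorem split_all {k : ℕ} (F : Finset E) (φ : E → V)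
    (hdiv : ∀ v, k ∣ (F.filter fun e => φ e = v).card) :
    ∃ f : E → V × ℕ, (∀ e, (f e).1 = φ e) ∧
      ∀ e ∈ F, (F.filter fun e' => f e' = f e).card = k := by
  have : ∀ v, ∃ h : E → ℕ, ∀ e ∈ F.filter (fun e => φ e = v),
      ((F.filter (fun e => φ e = v)).filter fun e' => h e' = h e).card = k := by
    intro v
    obtain ⟨m, hm⟩ := hdiv v
    obtain ⟨h, -, h2⟩ := split_one m _ hm
    exact ⟨h, h2⟩
  choose h hh using this
  refine ⟨fun e => (φ e, h (φ e) e), fun e => rfl, ?_⟩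
  intro e he
  rw [← hh (φ e) e (Finset.mem_filter.2 ⟨he, rfl⟩)]
  congr 1
  ext e'
  simp only [Finset.mem_filter, Prod.mk.injEq]
  constructor
  · rintro ⟨h1, h2, h3⟩; rw [h2] at h3; exact ⟨⟨h1, h2⟩, h3⟩
  · rintro ⟨⟨h1, h2⟩, h3⟩; exact ⟨h1, h2, by rw [h2]; exact h3⟩

theorem card_fib {k : ℕ} {α : Type*} [DecidableEq α] {F : Finset E} {f : E → α}
    (h : ∀ e ∈ F, (F.filter fun e' => f e' = f e).card = k) (s : Finset α) (hs : s ⊆ F.image f) :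
    (F.filter fun e => f e ∈ s).card = s.card * k := by
  rw [Finset.card_eq_sum_card_fiberwise (f := f) (t := s) (by intro e he; simp at he; exact he.2)]
  rw [Finset.sum_const_nat]
  intro a ha
  obtain ⟨e, he, rfl⟩ := Finset.mem_image.1 (hs ha)
  rw [← h e he]
  congr 1
  ext e'
  simp only [Finset.mem_filter]
  constructor
  · rintro ⟨⟨h1, _⟩, h2⟩; exact ⟨h1, h2⟩
  · rintro ⟨h1, h2⟩; exact ⟨⟨h1, by rw [h2]; exact ha⟩, h2⟩

theorem matching {k : ℕ} (hk : 0 < k) {α β : Type*} [DecidableEq α] [DecidableEq β] {F : Finset E}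
    {f : E → α} {g : E → β}
    (hf : ∀ e ∈ F, (F.filter fun e' => f e' = f e).card = k)
    (hg : ∀ e ∈ F, (F.filter fun e' => g e' = g e).card = k) :
    ∃ M ⊆ F, (∀ e ∈ F, (M.filter fun e' => f e' = f e).card = 1) ∧
      (∀ e ∈ F, (M.filter fun e' => g e' = g e).card = 1) := by
  let ι := {a // a ∈ F.image f}
  let t : ι → Finset β := fun a => (F.filter fun e => f e = a.1).image g
  have hall : ∀ s : Finset ι, s.card ≤ (s.biUnion t).card := by
    intro s
    have h1 := card_fib hf (s.map (Function.Embedding.subtype _)) (by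
      intro a ha
      simp only [Finset.mem_map, Function.Embedding.coe_subtype] at ha
      obtain ⟨a', _, rfl⟩ := ha
      exact a'.2)
    have h2 := card_fib hg (s.biUnion t) (by
      intro b hb
      simp only [Finset.mem_biUnion, t] at hb
      obtain ⟨a, _, hb⟩ := hb
      exact Finset.image_subset_image (Finset.filter_subset _ _) hb)
    rw [Finset.card_map] at h1
    have h3 : s.card * k ≤ (s.biUnion t).card * k := by
      rw [← h1, ← h2]
      apply Finset.card_le_card
      intro e he
      simp only [Finset.mem_filter, Finset.mem_map, Function.Embedding.coe_subtype] at he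
      obtain ⟨he, a, ha, hae⟩ := he
      refine Finset.mem_filter.2 ⟨he, Finset.mem_biUnion.2 ⟨a, ha, ?_⟩⟩
      exact Finset.mem_image_of_mem _ (Finset.mem_filter.2 ⟨he, hae.symm⟩)
    exact Nat.le_of_mul_le_mul_right h3 hk
  obtain ⟨h, hinj, hmem⟩ := (Finset.all_card_le_biUnion_card_iff_exists_injective t).1 hall
  have : ∀ a : ι, ∃ e ∈ F, f e = a.1 ∧ g e = h a := by
    intro a
    obtain ⟨e, he, he2⟩ := Finset.mem_image.1 (hmem a)
    obtain ⟨h1, h2⟩ := Finset.mem_filter.1 he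
    exact ⟨e, h1, h2, he2⟩
  choose m hm1 hm2 hm3 using this
  have hcard : (F.image f).card = (F.image g).card := by
    have h1 := card_fib hf _ subset_rfl
    have h2 := card_fib hg _ subset_rfl
    rw [Finset.filter_true_of_mem (fun e he => Finset.mem_image_of_mem _ he)] at h1 h2
    exact Nat.eq_of_mul_eq_mul_right hk (h1.symm.trans h2)
  have himg : (Finset.univ : Finset ι).image h = F.image g := by
    apply Finset.eq_of_subset_of_card_le
    · intro b hb
      obtain ⟨a, _, rfl⟩ := Finset.mem_image.1 hb
      exact Finset.mem_image.2 ⟨m a, hm1 a, hm3 a⟩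
    · rw [Finset.card_image_of_injective _ hinj, Finset.card_univ, Fintype.card_coe, hcard]
  refine ⟨Finset.univ.image m, ?_, ?_, ?_⟩
  · intro e he
    obtain ⟨a, _, rfl⟩ := Finset.mem_image.1 he
    exact hm1 a
  · intro e he
    rw [Finset.card_eq_one]
    refine ⟨m ⟨f e, Finset.mem_image_of_mem _ he⟩, ?_⟩
    ext e'
    simp only [Finset.mem_filter, Finset.mem_image, Finset.mem_univ, true_and, Finset.mem_singleton]
    constructor
    · rintro ⟨⟨a, rfl⟩, h1⟩
      congr 1
      apply Subtype.ext
      rw [← hm2, h1]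
    · rintro rfl
      exact ⟨⟨_, rfl⟩, hm2 _⟩
  · intro e he
    rw [Finset.card_eq_one]
    have : g e ∈ (Finset.univ : Finset ι).image h := by rw [himg]; exact Finset.mem_image_of_mem _ he
    obtain ⟨a, _, ha⟩ := Finset.mem_image.1 this
    refine ⟨m a, ?_⟩
    ext e'
    simp only [Finset.mem_filter, Finset.mem_image, Finset.mem_univ, true_and, Finset.mem_singleton]
    constructor
    · rintro ⟨⟨a', rfl⟩, h1⟩
      congr 1
      apply hinj
      rw [← hm3, h1, ha]
    · rintro rfl
      exact ⟨⟨_, rfl⟩, by rw [hm3, ha]⟩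

theorem sdiff_fib {k : ℕ} {α : Type*} [DecidableEq α] {F M : Finset E} {f : E → α} (hM : M ⊆ F)
    (hf : ∀ e ∈ F, (F.filter fun e' => f e' = f e).card = k + 1)
    (h1 : ∀ e ∈ F, (M.filter fun e' => f e' = f e).card = 1) :
    ∀ e ∈ F \ M, ((F \ M).filter fun e' => f e' = f e).card = k := by
  intro e he
  have he := (Finset.mem_sdiff.1 he).1
  have a := hf e he
  have b := h1 e he
  have : (F \ M).filter (fun e' => f e' = f e) =
      (F.filter fun e' => f e' = f e) \ (M.filter fun e' => f e' = f e) := by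
    ext e'; simp only [Finset.mem_filter, Finset.mem_sdiff]; tauto
  rw [this, Finset.card_sdiff_of_subset (Finset.filter_subset_filter _ hM)]
  omega

theorem colour {α β : Type*} [DecidableEq α] [DecidableEq β] {f : E → α} {g : E → β} :
    ∀ (k : ℕ) (F : Finset E),
    (∀ e ∈ F, (F.filter fun e' => f e' = f e).card = k) →
    (∀ e ∈ F, (F.filter fun e' => g e' = g e).card = k) →
    ∃ c : E → ℕ, (∀ e ∈ F, c e < k) ∧ (∀ e ∈ F, ∀ e' ∈ F, f e = f e' → c e = c e' → e = e') ∧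
      (∀ e ∈ F, ∀ e' ∈ F, g e = g e' → c e = c e' → e = e') := by
  intro k
  induction k with
  | zero =>
    intro F hf hg
    have : F = ∅ := by
      apply Finset.eq_empty_of_forall_notMem
      intro e he
      have := Finset.card_eq_zero.1 (hf e he)
      have h2 : e ∈ F.filter fun e' => f e' = f e := Finset.mem_filter.2 ⟨he, rfl⟩
      rw [this] at h2
      simp at h2
    subst this
    exact ⟨fun _ => 0, by simp, by simp, by simp⟩
  | succ k ih =>
    intro F hf hg
    obtain ⟨M, hM, hMf, hMg⟩ := matching (Nat.succ_pos k) hf hg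
    obtain ⟨c, hc, hcf, hcg⟩ := ih (F \ M) (sdiff_fib hM hf hMf) (sdiff_fib hM hg hMg)
    have aux : ∀ {γ : Type _} [DecidableEq γ] (f : E → γ),
        (∀ e ∈ F, (M.filter fun e' => f e' = f e).card = 1) →
        (∀ e ∈ F \ M, ∀ e' ∈ F \ M, f e = f e' → c e = c e' → e = e') →
        ∀ e ∈ F, ∀ e' ∈ F, f e = f e' → (if e ∈ M then k else c e) = (if e' ∈ M then k else c e') →
          e = e' := by
      intro γ _ f h1 h2 e he e' he' h3 h4
      by_cases h5 : e ∈ M <;> by_cases h6 : e' ∈ M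
      · exact Finset.card_le_one.1 (h1 e he).le e (Finset.mem_filter.2 ⟨h5, rfl⟩) e'
          (Finset.mem_filter.2 ⟨h6, h3.symm⟩)
      · have := hc e' (Finset.mem_sdiff.2 ⟨he', h6⟩)
        simp [h5, h6] at h4; omega
      · have := hc e (Finset.mem_sdiff.2 ⟨he, h5⟩)
        simp [h5, h6] at h4; omega
      · simp only [h5, h6, if_false] at h4
        exact h2 e (Finset.mem_sdiff.2 ⟨he, h5⟩) e' (Finset.mem_sdiff.2 ⟨he', h6⟩) h3 h4
    refine ⟨fun e => if e ∈ M then k else c e, ?_, ?_, ?_⟩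
    · intro e he
      dsimp only
      split_ifs with h
      · omega
      · have := hc e (Finset.mem_sdiff.2 ⟨he, h⟩); omega
    · intro e he e' he' h3 h4
      by_cases h5 : e ∈ M <;> by_cases h6 : e' ∈ M
      · exact Finset.card_le_one.1 (hMf e he).le e (Finset.mem_filter.2 ⟨h5, rfl⟩) e'
          (Finset.mem_filter.2 ⟨h6, h3.symm⟩)
      · have := hc e' (Finset.mem_sdiff.2 ⟨he', h6⟩)
        simp [h5, h6] at h4; omega
      · have := hc e (Finset.mem_sdiff.2 ⟨he, h5⟩)
        simp [h5, h6] at h4; omega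
      · simp only [h5, h6, if_false] at h4
        exact hcf e (Finset.mem_sdiff.2 ⟨he, h5⟩) e' (Finset.mem_sdiff.2 ⟨he', h6⟩) h3 h4
    · exact aux g hMg hcg

/-- every colour class has `1/k` of the edges at `v` -/
theorem count {k : ℕ} [Fintype E] {φ : E → V} {f : E → V × ℕ} (hφ : ∀ e, (f e).1 = φ e)
    (hf : ∀ e, (univ.filter fun e' => f e' = f e).card = k)
    (c : E → Fin k) (hc : ∀ e e', f e = f e' → c e = c e' → e = e') (v : V) (j : Fin k) :
    k * (univ.filter fun e => φ e = v ∧ c e = j).card = (univ.filter fun e => φ e = v).card := by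
  let W := univ.filter fun e => φ e = v
  have hW : W.card = (W.image f).card * k := by
    rw [Finset.card_eq_sum_card_image f W, Finset.sum_const_nat]
    intro a ha
    obtain ⟨e, he, rfl⟩ := Finset.mem_image.1 ha
    rw [← hf e]
    congr 1
    ext e'
    simp only [W, Finset.mem_filter, Finset.mem_univ, true_and] at he ⊢
    constructor
    · exact fun h => h.2
    · intro h; refine ⟨?_, h⟩
      rw [← hφ, h, hφ, he]
  have hle : ∀ j ∈ (univ : Finset (Fin k)), (W.filter fun e => c e = j).card ≤ (W.image f).card := by
    intro j _
    rw [← Finset.card_image_of_injOn (s := W.filter fun e => c e = j) (f := f)]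
    · exact Finset.card_le_card (Finset.image_subset_image (Finset.filter_subset _ _))
    · intro e he e' he' h
      rw [Finset.mem_coe, Finset.mem_filter] at he he'
      exact hc e e' h (by rw [he.2, he'.2])
  have hsum : ∑ j : Fin k, (W.filter fun e => c e = j).card = ∑ j : Fin k, (W.image f).card := by
    rw [← Finset.card_eq_sum_card_fiberwise (f := c) (t := univ) (by intro e _; simp), hW]
    simp [mul_comm]
  have := (Finset.sum_eq_sum_iff_of_le hle).1 hsum j (Finset.mem_univ j)
  have h2 : (univ.filter fun e => φ e = v ∧ c e = j) = W.filter fun e => c e = j := by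
    ext e; simp [W]
  rw [h2, this, mul_comm, ← hW]

end p5
end RF

namespace RF

theorem mdeg_sum [DecidableEq V] (ends : E → V × V) (S : Finset E) (v : V) :
    (mdeg ends S v : ℤ) = ∑ e ∈ S, (chi v (ends e).1 + chi v (ends e).2) := by
  unfold mdeg chi
  rw [Finset.sum_add_distrib, Finset.sum_boole, Finset.sum_boole]
  push_cast; rfl

theorem cut_dH [Fintype E] [DecidableEq V] (ends : E → V × V) (A : Finset V) :
    (cutCard ends A : ℤ) = dH univ (fun e => (ends e).1) (fun e => (ends e).2) A := by
  unfold cutCard dH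
  rw [Finset.card_filter]
  push_cast
  apply Finset.sum_congr rfl
  intro e _
  unfold cv
  by_cases h1 : (ends e).1 ∈ A <;> by_cases h2 : (ends e).2 ∈ A <;> simp [h1, h2]

theorem orient [Fintype V] [Fintype E] [DecidableEq V] [DecidableEq E]
    (ends : E → V × V) (k r : ℕ) (hk : 2 ≤ k) (hr : Odd r)
    (hreg : ∀ v : V, mdeg ends univ v = k * r)
    (horder : Even (Fintype.card V))
    (hconn : ∀ A : Finset V, Odd A.card → 3 * k - 2 ≤ cutCard ends A) :
    Solv (k : ℤ) univ (fun e => (ends e).1) (fun e => (ends e).2) univ (fun _ => (k : ℤ)) := by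
  have hk0 : (0 : ℤ) < k := by exact_mod_cast (by omega : 0 < k)
  apply outer (by exact_mod_cast hk) _ univ _ _ univ ∅ _ (Nat.lt_succ_self _)
  · simp
  · simp
  · intro v _ _ h
    have := Int.le_of_dvd hk0 h
    omega
  · obtain ⟨t, ht⟩ := horder
    rw [Finset.sum_const, Finset.card_univ, ht]
    exact ⟨t, by push_cast; simp; ring⟩
  · intro A _
    have h1 : ∑ v ∈ A, (mdeg ends univ v : ℤ) = ∑ e : E, (ind A (ends e).1 + ind A (ends e).2) := by
      simp only [mdeg_sum]
      rw [Finset.sum_comm]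
      apply Finset.sum_congr rfl
      intro e _
      rw [Finset.sum_add_distrib, sum_chi, sum_chi]
    have h2 : (2 : ℤ) ∣ dH univ (fun e => (ends e).1) (fun e => (ends e).2) A
        + ∑ e : E, (ind A (ends e).1 + ind A (ends e).2) := by
      unfold dH
      rw [← Finset.sum_add_distrib]
      apply Finset.dvd_sum
      intro e _
      change (2 : ℤ) ∣ cv A (ends e).1 (ends e).2 + (ind A (ends e).1 + ind A (ends e).2)
      unfold cv ind
      by_cases h1 : (ends e).1 ∈ A <;> by_cases h2 : (ends e).2 ∈ A <;> simp [h1, h2]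
    rw [← h1] at h2
    simp only [hreg, Finset.sum_const] at h2 ⊢
    obtain ⟨t, ht⟩ := hr
    subst ht
    simp only [nsmul_eq_mul] at h2 ⊢
    have h3 : (A.card : ℤ) * ((k * (2 * t + 1) : ℕ) : ℤ) = 2 * (A.card * k * t) + A.card * k := by
      push_cast; ring
    rw [h3] at h2
    omega
  · intro A _ h
    rw [← cut_dH]
    have hodd : Odd A.card := by
      by_contra h'
      rw [Nat.not_odd_iff_even] at h'
      obtain ⟨t, ht⟩ := h'
      apply h
      rw [Finset.sum_const, ht]
      exact ⟨t, by push_cast; simp; ring⟩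
    have := hconn A hodd
    omega

theorem sum_sign [Fintype E] [DecidableEq V] (p q : E → V) (s : E → ℤ)
    (hs : ∀ e, s e = 1 ∨ s e = -1) (v : V) :
    ∑ e, s e * (chi v (p e) - chi v (q e)) =
      ((univ.filter fun e => (if s e = 1 then p e else q e) = v).card : ℤ) -
      ((univ.filter fun e => (if s e = 1 then q e else p e) = v).card : ℤ) := by
  rw [Finset.card_filter, Finset.card_filter]
  push_cast
  rw [← Finset.sum_sub_distrib]
  apply Finset.sum_congr rfl
  intro e _
  unfold chi
  rcases hs e with h | h <;> simp [h]

theorem mdeg_split [DecidableEq V] (ends : E → V × V) (S : Finset E) (s : E → ℤ) (v : V) :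
    mdeg ends S v = (S.filter fun e => (if s e = 1 then (ends e).1 else (ends e).2) = v).card +
      (S.filter fun e => (if s e = 1 then (ends e).2 else (ends e).1) = v).card := by
  unfold mdeg
  simp only [Finset.card_filter]
  rw [← Finset.sum_add_distrib, ← Finset.sum_add_distrib]
  apply Finset.sum_congr rfl
  intro e _
  by_cases h : s e = 1 <;> simp [h, add_comm]

end RF

/-- A `kr`-regular multigraph of even order with `d_G(A) ≥ 3k−2` for every odd-size
vertex set `A` decomposes into `k` `r`-regular factors (`r` odd). -/
theorem regular_factorization [Fintype V] [Fintype E] [DecidableEq V]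
    (ends : E → V × V) (k r : ℕ) (hk : 0 < k) (hr : Odd r)
    (hreg : ∀ v : V, mdeg ends univ v = k * r)
    (horder : Even (Fintype.card V))
    (hconn : ∀ A : Finset V, Odd A.card → 3 * k - 2 ≤ cutCard ends A) :
    ∃ c : E → Fin k, ∀ v : V, ∀ i : Fin k,
      mdeg ends (univ.filter fun e => c e = i) v = r := by
  classical
  by_cases hk1 : k = 1
  · subst hk1
    refine ⟨fun _ => 0, fun v i => ?_⟩
    have : (univ.filter fun _ : E => (0 : Fin 1) = i) = univ :=
      Finset.filter_true_of_mem fun e _ => Subsingleton.elim _ _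
    rw [this, hreg, one_mul]
  · obtain ⟨s, hs, hsv⟩ := RF.orient ends k r (by omega) hr hreg horder hconn
    let tl : E → V := fun e => if s e = 1 then (ends e).1 else (ends e).2
    let hd : E → V := fun e => if s e = 1 then (ends e).2 else (ends e).1
    have hdeg : ∀ v, (univ.filter fun e => tl e = v).card + (univ.filter fun e => hd e = v).card
        = k * r := by
      intro v; rw [← hreg v, RF.mdeg_split ends univ s v]
    have hdiv1 : ∀ v, k ∣ (univ.filter fun e => tl e = v).card := by
      intro v
      have h1 := hsv v (Finset.mem_univ v)
      rw [RF.sum_sign _ _ s hs] at h1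
      change 2 * (k : ℤ) ∣ ((univ.filter fun e => tl e = v).card : ℤ) -
        ((univ.filter fun e => hd e = v).card : ℤ) - k at h1
      have h2 := hdeg v
      obtain ⟨j, hj⟩ := h1
      obtain ⟨t, ht⟩ := hr
      have h3 : ((univ.filter fun e => tl e = v).card : ℤ) +
        ((univ.filter fun e => hd e = v).card : ℤ) = k * (2 * t + 1) := by
        rw [ht] at h2; exact_mod_cast h2
      have h4 : ((univ.filter fun e => tl e = v).card : ℤ) = k * (1 + j + t) := by
        linarith
      exact Int.natCast_dvd_natCast.1 ⟨_, h4⟩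
    have hdiv2 : ∀ v, k ∣ (univ.filter fun e => hd e = v).card := by
      intro v
      exact (Nat.dvd_add_right (hdiv1 v)).1 ((hdeg v).symm ▸ Dvd.intro _ rfl)
    obtain ⟨f, hf1, hf2⟩ := RF.split_all univ tl hdiv1
    obtain ⟨g, hg1, hg2⟩ := RF.split_all univ hd hdiv2
    obtain ⟨c, hc, hcf, hcg⟩ := RF.colour k univ hf2 hg2
    let c' : E → Fin k := fun e => ⟨c e, hc e (Finset.mem_univ e)⟩
    refine ⟨c', fun v i => ?_⟩
    have e1 := RF.count hf1 (fun e => hf2 e (Finset.mem_univ e)) c' (fun e e' h h' =>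
      hcf e (Finset.mem_univ e) e' (Finset.mem_univ e') h (congrArg Fin.val h')) v i
    have e2 := RF.count hg1 (fun e => hg2 e (Finset.mem_univ e)) c' (fun e e' h h' =>
      hcg e (Finset.mem_univ e) e' (Finset.mem_univ e') h (congrArg Fin.val h')) v i
    rw [RF.mdeg_split ends _ s v, Finset.filter_filter, Finset.filter_filter]
    apply Nat.eq_of_mul_eq_mul_left hk
    rw [← hdeg v, ← e1, ← e2, mul_add]
    simp only [and_comm, tl, hd]
end
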